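/- arXiv:1912.07858 — 3 statements merged into one kernel-verified Lean document; each statement's English description precedes it below -/
import Mathlib

section
/- For every fixed real ε₀ > 0 there exists a constant N such that for every d-regular simple graph G with n vertices, where n ≥ N and ln^{1+ε₀} n ≤ d ≤ n / ln^{ε₀} n, the irregularity strength of G satisfies s(G) ≤ (n/d)·(1 + 1/ln^{ε₀/19} n). -/
open Finset

/-- The weighted degree of a vertex `v` under an edge weighting `ω`:
the sum of the weights of the edges incident to `v`. -/
def weightedDeg {V : Type} (G : SimpleGraph V) [Fintype V] [DecidableRel G.Adj]
    (ω : Sym2 V → ℕ) (v : V) : ℕ :=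
  ∑ u ∈ G.neighborFinset v, ω s(v, u)

/-- The irregularity strength of `G`: the least `k` such that some weighting
`ω : E(G) → {1, …, k}` yields pairwise distinct weighted degrees. -/
noncomputable def irregularityStrength {V : Type} (G : SimpleGraph V) [Fintype V]
    [DecidableRel G.Adj] : ℕ :=
  sInf {k : ℕ | ∃ ω : Sym2 V → ℕ,
    (∀ e ∈ G.edgeSet, 1 ≤ ω e ∧ ω e ≤ k) ∧
    ∀ u v : V, u ≠ v → weightedDeg G ω u ≠ weightedDeg G ω v}

/-- If every interval `[a, b]` contains at most `b - a + 1 + R` values of `f` on `S`, then the values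
can be made distinct by increasing each of them by at most `R`. -/
theorem exists_injOn_le_add {α : Type*} [DecidableEq α] (f : α → ℕ) (R : ℕ) (S : Finset α)
    (h : ∀ a b, a ≤ b → #{v ∈ S | a ≤ f v ∧ f v ≤ b} + a ≤ b + 1 + R) :
    ∃ t : α → ℕ, Set.InjOn t S ∧ ∀ v ∈ S, f v ≤ t v ∧ t v ≤ f v + R := by
  suffices H : ∃ t : α → ℕ, Set.InjOn t S ∧ ∀ v ∈ S, f v ≤ t v ∧
      ∃ u ∈ S, f u ≤ f v ∧ t v + 1 ≤ f u + #{w ∈ S | f u ≤ f w ∧ f w ≤ f v} by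
    obtain ⟨t, ht, H⟩ := H
    refine ⟨t, ht, fun v hv => ⟨(H v hv).1, ?_⟩⟩
    obtain ⟨-, u, -, huv, hu⟩ := H v hv
    have := h _ _ huv
    omega
  clear h
  induction S using Finset.induction_on_max_value f with
  | empty => exact ⟨fun _ => 0, by simp⟩
  | insert a s ha hmax ih =>
    obtain ⟨t, ht, H⟩ := ih
    have hmono : ∀ p q : ℕ, #{w ∈ s | p ≤ f w ∧ f w ≤ q} ≤
        #{w ∈ insert a s | p ≤ f w ∧ f w ≤ q} := fun p q =>
      card_le_card (filter_subset_filter _ (subset_insert _ _))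
    have key : ∃ x : ℕ, f a ≤ x ∧ (∀ v ∈ s, t v < x) ∧ ∃ u ∈ insert a s, f u ≤ f a ∧
        x + 1 ≤ f u + #{w ∈ insert a s | f u ≤ f w ∧ f w ≤ f a} := by
      by_cases hlt : ∀ v ∈ s, t v < f a
      · refine ⟨f a, le_rfl, hlt, a, mem_insert_self _ _, le_rfl, ?_⟩
        have : 0 < #{w ∈ insert a s | f a ≤ f w ∧ f w ≤ f a} :=
          card_pos.2 ⟨a, by simp⟩
        omega
      · push Not at hlt
        obtain ⟨v, hv, hva⟩ := hlt
        obtain ⟨m, hm, hmm⟩ := exists_max_image s t ⟨v, hv⟩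
        obtain ⟨-, u, hu, hum, hcard⟩ := H m hm
        refine ⟨t m + 1, (hva.trans (hmm v hv)).trans (Nat.le_succ _),
          fun v hv => Nat.lt_succ_of_le (hmm v hv), u, mem_insert_of_mem hu, hmax u hu, ?_⟩
        have : #{w ∈ s | f u ≤ f w ∧ f w ≤ f m} + 1 ≤
            #{w ∈ insert a s | f u ≤ f w ∧ f w ≤ f a} := by
          rw [← card_insert_of_notMem (a := a) (by simp [ha])]
          apply card_le_card
          intro w hw
          simp only [mem_insert, mem_filter] at hw ⊢
          rcases hw with rfl | ⟨hw, h1, h2⟩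
          · exact ⟨Or.inl rfl, hmax u hu, le_rfl⟩
          · exact ⟨Or.inr hw, h1, hmax w hw⟩
        omega
    obtain ⟨x, hx, hlt, u, hu, hua, hcard⟩ := key
    have hne : ∀ v ∈ s, v ≠ a := fun v hv => ne_of_mem_of_not_mem hv ha
    refine ⟨Function.update t a x, ?_, ?_⟩
    · rw [coe_insert, Set.injOn_insert (by simpa using ha)]
      refine ⟨fun p hp q hq hpq => ?_, ?_⟩
      · rw [Function.update_of_ne (hne p hp), Function.update_of_ne (hne q hq)] at hpq
        exact ht hp hq hpq
      · rintro ⟨p, hp, hpx⟩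
        rw [Function.update_of_ne (hne p hp), Function.update_self] at hpx
        exact (hlt p hp).ne hpx
    · intro v hv
      rcases mem_insert.1 hv with rfl | hv
      · rw [Function.update_self]
        exact ⟨hx, u, hu, hua, hcard⟩
      · rw [Function.update_of_ne (hne v hv)]
        obtain ⟨h1, u, hu, huv, hc⟩ := H v hv
        exact ⟨h1, u, mem_insert_of_mem hu, huv, hc.trans (by gcongr; exact subset_insert _ _)⟩

/-- If every interval `[a, b]` contains at most `(b - a) / 2 + R` values of `f` on `S`, then the
values can be increased so that the pairs `{t v, t v + M}` become disjoint. -/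
theorem exists_disjoint_pairs {α : Type*} [DecidableEq α] (f : α → ℕ) {M : ℕ} (hM : 0 < M) (R : ℕ)
    (S : Finset α)
    (h : ∀ a b, a ≤ b → 2 * #{v ∈ S | a ≤ f v ∧ f v ≤ b} ≤ (b - a) + 2 * R) :
    ∃ t : α → ℕ, (∀ v ∈ S, f v ≤ t v ∧ t v ≤ f v + (2 * R + 4 * M)) ∧
      ∀ u ∈ S, ∀ v ∈ S, u ≠ v → t u ≠ t v ∧ t u ≠ t v + M := by
  let τ : α → ℕ := fun v => M * (f v / (2 * M) + 1)
  have hτ : ∀ v, f v < 2 * τ v ∧ 2 * τ v ≤ f v + 2 * M := by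
    intro v
    have h1 := Nat.div_add_mod (f v) (2 * M)
    have h2 := Nat.mod_lt (f v) (show 0 < 2 * M by omega)
    have h3 : 2 * τ v = 2 * M * (f v / (2 * M)) + 2 * M := by simp only [τ]; ring
    omega
  obtain ⟨k, hk, hkτ⟩ := exists_injOn_le_add τ (M + R) S (by
    intro a b hab
    have h1 := h (2 * a - 2 * M) (2 * b) (by omega)
    have h2 : #{v ∈ S | a ≤ τ v ∧ τ v ≤ b} ≤ #{v ∈ S | 2 * a - 2 * M ≤ f v ∧ f v ≤ 2 * b} := by
      apply card_le_card
      intro v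
      simp only [mem_filter]
      rintro ⟨hv, h3, h4⟩
      have := hτ v
      exact ⟨hv, by omega, by omega⟩
    omega)
  refine ⟨fun v => k v + M * (k v / M), fun v hv => ?_, fun u hu v hv huv => ?_⟩
  · obtain ⟨h1, h2⟩ := hkτ v hv
    have h3 := hτ v
    have h4 : M * (k v / M) ≤ k v := Nat.mul_div_le _ _
    have h5 : τ v ≤ M * (k v / M) := by
      refine Nat.mul_le_mul_left _ ?_
      rw [Nat.le_div_iff_mul_le hM, mul_comm]
      exact h1
    dsimp only
    omega
  · have hne : k u ≠ k v := fun e => huv (hk hu hv e)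
    have hu1 := Nat.div_add_mod (k u) M
    have hv1 := Nat.div_add_mod (k v) M
    have hu2 := Nat.mod_lt (k u) hM
    have hv2 := Nat.mod_lt (k v) hM
    have hrep : ∀ v, k v + M * (k v / M) = k v % M + (2 * M) * (k v / M) := by
      intro v
      have := Nat.div_add_mod (k v) M
      linarith
    dsimp only
    rw [hrep u, hrep v]
    constructor
    · intro e
      have hmod := congrArg (· % (2 * M)) e
      simp only [Nat.add_mul_mod_self_left] at hmod
      rw [Nat.mod_eq_of_lt (show k u % M < 2 * M by omega),
        Nat.mod_eq_of_lt (show k v % M < 2 * M by omega)] at hmod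
      rw [hmod, Nat.add_left_cancel_iff] at e
      have := Nat.eq_of_mul_eq_mul_left (by omega) e
      rw [this] at hu1
      omega
    · intro e
      rw [add_right_comm] at e
      have hmod := congrArg (· % (2 * M)) e
      simp only [Nat.add_mul_mod_self_left] at hmod
      rw [Nat.mod_eq_of_lt (show k u % M < 2 * M by omega),
        Nat.mod_eq_of_lt (show k v % M + M < 2 * M by omega)] at hmod
      omega

/-- A total of at most `A * #N` can be distributed over `N` with at most `A` on each element. -/
theorem exists_sum_eq_of_le_mul_card {α : Type*} [DecidableEq α] (A : ℕ) (N : Finset α) (T : ℕ)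
    (h : T ≤ A * #N) : ∃ c : α → ℕ, (∀ u, c u ≤ A) ∧ (∀ u ∉ N, c u = 0) ∧ ∑ u ∈ N, c u = T := by
  induction N using Finset.induction_on generalizing T with
  | empty => exact ⟨fun _ => 0, by simp_all⟩
  | insert a s ha ih =>
    rw [card_insert_of_notMem ha, mul_add, mul_one] at h
    obtain ⟨c, h1, h2, h3⟩ := ih (T - min T A) (by omega)
    refine ⟨Function.update c a (min T A), fun u => ?_, fun u hu => ?_, ?_⟩
    · by_cases hu : u = a
      · subst hu; simp
      · simpa [hu] using h1 u
    · rw [mem_insert, not_or] at hu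
      simpa [hu.1] using h2 u hu.2
    · rw [sum_insert ha, Function.update_self,
        sum_congr rfl (fun u hu => Function.update_of_ne (ne_of_mem_of_not_mem hu ha) _ _), h3]
      omega

/-- Moving arbitrary amounts of residue from each `z ∈ Z` to a different element `π z` of `Z`, all
residue classes can be made to have nearly average size. -/
theorem exists_balanced_residues {β : Type*} [DecidableEq β] {M : ℕ} [NeZero M] (Z : Finset β)
    (π : β → β) (hπ : ∀ z ∈ Z, π z ≠ z) {q : ℕ} (hq : 2 * #Z < M * q) (r : β → ZMod M) :
    ∃ c : β → ZMod M, ∀ ρ : ZMod M,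
      #{z ∈ Z | r z + c z - ∑ z' ∈ Z with π z' = z, c z' = ρ} ≤ q + 1 := by
  have key : ∀ F ⊆ Z, ∀ r : β → ZMod M,
      (∀ ρ, #{z ∈ Z \ (F ∪ F.image π) | r z = ρ} ≤ q + 1) →
      ∃ c : β → ZMod M, ∀ ρ : ZMod M,
        #{z ∈ Z | r z + (if z ∈ F then c z else 0) - ∑ z' ∈ F with π z' = z, c z' = ρ} ≤ q + 1 := by
    intro F
    induction F using Finset.induction_on with
    | empty =>
      intro _ r hr
      exact ⟨0, by simpa using hr⟩
    | insert a F ha ih =>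
      intro hF r hr
      have haZ : a ∈ Z := hF (mem_insert_self _ _)
      set T' := Z \ (insert a F ∪ (insert a F).image π) with hT'
      let full : Finset (ZMod M) := {ρ | q ≤ #{z ∈ T' | r z = ρ}}
      have hfull : 2 * #full < M := by
        have h1 : #full * q ≤ #T' := by
          rw [← smul_eq_mul, card_eq_sum_card_fiberwise (f := r) (s := T') (t := univ) (by simp)]
          calc #full • q ≤ ∑ ρ ∈ full, #{z ∈ T' | r z = ρ} :=
                card_nsmul_le_sum _ _ _ (fun ρ hρ => (mem_filter.1 hρ).2)
            _ ≤ _ := sum_le_sum_of_subset (subset_univ _)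
        have h2 : #T' ≤ #Z := card_le_card sdiff_subset
        have h3 : 2 * #full * q < M * q := by nlinarith
        exact lt_of_mul_lt_mul_right h3 (Nat.zero_le _)
      obtain ⟨x, hx⟩ : ∃ x : ZMod M, x ∉ full.image (fun ρ => ρ - r a) ∪
          full.image (fun ρ => r (π a) - ρ) := by
        by_contra! hcon
        have h1 : #(univ : Finset (ZMod M)) ≤ #(full.image (fun ρ => ρ - r a) ∪
            full.image (fun ρ => r (π a) - ρ)) := card_le_card (fun x _ => hcon x)
        rw [card_univ, ZMod.card] at h1
        have h2 := card_union_le (full.image (fun ρ => ρ - r a)) (full.image (fun ρ => r (π a) - ρ))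
        have h3 := card_image_le (s := full) (f := fun ρ => ρ - r a)
        have h4 := card_image_le (s := full) (f := fun ρ => r (π a) - ρ)
        omega
      simp only [mem_union, mem_image, not_or, not_exists, not_and] at hx
      have hxa : r a + x ∉ full := fun h => hx.1 _ h (by ring)
      have hxp : r (π a) - x ∉ full := fun h => hx.2 _ h (by ring)
      let r' : β → ZMod M := fun z => r z + (if z = a then x else 0) - if π a = z then x else 0
      have hne := hπ a haZ
      obtain ⟨c, hc⟩ := ih (fun z hz => hF (mem_insert_of_mem hz)) r' (by
        intro ρ
        have hsub : {z ∈ Z \ (F ∪ F.image π) | r' z = ρ} ⊆ {z ∈ T' | r z = ρ} ∪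
            (if r a + x = ρ then {a} else ∅) ∪ (if r (π a) - x = ρ then {π a} else ∅) := by
          intro z hz
          rw [mem_filter, mem_sdiff] at hz
          obtain ⟨⟨hzZ, hzF⟩, hzρ⟩ := hz
          by_cases hza : z = a
          · subst hza
            have : r z + x = ρ := by simpa [r', hne] using hzρ
            simp [this]
          · by_cases hzp : π a = z
            · subst hzp
              have : r (π a) - x = ρ := by simpa [r', hne] using hzρ
              simp [this]
            · have h1 : r z = ρ := by simpa [r', hza, hzp] using hzρ
              have h2 : z ∈ T' := by
                rw [hT', mem_sdiff]
                refine ⟨hzZ, fun h => hzF ?_⟩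
                simp only [image_insert, mem_union, mem_insert, hza, Ne.symm hzp, false_or] at h ⊢
                exact h
              simp [h1, h2]
        have h1 := card_le_card hsub
        by_cases h2 : r a + x = ρ ∨ r (π a) - x = ρ
        · have h3 : ρ ∉ full := by rcases h2 with h | h <;> rwa [← h]
          simp only [full, mem_filter, mem_univ, true_and, not_le] at h3
          have h4 := card_union_le ({z ∈ T' | r z = ρ} ∪ (if r a + x = ρ then {a} else ∅))
            (if r (π a) - x = ρ then {π a} else ∅)
          have h5 := card_union_le {z ∈ T' | r z = ρ} (if r a + x = ρ then {a} else ∅)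
          have h6 : #(if r a + x = ρ then ({a} : Finset β) else ∅) ≤ 1 := by split_ifs <;> simp
          have h7 : #(if r (π a) - x = ρ then ({π a} : Finset β) else ∅) ≤ 1 := by
            split_ifs <;> simp
          omega
        · rw [not_or] at h2
          rw [if_neg h2.1, if_neg h2.2, union_empty, union_empty] at h1
          exact h1.trans (hr ρ))
      refine ⟨Function.update c a x, fun ρ => le_of_eq_of_le ?_ (hc ρ)⟩
      congr 1
      refine filter_congr fun z _ => ?_
      have hsum : ∑ z' ∈ insert a F with π z' = z, Function.update c a x z' =
          (if π a = z then x else 0) + ∑ z' ∈ F with π z' = z, c z' := by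
        rw [sum_filter, sum_insert ha, Function.update_self, sum_filter]
        congr 1
        exact sum_congr rfl fun z' hz' => by
          rw [Function.update_of_ne (ne_of_mem_of_not_mem hz' ha)]
      have hval : (if z ∈ insert a F then Function.update c a x z else 0) =
          (if z = a then x else 0) + if z ∈ F then c z else 0 := by
        by_cases hza : z = a
        · subst hza; simp [ha]
        · simp [hza]
      rw [hsum, hval]
      simp only [r']
      constructor <;> intro h <;> rw [← h] <;> ring
  obtain ⟨c, hc⟩ := key Z Subset.rfl r (by
    intro ρ
    rw [sdiff_eq_empty_iff_subset.2 subset_union_left]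
    simp)
  refine ⟨c, fun ρ => le_of_eq_of_le ?_ (hc ρ)⟩
  congr 1
  exact filter_congr fun z hz => by rw [if_pos hz]

/-- Toggling each `y` between two states `M` apart along the edges to `z`, one `z` at a time, makes
the values on `Z` distinct, provided that residue classes modulo `M` are not larger than degrees. -/
theorem exists_toggle_injOn {α β : Type*} [DecidableEq α] [DecidableEq β] (A : α → β → Prop)
    [∀ y z, Decidable (A y z)] (Y : Finset α) (Z : Finset β) {M : ℕ} (hM : 0 < M) (C : β → ℤ)
    (hC : ∀ z ∈ Z, #{z' ∈ Z | (M : ℤ) ∣ C z' - C z} ≤ #{y ∈ Y | A y z} + 1) :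
    ∃ h : α → β → ℤ, (∀ y z, |h y z| ≤ M) ∧ (∀ y z, h y z ≠ 0 → y ∈ Y ∧ z ∈ Z ∧ A y z) ∧
      (∀ y, ∑ z ∈ Z, h y z = 0 ∨ ∑ z ∈ Z, h y z = M) ∧
      Set.InjOn (fun z => C z + ∑ y ∈ Y, h y z) Z := by
  suffices H : ∀ Z' ⊆ Z, ∃ h : α → β → ℤ, (∀ y z, |h y z| ≤ M) ∧ (∀ y z, (M : ℤ) ∣ h y z) ∧
      (∀ y z, h y z ≠ 0 → y ∈ Y ∧ z ∈ Z' ∧ A y z) ∧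
      (∀ y, ∑ z ∈ Z', h y z = 0 ∨ ∑ z ∈ Z', h y z = M) ∧
      Set.InjOn (fun z => C z + ∑ y ∈ Y, h y z) Z' by
    obtain ⟨h, h1, -, h2, h3, h4⟩ := H Z Subset.rfl
    exact ⟨h, h1, h2, h3, h4⟩
  intro Z'
  induction Z' using Finset.induction_on with
  | empty => exact fun _ => ⟨fun _ _ => 0, by simp⟩
  | insert z Z' hz ih =>
    intro hZ
    obtain ⟨h, hM1, hdvd, hsupp, hrow, hinj⟩ := ih ((subset_insert _ _).trans hZ)
    have hzZ : z ∈ Z := hZ (mem_insert_self _ _)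
    let N : Finset α := {y ∈ Y | A y z}
    let N₀ : Finset α := {y ∈ N | ∑ z ∈ Z', h y z = 0}
    let N₁ : Finset α := {y ∈ N | ¬ ∑ z ∈ Z', h y z = 0}
    have hN : #N₀ + #N₁ = #N := card_filter_add_card_filter_not _
    let δ : α → ℤ := fun y => if ∑ z ∈ Z', h y z = 0 then M else -M
    let val : β → ℤ := fun z => C z + ∑ y ∈ Y, h y z
    let cand : ℕ → ℤ := fun j => C z + M * ((j : ℤ) - #N₁)
    have hcand : Function.Injective cand := by
      intro i j hij
      have : (M : ℤ) * ((i : ℤ) - #N₁) = M * ((j : ℤ) - #N₁) := by simpa [cand] using hij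
      have := mul_left_cancel₀ (by exact_mod_cast hM.ne') this
      omega
    obtain ⟨j, hj, hjval⟩ : ∃ j ≤ #N, ∀ z' ∈ Z', val z' ≠ cand j := by
      by_contra! hcon
      have hsub : (range (#N + 1)).image cand ⊆
          ({z' ∈ Z | (M : ℤ) ∣ C z' - C z}.erase z).image val := by
        intro w hw
        obtain ⟨j, hj, rfl⟩ := mem_image.1 hw
        obtain ⟨z', hz', he⟩ := hcon j (Nat.lt_succ_iff.1 (mem_range.1 hj))
        refine mem_image.2 ⟨z', ?_, he⟩
        rw [mem_erase, mem_filter]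
        refine ⟨ne_of_mem_of_not_mem hz' hz, hZ (mem_insert_of_mem hz'), ?_⟩
        have : C z' - C z = M * ((j : ℤ) - #N₁) - ∑ y ∈ Y, h y z' := by
          simp only [val, cand] at he
          linarith
        rw [this]
        exact dvd_sub (dvd_mul_right _ _) (dvd_sum fun y _ => hdvd y z')
      have h1 := (card_le_card hsub).trans card_image_le
      rw [card_image_of_injective _ hcand, card_range, card_erase_of_mem (by simp [hzZ])] at h1
      have h2 := hC z hzZ
      change _ ≤ #N + 1 at h2
      omega
    obtain ⟨T, hTN, hT⟩ : ∃ T ⊆ N, ∑ y ∈ T, δ y = M * ((j : ℤ) - #N₁) := by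
      rcases le_total (#N₁) j with hle | hle
      · obtain ⟨T, hT, hTc⟩ := exists_subset_card_eq (s := N₀) (n := j - #N₁) (by omega)
        refine ⟨T, hT.trans (filter_subset _ _), ?_⟩
        rw [sum_congr rfl (g := fun _ => (M : ℤ)) (fun y hy => if_pos (mem_filter.1 (hT hy)).2),
          sum_const, hTc, nsmul_eq_mul]
        push_cast [hle]
        ring
      · obtain ⟨T, hT, hTc⟩ := exists_subset_card_eq (s := N₁) (n := #N₁ - j) (by omega)
        refine ⟨T, hT.trans (filter_subset _ _), ?_⟩
        rw [sum_congr rfl (g := fun _ => -(M : ℤ)) (fun y hy => if_neg (mem_filter.1 (hT hy)).2),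
          sum_const, hTc, nsmul_eq_mul]
        push_cast [hle]
        ring
    let h' : α → β → ℤ := fun y w => if w = z then (if y ∈ T then δ y else 0) else h y w
    have hδ : ∀ y, δ y = M ∨ δ y = -M := fun y => by simp only [δ]; split_ifs <;> simp
    have hold : ∀ y, ∀ w ∈ Z', h' y w = h y w := fun y w hw =>
      if_neg (ne_of_mem_of_not_mem hw hz)
    have hz0 : ∀ y, h' y z = if y ∈ T then δ y else 0 := fun y => if_pos rfl
    refine ⟨h', fun y w => ?_, fun y w => ?_, fun y w hyw => ?_, fun y => ?_, ?_⟩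
    · simp only [h']
      split_ifs
      · rcases hδ y with e | e <;> simp [e]
      · simp
      · exact hM1 y w
    · simp only [h']
      split_ifs
      · rcases hδ y with e | e <;> simp [e]
      · simp
      · exact hdvd y w
    · by_cases hw : w = z
      · subst hw
        rw [hz0] at hyw
        have hyT : y ∈ T := by by_contra hy; simp [hy] at hyw
        have := mem_filter.1 (hTN hyT)
        exact ⟨this.1, mem_insert_self _ _, this.2⟩
      · have : h y w ≠ 0 := by simpa [h', hw] using hyw
        obtain ⟨a, b, c⟩ := hsupp y w this
        exact ⟨a, mem_insert_of_mem b, c⟩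
    · rw [sum_insert hz, sum_congr rfl (hold y), hz0]
      by_cases hy : y ∈ T
      · rw [if_pos hy]
        rcases hrow y with e | e
        · right; simp [δ, e]
        · left
          simp [δ, e, hM.ne']
      · rw [if_neg hy, zero_add]
        exact hrow y
    · have hvz : C z + ∑ y ∈ Y, h' y z = cand j := by
        simp only [hz0, cand]
        rw [← sum_filter, filter_mem_eq_inter,
          inter_eq_right.2 (hTN.trans (filter_subset _ _)), hT]
      have hvo : ∀ w ∈ Z', C w + ∑ y ∈ Y, h' y w = val w := fun w hw => by
        simp only [val]
        rw [sum_congr rfl (fun y _ => hold y w hw)]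
      rw [coe_insert, Set.injOn_insert (by simpa using hz)]
      refine ⟨fun p hp p' hp' e => ?_, ?_⟩
      · dsimp only at e
        rw [hvo p hp, hvo p' hp'] at e
        exact hinj hp hp' e
      · rintro ⟨w, hw, e⟩
        dsimp only at e
        rw [hvz, hvo w hw] at e
        exact hjval w hw e

/-- In a bipartite graph between `Y` and `Z` with large degrees, weights of size at most `2 * M` can
be put on the edges so that the values on `Z` become distinct while each value on `Y` changes by
`0` or `M`. -/
theorem exists_bipartite_adjustment {α β : Type*} [DecidableEq α] [DecidableEq β]
    (A : α → β → Prop) [∀ y z, Decidable (A y z)] (Y : Finset α) (Z : Finset β) {M q : ℕ}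
    (hM : 0 < M) (C : β → ℤ) (hY : ∀ y ∈ Y, 2 ≤ #{z ∈ Z | A y z})
    (hZ : ∀ z ∈ Z, q ≤ #{y ∈ Y | A y z}) (hq : 2 * #Z < M * q) :
    ∃ h : α → β → ℤ, (∀ y z, |h y z| ≤ 2 * M) ∧ (∀ y z, h y z ≠ 0 → y ∈ Y ∧ z ∈ Z ∧ A y z) ∧
      (∀ y, ∑ z ∈ Z, h y z = 0 ∨ ∑ z ∈ Z, h y z = M) ∧
      Set.InjOn (fun z => C z + ∑ y ∈ Y, h y z) Z := by
  rcases Z.eq_empty_or_nonempty with rfl | ⟨z₀, hz₀⟩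
  · exact ⟨fun _ _ => 0, by simp⟩
  have : NeZero M := ⟨hM.ne'⟩
  have hq0 : 0 < q := Nat.pos_of_mul_pos_left (lt_of_le_of_lt (Nat.zero_le _) hq)
  have hnbr : ∀ z ∈ Z, ∃ y, y ∈ Y ∧ A y z := fun z hz => by
    obtain ⟨y, hy⟩ := card_pos.1 (hq0.trans_le (hZ z hz))
    exact ⟨y, mem_filter.1 hy⟩
  obtain ⟨l, hl⟩ : ∃ l : β → α, ∀ z ∈ Z, l z ∈ Y ∧ A (l z) z := by
    have : Nonempty α := ⟨(hnbr z₀ hz₀).choose⟩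
    choose! l hl using hnbr
    exact ⟨l, hl⟩
  have hperm : ∀ y, ∃ σ : Equiv.Perm β, (∀ z, σ z ≠ z → z ∈ Z ∧ A y z) ∧
      (∀ z ∈ Z, A y z → σ z ∈ Z ∧ A y (σ z)) ∧ (y ∈ Y → ∀ z ∈ Z, A y z → σ z ≠ z) := by
    intro y
    obtain ⟨σ, h1, h2⟩ := ({z ∈ Z | A y z} : Finset β).countable_toSet.exists_cycleOn
    refine ⟨σ, fun z hz => by simpa using h2 hz, fun z hz hyz => ?_, fun hy z hz hyz => ?_⟩
    · have := h1.1.mapsTo (x := z) (by simp [hz, hyz])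
      simpa using this
    · refine h1.apply_ne ?_ (by simp [hz, hyz])
      exact_mod_cast one_lt_card_iff_nontrivial.1 (hY y hy)
  choose σ hσsupp hσmem hσne using hperm
  let π : β → β := fun z => σ (l z) z
  obtain ⟨c, hc⟩ := exists_balanced_residues Z π
    (fun z hz => hσne _ (hl z hz).1 z hz (hl z hz).2) hq (fun z => (C z : ZMod M))
  let e : α → β → ℤ := fun y z => if z ∈ Z ∧ l z = y then ((c z).val : ℤ) else 0
  have he0 : ∀ y z, 0 ≤ e y z ∧ e y z ≤ M := by
    intro y z
    simp only [e]
    have := ZMod.val_lt (c z)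
    split_ifs <;> constructor <;> omega
  have hesupp : ∀ y z, e y z ≠ 0 → y ∈ Y ∧ z ∈ Z ∧ A y z := by
    intro y z hyz
    have : z ∈ Z ∧ l z = y := by by_contra hcon; simp [e, hcon] at hyz
    obtain ⟨hz, rfl⟩ := this
    exact ⟨(hl z hz).1, hz, (hl z hz).2⟩
  let h₁ : α → β → ℤ := fun y z => e y z - e y ((σ y).symm z)
  have h₁supp : ∀ y z, h₁ y z ≠ 0 → y ∈ Y ∧ z ∈ Z ∧ A y z := by
    intro y z hyz
    by_cases h0 : e y z = 0
    · have h1 : e y ((σ y).symm z) ≠ 0 := by simpa [h₁, h0] using hyz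
      obtain ⟨hy, hz, ha⟩ := hesupp _ _ h1
      have := hσmem y _ hz ha
      rw [Equiv.apply_symm_apply] at this
      exact ⟨hy, this⟩
    · exact hesupp _ _ h0
  have h₁row : ∀ y, ∑ z ∈ Z, h₁ y z = 0 := by
    intro y
    simp only [h₁]
    rw [sum_sub_distrib, sub_eq_zero]
    refine (Equiv.Perm.sum_comp (σ y).symm Z (e y) ?_).symm
    intro z hz
    have : σ y z ≠ z := fun h => hz (by rw [Equiv.symm_apply_eq, h])
    exact (hσsupp y z this).1
  have h₁col : ∀ z ∈ Z, ∑ y ∈ Y, h₁ y z =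
      ((c z).val : ℤ) - ∑ z' ∈ Z with π z' = z, ((c z').val : ℤ) := by
    intro z hz
    simp only [h₁]
    rw [sum_sub_distrib]
    congr 1
    · simp only [e, hz, true_and]
      rw [sum_ite_eq, if_pos (hl z hz).1]
    · have hmem : ∀ y, (σ y).symm z ∈ Z := by
        intro y
        by_cases hfix : (σ y).symm z = z
        · rwa [hfix]
        · exact (hσsupp y _ (by rw [Equiv.apply_symm_apply]; exact Ne.symm hfix)).1
      have h1 : ∀ y ∈ Y, e y ((σ y).symm z) =
          ∑ z' ∈ Z, if l z' = y ∧ π z' = z then ((c z').val : ℤ) else 0 := by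
        intro y _
        rw [sum_eq_single ((σ y).symm z)]
        · by_cases hzl : l ((σ y).symm z) = y
          · have hpz : π ((σ y).symm z) = z := by simp [π, hzl]
            simp [e, hzl, hpz, hmem y]
          · simp [e, hzl]
        · intro z' _ hne
          refine if_neg ?_
          rintro ⟨rfl, h2⟩
          exact hne (by rw [← h2]; simp [π])
        · exact fun h => absurd (hmem y) h
      rw [sum_congr rfl h1, sum_comm, sum_filter]
      refine sum_congr rfl fun z' hz' => ?_
      by_cases hp : π z' = z
      · simp only [hp, and_true, if_true]
        rw [sum_ite_eq, if_pos (hl z' hz').1]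
      · simp [hp]
  obtain ⟨h₂, h₂le, h₂supp, h₂row, h₂inj⟩ := exists_toggle_injOn A Y Z hM
    (fun z => C z + ∑ y ∈ Y, h₁ y z) (by
      intro z hz
      refine le_trans ?_ ((hc (((C z + ∑ y ∈ Y, h₁ y z : ℤ)) : ZMod M)).trans
        (Nat.succ_le_succ (hZ z hz)))
      apply card_le_card
      intro z' hz'
      rw [mem_filter] at hz' ⊢
      refine ⟨hz'.1, ?_⟩
      rw [← sub_eq_zero]
      have := (ZMod.intCast_zmod_eq_zero_iff_dvd _ M).2 hz'.2
      rw [← this, h₁col z' hz'.1]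
      push_cast
      simp
      ring)
  refine ⟨fun y z => h₁ y z + h₂ y z, fun y z => ?_, fun y z hyz => ?_, fun y => ?_, ?_⟩
  · have h1 := he0 y z
    have h2 := he0 y ((σ y).symm z)
    have h3 := abs_le.1 (h₂le y z)
    rw [abs_le]
    simp only [h₁]
    constructor <;> linarith
  · by_cases h0 : h₁ y z = 0
    · exact h₂supp y z (by simpa [h0] using hyz)
    · exact h₁supp y z h0
  · rw [sum_add_distrib, h₁row, zero_add]
    exact h₂row y
  · refine h₂inj.congr fun z _ => ?_
    simp only [sum_add_distrib, add_assoc]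

/-- Correction of a symmetric base weighting `W` along a partition `B`, `Y`, `Z` of the vertices:
the vertices of `B` are separated by weights on the edges to `Y`, those of `Y` by weights on the
edges to `Z`, and those of `Z` by shifting the vertices of `Y` within disjoint pairs. -/
theorem exists_weighting_of_layers {V : Type*} [Fintype V] [DecidableEq V] (G : SimpleGraph V)
    [DecidableRel G.Adj] {d : ℕ} (hd : G.IsRegularOfDegree d) (B Y Z : Finset V)
    (hcover : ∀ v, v ∈ B ∨ v ∈ Y ∨ v ∈ Z) (hdBY : Disjoint B Y) (hdBZ : Disjoint B Z)
    (hdYZ : Disjoint Y Z) (W : V → V → ℕ) (hsymm : ∀ u v, W u v = W v u) (hpos : ∀ u v, 1 ≤ W u v)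
    (σ : V → ℕ) (hσ : ∀ v, σ v = ∑ u ∈ G.neighborFinset v, W v u)
    {s A M RB RY q k θ₁ θ₂ : ℕ} (hM : 0 < M) (hθ : θ₁ ≤ θ₂)
    (hB : ∀ a b, a ≤ b → #{v ∈ B | a ≤ σ v ∧ σ v ≤ b} + a ≤ b + 1 + RB)
    (hBdeg : ∀ b ∈ B, RB ≤ s * #{u ∈ G.neighborFinset b | u ∈ Y})
    (hY : ∀ f : V → ℕ, (∀ v ∈ Y, σ v ≤ f v ∧ f v ≤ σ v + s * d) → ∀ a b, a ≤ b →
      2 * #{v ∈ Y | a ≤ f v ∧ f v ≤ b} ≤ (b - a) + 2 * RY)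
    (hYdeg : ∀ y ∈ Y, 2 * RY + 4 * M ≤ A * #{u ∈ G.neighborFinset y | u ∈ Z})
    (hYdeg2 : ∀ y ∈ Y, 2 ≤ #{u ∈ G.neighborFinset y | u ∈ Z})
    (hZdeg : ∀ z ∈ Z, q ≤ #{u ∈ G.neighborFinset z | u ∈ Y}) (hq : 2 * #Z < M * q)
    (hk : ∀ u v, W u v ≤ k) (hkBY : ∀ b ∈ B, ∀ y ∈ Y, W b y + s ≤ k)
    (hkYZ : ∀ y ∈ Y, ∀ z ∈ Z, 2 * M + 1 ≤ W y z ∧ W y z + A + 2 * M ≤ k)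
    (hθZ : ∀ z ∈ Z, σ z + (A + 2 * M) * d < θ₁)
    (hθY : ∀ y ∈ Y, θ₁ ≤ σ y ∧ σ y + s * d + A * d + M < θ₂) (hθB : ∀ b ∈ B, θ₂ ≤ σ b) :
    ∃ w : V → V → ℤ, (∀ u v, w u v = w v u) ∧ (∀ u v, 1 ≤ w u v ∧ w u v ≤ k) ∧
      Function.Injective fun v => ∑ u ∈ G.neighborFinset v, w v u := by
  have hdeg : ∀ v, #(G.neighborFinset v) = d := fun v => hd v
  have hθ' : (θ₁ : ℤ) ≤ θ₂ := by exact_mod_cast hθ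
  obtain ⟨t, htinj, ht⟩ := exists_injOn_le_add σ RB B hB
  have h1 : ∀ b, ∃ c : V → ℕ, (∀ u, c u ≤ s) ∧
      (∀ u, ¬ (b ∈ B ∧ G.Adj b u ∧ u ∈ Y) → c u = 0) ∧
      (b ∈ B → σ b + ∑ u ∈ G.neighborFinset b, c u = t b) := by
    intro b
    by_cases hb : b ∈ B
    · obtain ⟨c, hc1, hc2, hc3⟩ := exists_sum_eq_of_le_mul_card s
        {u ∈ G.neighborFinset b | u ∈ Y} (t b - σ b)
        (le_trans (by have := ht b hb; omega) (hBdeg b hb))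
      refine ⟨c, hc1, fun u hu => hc2 u (by simpa [hb] using hu), fun _ => ?_⟩
      rw [← sum_subset (filter_subset (· ∈ Y) _) (fun u _ hu => hc2 u hu), hc3]
      have := ht b hb
      omega
    · exact ⟨fun _ => 0, by simp, by simp, fun h => absurd h hb⟩
  choose h₁ h₁le h₁supp h₁sum using h1
  let f : V → ℕ := fun v => σ v + ∑ u ∈ G.neighborFinset v, h₁ u v
  have hf : ∀ v, f v ≤ σ v + s * d := by
    intro v
    have := sum_le_card_nsmul (G.neighborFinset v) (fun u => h₁ u v) s (fun u _ => h₁le u v)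
    rw [hdeg, smul_eq_mul] at this
    simp only [f]
    linarith [mul_comm s d]
  obtain ⟨t', ht', ht'disj⟩ := exists_disjoint_pairs f hM RY Y
    (hY f fun v _ => ⟨Nat.le_add_right _ _, hf v⟩)
  have h2 : ∀ y, ∃ c : V → ℕ, (∀ u, c u ≤ A) ∧
      (∀ u, ¬ (y ∈ Y ∧ G.Adj y u ∧ u ∈ Z) → c u = 0) ∧
      (y ∈ Y → f y + ∑ u ∈ G.neighborFinset y, c u = t' y) := by
    intro y
    by_cases hy : y ∈ Y
    · obtain ⟨c, hc1, hc2, hc3⟩ := exists_sum_eq_of_le_mul_card A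
        {u ∈ G.neighborFinset y | u ∈ Z} (t' y - f y)
        (le_trans (by have := ht' y hy; omega) (hYdeg y hy))
      refine ⟨c, hc1, fun u hu => hc2 u (by simpa [hy] using hu), fun _ => ?_⟩
      rw [← sum_subset (filter_subset (· ∈ Z) _) (fun u _ hu => hc2 u hu), hc3]
      have := ht' y hy
      omega
    · exact ⟨fun _ => 0, by simp, by simp, fun h => absurd h hy⟩
  choose h₂ h₂le h₂supp h₂sum using h2
  have hflip : ∀ (v : V) (S : Finset V),
      {u ∈ S | G.Adj v u} = {u ∈ G.neighborFinset v | u ∈ S} := by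
    intro v S
    ext u
    simp [and_comm]
  obtain ⟨h₃, h₃le, h₃supp, h₃row, h₃inj⟩ := exists_bipartite_adjustment G.Adj Y Z hM
    (fun z => (σ z : ℤ) + ∑ u ∈ G.neighborFinset z, (h₂ u z : ℤ))
    (fun y hy => by rw [hflip]; exact hYdeg2 y hy)
    (fun z hz => by simp only [G.adj_comm _ z]; rw [hflip]; exact hZdeg z hz) hq
  have h₃row' : ∀ y, ∑ z ∈ G.neighborFinset y, h₃ y z = ∑ z ∈ Z, h₃ y z := by
    intro y
    rw [← sum_filter_of_ne (s := Z) (p := (G.Adj y ·)) (fun z _ hz => (h₃supp y z hz).2.2), hflip]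
    exact (sum_filter_of_ne (fun z _ hz => (h₃supp y z hz).2.1)).symm
  have h₃col' : ∀ z, ∑ y ∈ G.neighborFinset z, h₃ y z = ∑ y ∈ Y, h₃ y z := by
    intro z
    rw [← sum_filter_of_ne (s := Y) (p := (G.Adj z ·)) (fun y _ hy => (h₃supp y z hy).2.2.symm),
      hflip]
    exact (sum_filter_of_ne (fun y _ hy => (h₃supp y z hy).1)).symm
  let w : V → V → ℤ := fun u v =>
    W u v + h₁ u v + h₁ v u + h₂ u v + h₂ v u + h₃ u v + h₃ v u
  have hBnot : ∀ v ∈ B, v ∉ Y ∧ v ∉ Z := fun v hv =>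
    ⟨disjoint_left.1 hdBY hv, disjoint_left.1 hdBZ hv⟩
  have hYnot : ∀ v ∈ Y, v ∉ B ∧ v ∉ Z := fun v hv =>
    ⟨disjoint_right.1 hdBY hv, disjoint_left.1 hdYZ hv⟩
  have hZnot : ∀ v ∈ Z, v ∉ B ∧ v ∉ Y := fun v hv =>
    ⟨disjoint_right.1 hdBZ hv, disjoint_right.1 hdYZ hv⟩
  have z₁ : ∀ u v, u ∉ B ∨ v ∉ Y → (h₁ u v : ℤ) = 0 := fun u v h => by
    exact_mod_cast h₁supp u v (by tauto)
  have z₂ : ∀ u v, u ∉ Y ∨ v ∉ Z → (h₂ u v : ℤ) = 0 := fun u v h => by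
    exact_mod_cast h₂supp u v (by tauto)
  have z₃ : ∀ u v, u ∉ Y ∨ v ∉ Z → h₃ u v = 0 := fun u v h => by
    by_contra hne
    have := h₃supp u v hne
    tauto
  have hwsymm : ∀ u v, w u v = w v u := fun u v => by
    simp only [w]
    rw [hsymm u v]
    ring
  have hsum : ∀ v, ∑ u ∈ G.neighborFinset v, w v u = σ v +
      ∑ u ∈ G.neighborFinset v, (h₁ v u : ℤ) + ∑ u ∈ G.neighborFinset v, (h₁ u v : ℤ) +
      ∑ u ∈ G.neighborFinset v, (h₂ v u : ℤ) + ∑ u ∈ G.neighborFinset v, (h₂ u v : ℤ) +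
      ∑ z ∈ Z, h₃ v z + ∑ y ∈ Y, h₃ y v := by
    intro v
    simp only [w, sum_add_distrib]
    rw [h₃row', h₃col', hσ v]
    push_cast
    rfl
  have hsumB : ∀ v ∈ B, ∑ u ∈ G.neighborFinset v, w v u = t v := by
    intro v hv
    obtain ⟨n1, n2⟩ := hBnot v hv
    have := h₁sum v hv
    rw [hsum, sum_eq_zero fun u _ => z₁ u v (.inr n1), sum_eq_zero fun u _ => z₂ v u (.inl n1),
      sum_eq_zero fun u _ => z₂ u v (.inr n2), sum_eq_zero fun u _ => z₃ v u (.inl n1),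
      sum_eq_zero fun u _ => z₃ u v (.inr n2), ← this]
    push_cast
    ring
  have hsumY : ∀ v ∈ Y, ∑ u ∈ G.neighborFinset v, w v u = t' v + ∑ z ∈ Z, h₃ v z := by
    intro v hv
    obtain ⟨n1, n2⟩ := hYnot v hv
    have := h₂sum v hv
    rw [hsum, sum_eq_zero fun u _ => z₁ v u (.inl n1),
      sum_eq_zero fun u _ => z₂ u v (.inr n2), sum_eq_zero fun u _ => z₃ u v (.inr n2), ← this]
    simp only [f]
    push_cast
    ring
  have hsumZ : ∀ v ∈ Z, ∑ u ∈ G.neighborFinset v, w v u =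
      σ v + ∑ u ∈ G.neighborFinset v, (h₂ u v : ℤ) + ∑ y ∈ Y, h₃ y v := by
    intro v hv
    obtain ⟨n1, n2⟩ := hZnot v hv
    rw [hsum, sum_eq_zero fun u _ => z₁ v u (.inl n1), sum_eq_zero fun u _ => z₁ u v (.inr n2),
      sum_eq_zero fun u _ => z₂ v u (.inl n2), sum_eq_zero fun u _ => z₃ v u (.inl n2)]
    ring
  have hltZ : ∀ v ∈ Z, ∑ u ∈ G.neighborFinset v, w v u < θ₁ := by
    intro v hv
    have e1 := sum_le_card_nsmul (G.neighborFinset v) (fun u => (h₂ u v : ℤ)) A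
      (fun u _ => by exact_mod_cast h₂le u v)
    have e2 := sum_le_card_nsmul (G.neighborFinset v) (fun u => h₃ u v) (2 * M)
      (fun u _ => (abs_le.1 (h₃le u v)).2)
    rw [hdeg, nsmul_eq_mul] at e1 e2
    rw [h₃col'] at e2
    have e3 : (σ v : ℤ) + (A + 2 * M) * d < θ₁ := by exact_mod_cast hθZ v hv
    rw [hsumZ v hv]
    linarith
  have hboundY : ∀ v ∈ Y, (θ₁ : ℤ) ≤ ∑ u ∈ G.neighborFinset v, w v u ∧
      ∑ u ∈ G.neighborFinset v, w v u < θ₂ := by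
    intro v hv
    rw [hsumY v hv]
    have e1 := sum_le_card_nsmul (G.neighborFinset v) (fun u => h₂ v u) A (fun u _ => h₂le v u)
    rw [hdeg, smul_eq_mul] at e1
    have e2 := h₂sum v hv
    have e3 := hf v
    have e4 := hθY v hv
    have e5 : σ v ≤ f v := Nat.le_add_right _ _
    rw [mul_comm A d] at e4
    rcases h₃row v with e | e <;> rw [e] <;> constructor <;> omega
  have hgeB : ∀ v ∈ B, (θ₂ : ℤ) ≤ ∑ u ∈ G.neighborFinset v, w v u := by
    intro v hv
    rw [hsumB v hv]
    exact_mod_cast (hθB v hv).trans (ht v hv).1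
  refine ⟨w, hwsymm, ?_, ?_⟩
  · have hBB : ∀ u ∈ B, ∀ v, v ∉ Y → 1 ≤ w u v ∧ w u v ≤ k := by
      intro u hu v hv
      obtain ⟨n1, n2⟩ := hBnot u hu
      simp only [w]
      rw [z₁ u v (.inr hv), z₁ v u (.inr n1), z₂ u v (.inl n1), z₂ v u (.inr n2),
        z₃ u v (.inl n1), z₃ v u (.inr n2)]
      have := hpos u v
      have := hk u v
      constructor <;> omega
    have hBY : ∀ u ∈ B, ∀ v ∈ Y, 1 ≤ w u v ∧ w u v ≤ k := by
      intro u hu v hv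
      obtain ⟨n1, n2⟩ := hBnot u hu
      simp only [w]
      rw [z₁ v u (.inr n1), z₂ u v (.inl n1), z₂ v u (.inr n2),
        z₃ u v (.inl n1), z₃ v u (.inr n2)]
      have := hpos u v
      have := hkBY u hu v hv
      have := h₁le u v
      constructor <;> omega
    have hYZ : ∀ u ∈ Y, ∀ v ∈ Z, 1 ≤ w u v ∧ w u v ≤ k := by
      intro u hu v hv
      obtain ⟨n1, n2⟩ := hYnot u hu
      obtain ⟨m1, m2⟩ := hZnot v hv
      simp only [w]
      rw [z₁ u v (.inl n1), z₁ v u (.inl m1), z₂ v u (.inr n2), z₃ v u (.inr n2)]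
      have := hkYZ u hu v hv
      have := h₂le u v
      have := abs_le.1 (h₃le u v)
      constructor <;> omega
    have hYY : ∀ u ∈ Y, ∀ v ∈ Y, 1 ≤ w u v ∧ w u v ≤ k := by
      intro u hu v hv
      obtain ⟨n1, n2⟩ := hYnot u hu
      obtain ⟨m1, m2⟩ := hYnot v hv
      simp only [w]
      rw [z₁ u v (.inl n1), z₁ v u (.inl m1), z₂ u v (.inr m2), z₂ v u (.inr n2),
        z₃ u v (.inr m2), z₃ v u (.inr n2)]
      have := hpos u v
      have := hk u v
      constructor <;> omega
    have hZZ : ∀ u ∈ Z, ∀ v ∈ Z, 1 ≤ w u v ∧ w u v ≤ k := by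
      intro u hu v hv
      obtain ⟨n1, n2⟩ := hZnot u hu
      obtain ⟨m1, m2⟩ := hZnot v hv
      simp only [w]
      rw [z₁ u v (.inl n1), z₁ v u (.inl m1), z₂ u v (.inl n2), z₂ v u (.inl m2),
        z₃ u v (.inl n2), z₃ v u (.inl m2)]
      have := hpos u v
      have := hk u v
      constructor <;> omega
    intro u v
    rcases hcover u with hu | hu | hu <;> rcases hcover v with hv | hv | hv
    · exact hBB u hu v (hBnot v hv).1
    · exact hBY u hu v hv
    · exact hBB u hu v (hZnot v hv).2
    · rw [hwsymm]; exact hBY v hv u hu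
    · exact hYY u hu v hv
    · exact hYZ u hu v hv
    · rw [hwsymm]; exact hBB v hv u (hZnot u hu).2
    · rw [hwsymm]; exact hYZ v hv u hu
    · exact hZZ u hu v hv
  · intro u v huv
    dsimp only at huv
    rcases hcover u with hu | hu | hu <;> rcases hcover v with hv | hv | hv
    · rw [hsumB u hu, hsumB v hv] at huv
      exact htinj hu hv (by exact_mod_cast huv)
    · linarith [hgeB u hu, (hboundY v hv).2]
    · linarith [hgeB u hu, hltZ v hv]
    · linarith [hgeB v hv, (hboundY u hu).2]
    · by_contra hne
      rw [hsumY u hu, hsumY v hv] at huv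
      have e1 := ht'disj u hu v hv hne
      have e2 := ht'disj v hv u hu (Ne.symm hne)
      rcases h₃row u with e | e <;> rcases h₃row v with e' | e' <;> rw [e, e'] at huv <;> omega
    · linarith [hltZ v hv, (hboundY u hu).1]
    · linarith [hgeB v hv, hltZ u hu]
    · linarith [hltZ u hu, (hboundY v hv).1]
    · rw [hsumZ u hu, hsumZ v hv] at huv
      exact h₃inj hu hv huv

open MeasureTheory ProbabilityTheory in
/-- The **Hoeffding inequality** for the uniform product measure, one-sided form. -/
theorem measure_pi_uniform_sum_ge_le {V α : Type*} [Fintype V] [Fintype α] [Nonempty α]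
    [MeasurableSpace α] [MeasurableSingletonClass α] (S : Finset V) (f : α → ℝ) {a : ℝ}
    (hf : ∀ j, f j ∈ Set.Icc a (a + 1)) {ε : ℝ} (hε : 0 ≤ ε) :
    (Measure.pi fun _ : V => (PMF.uniformOfFintype α).toMeasure).real
      {x | ε ≤ ∑ u ∈ S, f (x u) - #S * ((∑ j, f j) / Fintype.card α)} ≤
      Real.exp (-2 * ε ^ 2 / #S) := by
  set ν := (PMF.uniformOfFintype α).toMeasure with hν
  have hmean : ν[f] = (∑ j, f j) / Fintype.card α := by
    rw [hν, PMF.integral_eq_sum]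
    simp [PMF.uniformOfFintype_apply, div_eq_inv_mul, mul_sum]
  have hsub := hasSubgaussianMGF_of_mem_Icc (μ := ν) (X := f)
    (measurable_of_countable _).aemeasurable (Filter.Eventually.of_forall hf)
  rw [hmean] at hsub
  have hind := iIndepFun_pi (μ := fun _ : V => ν)
    (X := fun _ j => f j - (∑ j, f j) / Fintype.card α)
    fun _ => (measurable_of_countable _).aemeasurable
  have key := HasSubgaussianMGF.measure_sum_ge_le_of_iIndepFun hind (s := S)
    (c := fun _ => (‖a + 1 - a‖₊ / 2) ^ 2) (fun i _ => by
      have hmp := measurePreserving_eval (fun _ : V => ν) i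
      refine HasSubgaussianMGF.of_map (Y := fun x : V → α => x i)
        (X := fun j => f j - (∑ j, f j) / Fintype.card α) hmp.measurable.aemeasurable ?_
      rw [show (fun x : V → α => x i) = Function.eval i from rfl, hmp.map_eq]
      exact hsub) hε
  simp only [sum_sub_distrib, sum_const, nsmul_eq_mul] at key
  refine key.trans (le_of_eq ?_)
  congr 1
  have : a + 1 - a = 1 := by ring
  rw [this]
  push_cast
  rcases Nat.eq_zero_or_pos #S with h | h
  · simp [h]
  · have : (0 : ℝ) < #S := by exact_mod_cast h
    simp
    field_simp

open MeasureTheory ProbabilityTheory in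
/-- A labelling of the vertices of a regular graph for which the sum over every neighbourhood of
each function from a finite family is close to its mean. -/
theorem exists_labelling_of_concentration {V α ι : Type*} [Fintype V] [Fintype α] [Nonempty α]
    [Fintype ι] (G : SimpleGraph V) [DecidableRel G.Adj] {d : ℕ} (hd : G.IsRegularOfDegree d)
    (f : ι → α → ℝ) (hf : ∀ i j, f i j ∈ Set.Icc (0 : ℝ) 1) {η : ℝ} (hη : 0 ≤ η)
    (hsmall : 2 * Fintype.card V * Fintype.card ι * Real.exp (-2 * η ^ 2 * d) < 1) :
    ∃ x : V → α, ∀ v i, |∑ u ∈ G.neighborFinset v, f i (x u) -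
      d * ((∑ j, f i j) / Fintype.card α)| ≤ η * d := by
  let _ : MeasurableSpace α := ⊤
  set P := Measure.pi fun _ : V => (PMF.uniformOfFintype α).toMeasure with hP
  have hdeg : ∀ v, #(G.neighborFinset v) = d := fun v => hd v
  by_contra! hcon
  have hexp : -2 * (η * d) ^ 2 / d = -2 * η ^ 2 * d := by
    rcases Nat.eq_zero_or_pos d with h | h
    · simp [h]
    · have : (0 : ℝ) < d := by exact_mod_cast h
      field_simp
  have hup : ∀ v i, P.real {x | η * d ≤ ∑ u ∈ G.neighborFinset v, f i (x u) -
      d * ((∑ j, f i j) / Fintype.card α)} ≤ Real.exp (-2 * η ^ 2 * d) := by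
    intro v i
    have := measure_pi_uniform_sum_ge_le (G.neighborFinset v) (f i) (a := 0)
      (by simpa using hf i) (ε := η * d) (by positivity)
    rwa [hdeg, hexp] at this
  have hdown : ∀ v i, P.real {x | η * d ≤ ∑ u ∈ G.neighborFinset v, -f i (x u) -
      d * ((∑ j, -f i j) / Fintype.card α)} ≤ Real.exp (-2 * η ^ 2 * d) := by
    intro v i
    have := measure_pi_uniform_sum_ge_le (G.neighborFinset v) (fun j => -f i j) (a := -1)
      (fun j => ⟨by linarith [(hf i j).2], by linarith [(hf i j).1]⟩) (ε := η * d) (by positivity)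
    rwa [hdeg, hexp] at this
  have hcov : (Set.univ : Set (V → α)) ⊆ ⋃ p ∈ (univ : Finset (V × ι)),
      ({x | η * d ≤ ∑ u ∈ G.neighborFinset p.1, f p.2 (x u) -
        d * ((∑ j, f p.2 j) / Fintype.card α)} ∪
      {x | η * d ≤ ∑ u ∈ G.neighborFinset p.1, -f p.2 (x u) -
        d * ((∑ j, -f p.2 j) / Fintype.card α)}) := by
    intro x _
    obtain ⟨v, i, h⟩ := hcon x
    simp only [Set.mem_iUnion]
    refine ⟨(v, i), mem_univ _, ?_⟩
    rcases lt_abs.1 h with h | h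
    · exact Or.inl h.le
    · refine Or.inr ?_
      simp only [Set.mem_ofPred_eq, sum_neg_distrib, neg_div]
      linarith
  have hprob : IsProbabilityMeasure P := by rw [hP]; infer_instance
  have h1 : P.real Set.univ = 1 := by simp [hP]
  have h2 := (measureReal_mono hcov (measure_ne_top P _)).trans (measureReal_biUnion_finset_le _ _)
  have h3 := h2.trans (sum_le_sum fun p _ => (measureReal_union_le _ _).trans
    (add_le_add (hup p.1 p.2) (hdown p.1 p.2)))
  rw [h1, sum_const, card_univ, Fintype.card_prod, nsmul_eq_mul] at h3
  push_cast at h3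
  linarith

/-- If `f` is close to an affine function of the level `ℓ` on `S` and level intervals contain few
vertices, then intervals contain few values of `f` on `S`. -/
theorem mul_card_filter_le_of_affine {V : Type*} [Fintype V] (ℓ : V → ℕ) {D : ℝ} (hD : 0 ≤ D)
    (hcount : ∀ a b, a ≤ b → (#{v | a ≤ ℓ v ∧ ℓ v < b} : ℝ) ≤ D * ((b : ℝ) - a + 1))
    (S : Finset V) (f : V → ℕ) {C l E r : ℝ} (hE : 0 ≤ E) (hr : 0 ≤ r) (hrl : r * D ≤ l)
    (hf : ∀ v ∈ S, |(f v : ℝ) - (C + l * ℓ v)| ≤ E) {p q : ℕ} (hpq : p ≤ q) :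
    r * #{v ∈ S | p ≤ f v ∧ f v ≤ q} ≤ ((q : ℝ) - p) + 2 * E + 2 * (r * D) := by
  have hpq' : (p : ℝ) ≤ q := by exact_mod_cast hpq
  have hrD : 0 ≤ r * D := mul_nonneg hr hD
  set T : Finset V := {v ∈ S | p ≤ f v ∧ f v ≤ q} with hT
  rcases T.eq_empty_or_nonempty with h | h
  · rw [h]
    simp only [card_empty, Nat.cast_zero, mul_zero]
    linarith
  · obtain ⟨u, hu, humin⟩ := exists_min_image T ℓ h
    obtain ⟨w, hw, hwmax⟩ := exists_max_image T ℓ h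
    have hle : #T ≤ #{v | ℓ u ≤ ℓ v ∧ ℓ v < ℓ w + 1} := by
      refine card_le_card fun v hv => ?_
      simp only [mem_filter, mem_univ, true_and]
      exact ⟨humin v hv, Nat.lt_succ_of_le (hwmax v hv)⟩
    have huw := humin w hw
    have huw' : (ℓ u : ℝ) ≤ ℓ w := by exact_mod_cast huw
    have h1 := hcount (ℓ u) (ℓ w + 1) (by omega)
    have h2 : (#T : ℝ) ≤ D * ((ℓ w : ℝ) - ℓ u + 2) := by
      have : (#T : ℝ) ≤ (#{v | ℓ u ≤ ℓ v ∧ ℓ v < ℓ w + 1} : ℝ) := by exact_mod_cast hle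
      push_cast at h1
      linarith
    rw [hT, mem_filter] at hu hw
    have h3 := abs_le.1 (hf u hu.1)
    have h4 := abs_le.1 (hf w hw.1)
    have h5 : (p : ℝ) ≤ f u := by exact_mod_cast hu.2.1
    have h6 : (f w : ℝ) ≤ q := by exact_mod_cast hw.2.2
    have h7 : r * #T ≤ r * (D * ((ℓ w : ℝ) - ℓ u + 2)) := mul_le_mul_of_nonneg_left h2 hr
    have h8 : r * D * ((ℓ w : ℝ) - ℓ u) ≤ l * ((ℓ w : ℝ) - ℓ u) :=
      mul_le_mul_of_nonneg_right hrl (by linarith)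
    linarith [h3.2, h4.1]

/-- The base weight of an edge between vertices of levels `i` and `j`. Levels below `m₀`, between
`m₀` and `m`, and from `m` on form the three layers. -/
def layerWeight (Q m₀ m M β c β' K i j : ℕ) : ℕ :=
  if i < m₀ then if j < m₀ then 1 else if j < m then 1 + 2 * M else 1
  else if i < m then if j < m₀ then 1 + 2 * M else if j < m then 1 else β + c * i
  else if j < m₀ then 1 else if j < m then β + c * j else β' + if Q + m ≤ i + j then K else 0

section layerWeight

variable {Q m₀ m M β c β' K : ℕ}

theorem layerWeight_comm (i j : ℕ) :
    layerWeight Q m₀ m M β c β' K i j = layerWeight Q m₀ m M β c β' K j i := by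
  unfold layerWeight
  rw [add_comm i j]
  split_ifs <;> rfl

theorem one_le_layerWeight (hβ : 1 ≤ β) (hβ' : 1 ≤ β') (i j : ℕ) :
    1 ≤ layerWeight Q m₀ m M β c β' K i j := by
  unfold layerWeight
  split_ifs <;> omega

theorem layerWeight_le (h1 : 1 + 2 * M ≤ β') (h2 : β + c * m ≤ β') (i j : ℕ) :
    layerWeight Q m₀ m M β c β' K i j ≤ β' + K := by
  have key : ∀ i, i < m → β + c * i ≤ β' := fun i hi =>
    (Nat.add_le_add_left (Nat.mul_le_mul_left c hi.le) β).trans h2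
  unfold layerWeight
  split_ifs <;> first | omega | (have := key i ‹_›; omega) | (have := key j ‹_›; omega)

theorem layerWeight_le_of_lt_left {i : ℕ} (hi : i < m₀) (j : ℕ) :
    layerWeight Q m₀ m M β c β' K i j ≤ 1 + 2 * M := by
  unfold layerWeight
  split_ifs <;> omega

theorem layerWeight_le_of_mid {i : ℕ} (hi : m₀ ≤ i) (him : i < m) (h1 : 1 + 2 * M ≤ β) (j : ℕ) :
    layerWeight Q m₀ m M β c β' K i j ≤ β + c * m := by
  have key : c * i ≤ c * m := Nat.mul_le_mul_left c him.le
  unfold layerWeight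
  split_ifs <;> omega

theorem layerWeight_mid_low {i j : ℕ} (hi : m₀ ≤ i) (him : i < m) (hj : j < m₀) :
    layerWeight Q m₀ m M β c β' K i j = 1 + 2 * M := by
  unfold layerWeight
  split_ifs <;> omega

theorem le_layerWeight_mid_high {i j : ℕ} (hi : m₀ ≤ i) (him : i < m) (hj : m ≤ j) :
    β ≤ layerWeight Q m₀ m M β c β' K i j := by
  unfold layerWeight
  split_ifs <;> omega

theorem le_layerWeight_high_high (hm : m₀ ≤ m) {i j : ℕ} (hi : m ≤ i) (hj : m ≤ j) :
    β' ≤ layerWeight Q m₀ m M β c β' K i j := by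
  unfold layerWeight
  split_ifs <;> omega

theorem exists_sum_layerWeight_mid : ∃ C : ℕ, ∀ i, m₀ ≤ i → i < m →
    ∑ j ∈ range Q, layerWeight Q m₀ m M β c β' K i j = C + c * (Q - m) * i := by
  refine ⟨∑ j ∈ range Q, (if j < m₀ then 1 + 2 * M else if j < m then 1 else β),
    fun i hi him => ?_⟩
  have h : ∀ j, layerWeight Q m₀ m M β c β' K i j =
      (if j < m₀ then 1 + 2 * M else if j < m then 1 else β) + if m ≤ j then c * i else 0 := by
    intro j
    unfold layerWeight
    split_ifs <;> omega
  have h' : {j ∈ range Q | m ≤ j} = Ico m Q := by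
    ext j
    simp [and_comm]
  simp only [h, sum_add_distrib]
  rw [← sum_filter, h', sum_const, Nat.card_Ico, smul_eq_mul]
  ring

theorem exists_sum_layerWeight_high (hm : m₀ ≤ m) : ∃ C : ℕ, ∀ i, m ≤ i → i < Q →
    ∑ j ∈ range Q, layerWeight Q m₀ m M β c β' K i j = C + K * (i - m) := by
  refine ⟨∑ j ∈ range Q, (if j < m₀ then 1 else if j < m then β + c * j else β'),
    fun i hi hiQ => ?_⟩
  have h : ∀ j, layerWeight Q m₀ m M β c β' K i j =
      (if j < m₀ then 1 else if j < m then β + c * j else β') +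
        if Q + m ≤ i + j then K else 0 := by
    intro j
    unfold layerWeight
    split_ifs <;> omega
  have h' : {j ∈ range Q | Q + m ≤ i + j} = Ico (Q + m - i) Q := by
    ext j
    simp only [mem_filter, mem_range, mem_Ico]
    omega
  simp only [h, sum_add_distrib]
  rw [← sum_filter, h', sum_const, Nat.card_Ico, smul_eq_mul,
    show Q - (Q + m - i) = i - m by omega, mul_comm]

end layerWeight

/-- In a regular graph, a set meeting every neighbourhood in at most `t * d` vertices has at most
`t * n` elements. -/
theorem card_le_of_card_neighborFinset_filter_le {V : Type*} [Fintype V] (G : SimpleGraph V)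
    [DecidableRel G.Adj] {d : ℕ} (hd : G.IsRegularOfDegree d) (hd0 : 0 < d) (P : V → Prop)
    [DecidablePred P] {t : ℝ} (h : ∀ v, (#{u ∈ G.neighborFinset v | P u} : ℝ) ≤ t * d) :
    (#{u | P u} : ℝ) ≤ t * Fintype.card V := by
  have hdeg : ∀ v, #(G.neighborFinset v) = d := fun v => hd v
  have h1 : ∑ v, #{u ∈ G.neighborFinset v | P u} = d * #{u | P u} := by
    have h2 : ∀ v, #{u ∈ G.neighborFinset v | P u} = ∑ u with P u, if G.Adj v u then 1 else 0 := by
      intro v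
      rw [← card_filter, filter_filter]
      congr 1
      ext u
      simp [and_comm]
    simp only [h2]
    rw [sum_comm]
    have h3 : ∀ u, ∑ v, (if G.Adj v u then 1 else 0) = d := by
      intro u
      rw [← card_filter, ← hdeg u]
      congr 1
      ext v
      simp [G.adj_comm]
    simp [h3, mul_comm]
  have h2 : (d : ℝ) * #{u | P u} ≤ ∑ _v : V, t * d := by
    rw [← Nat.cast_mul, ← h1, Nat.cast_sum]
    exact sum_le_sum fun v _ => h v
  rw [sum_const, card_univ, nsmul_eq_mul] at h2
  have hd' : (0 : ℝ) < d := by exact_mod_cast hd0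
  nlinarith

set_option maxHeartbeats 1000000 in
/-- A regular graph with a well-distributed assignment `ℓ` of levels has a weighting with distinct
weighted degrees and weights at most `κ g ^ 8 + 46 κ g ^ 7`. -/
theorem exists_weighting_of_levels {V : Type*} [Fintype V] (G : SimpleGraph V)
    [DecidableRel G.Adj] {d : ℕ} (hd : G.IsRegularOfDegree d) {g κ : ℕ} (hg : 50 ≤ g)
    (hκ : 1 ≤ κ) (hgd : g ^ 7 ≤ d) (hn : Fintype.card V ≤ d * (κ * g ^ 8)) (ℓ : V → ℕ)
    (hℓ : ∀ v, ℓ v < g ^ 7)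
    (hrow : ∀ v, ∀ i < g ^ 7,
      |∑ u ∈ G.neighborFinset v, (layerWeight (g ^ 7) (g ^ 4) (g ^ 4 + g ^ 6) (κ * g ^ 7)
          (14 * (κ * g ^ 7)) (4 * (κ * g)) (46 * (κ * g ^ 7)) (κ * g ^ 8) i (ℓ u) : ℝ) -
        (d / g ^ 7 : ℝ) * ∑ j ∈ range (g ^ 7), (layerWeight (g ^ 7) (g ^ 4) (g ^ 4 + g ^ 6)
          (κ * g ^ 7) (14 * (κ * g ^ 7)) (4 * (κ * g)) (46 * (κ * g ^ 7)) (κ * g ^ 8) i j : ℝ)| ≤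
        2 * (d / g ^ 7 : ℝ) * (κ * g ^ 8))
    (hinterval : ∀ v, ∀ a b, a ≤ b → b ≤ g ^ 7 →
      |(#{u ∈ G.neighborFinset v | a ≤ ℓ u ∧ ℓ u < b} : ℝ) - (d / g ^ 7 : ℝ) * ((b : ℝ) - a)| ≤
        (d / g ^ 7 : ℝ)) :
    ∃ w : V → V → ℤ, (∀ u v, w u v = w v u) ∧
      (∀ u v, 1 ≤ w u v ∧ w u v ≤ (46 * (κ * g ^ 7) + κ * g ^ 8 : ℕ)) ∧
      Function.Injective fun v => ∑ u ∈ G.neighborFinset v, w v u := by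
  classical
  have hdeg : ∀ v, #(G.neighborFinset v) = d := fun v => hd v
  have hd0 : 0 < d := lt_of_lt_of_le (by positivity) hgd
  set e : ℝ := d / g ^ 7 with he
  have hgR : (50 : ℝ) ≤ g := by exact_mod_cast hg
  have hκR : (1 : ℝ) ≤ κ := by exact_mod_cast hκ
  have hg7 : (0 : ℝ) < (g : ℝ) ^ 7 := by positivity
  have he1 : 1 ≤ e := by
    rw [he, le_div_iff₀ hg7, one_mul]
    exact_mod_cast hgd
  have hde : (d : ℝ) = e * g ^ 7 := by rw [he]; field_simp
  have hgg : g ^ 4 ≤ g ^ 4 + g ^ 6 := Nat.le_add_right _ _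
  have hmQ : g ^ 4 + g ^ 6 ≤ g ^ 7 := by
    have h1 : g ^ 7 = g * g ^ 6 := by ring
    have h2 : g ^ 4 ≤ g ^ 6 := Nat.pow_le_pow_right (by omega) (by norm_num)
    nlinarith [Nat.zero_le (g ^ 6)]
  have hmQR : 2 * ((g : ℝ) ^ 4 + g ^ 6) + 2 ≤ g ^ 7 := by
    have h1 : (g : ℝ) ^ 7 = g * g ^ 6 := by ring
    have h2 : (g : ℝ) ^ 4 ≤ g ^ 6 := pow_le_pow_right₀ (by linarith) (by norm_num)
    have h3 : (1 : ℝ) ≤ g ^ 6 := one_le_pow₀ (by linarith)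
    nlinarith
  set W : V → V → ℕ := fun u v => layerWeight (g ^ 7) (g ^ 4) (g ^ 4 + g ^ 6) (κ * g ^ 7)
    (14 * (κ * g ^ 7)) (4 * (κ * g)) (46 * (κ * g ^ 7)) (κ * g ^ 8) (ℓ u) (ℓ v) with hW
  set σ : V → ℕ := fun v => ∑ u ∈ G.neighborFinset v, W v u with hσ
  set Z : Finset V := {v | ℓ v < g ^ 4} with hZ
  set Y : Finset V := {v | g ^ 4 ≤ ℓ v ∧ ℓ v < g ^ 4 + g ^ 6} with hY
  set B : Finset V := {v | g ^ 4 + g ^ 6 ≤ ℓ v} with hB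
  have memZ : ∀ v, v ∈ Z ↔ ℓ v < g ^ 4 := by simp [hZ]
  have memY : ∀ v, v ∈ Y ↔ g ^ 4 ≤ ℓ v ∧ ℓ v < g ^ 4 + g ^ 6 := by simp [hY]
  have memB : ∀ v, v ∈ B ↔ g ^ 4 + g ^ 6 ≤ ℓ v := by simp [hB]
  -- degrees into the layers
  have degZ : ∀ v, e * ((g : ℝ) ^ 4 - 1) ≤ #{u ∈ G.neighborFinset v | u ∈ Z} := by
    intro v
    have h := abs_le.1 (hinterval v 0 (g ^ 4) (Nat.zero_le _) (hgg.trans hmQ))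
    simp only [Nat.zero_le, true_and] at h
    simp only [memZ]
    push_cast at h
    linarith [h.1]
  have degY : ∀ v, e * ((g : ℝ) ^ 6 - 1) ≤ #{u ∈ G.neighborFinset v | u ∈ Y} := by
    intro v
    have h := abs_le.1 (hinterval v (g ^ 4) (g ^ 4 + g ^ 6) hgg hmQ)
    simp only [memY]
    push_cast at h
    linarith [h.1]
  have degB : ∀ v, (d : ℝ) / 2 ≤ #{u ∈ G.neighborFinset v | u ∈ B} := by
    intro v
    have h := abs_le.1 (hinterval v (g ^ 4 + g ^ 6) (g ^ 7) hmQ le_rfl)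
    simp only [hℓ, and_true] at h
    simp only [memB]
    push_cast at h
    rw [hde]
    nlinarith [h.1]
  have hcount : ∀ a b, a ≤ b →
      (#{v | a ≤ ℓ v ∧ ℓ v < b} : ℝ) ≤ e * (κ * g ^ 8) * ((b : ℝ) - a + 1) := by
    have key : ∀ a b, a ≤ b → b ≤ g ^ 7 →
        (#{v | a ≤ ℓ v ∧ ℓ v < b} : ℝ) ≤ e * (κ * g ^ 8) * ((b : ℝ) - a + 1) := by
      intro a b hab hb
      have hab' : (a : ℝ) ≤ b := by exact_mod_cast hab
      have h := card_le_of_card_neighborFinset_filter_le G hd hd0 (fun v => a ≤ ℓ v ∧ ℓ v < b)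
        (t := ((b : ℝ) - a + 1) / g ^ 7) fun v => by
          have h := abs_le.1 (hinterval v a b hab hb)
          have : ((b : ℝ) - a + 1) / g ^ 7 * d = e * ((b : ℝ) - a + 1) := by rw [he]; ring
          rw [this]
          linarith [h.2]
      have hn' : (Fintype.card V : ℝ) ≤ d * (κ * g ^ 8) := by exact_mod_cast hn
      refine h.trans ((mul_le_mul_of_nonneg_left hn' (by positivity)).trans (le_of_eq ?_))
      rw [he]
      ring
    intro a b hab
    rcases le_total b (g ^ 7) with hb | hb
    · exact key a b hab hb
    · rcases le_total a (g ^ 7) with ha | ha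
      · have h := key a (g ^ 7) ha le_rfl
        have hb' : ((g ^ 7 : ℕ) : ℝ) ≤ b := by exact_mod_cast hb
        have h2 : (#{v | a ≤ ℓ v ∧ ℓ v < b} : ℝ) ≤ #{v | a ≤ ℓ v ∧ ℓ v < g ^ 7} := by
          exact_mod_cast card_le_card fun v hv => by
            simp only [mem_filter, mem_univ, true_and] at hv ⊢
            exact ⟨hv.1, hℓ v⟩
        refine h2.trans (h.trans ?_)
        gcongr
      · rw [filter_false_of_mem fun v _ => by have := hℓ v; omega]
        have hab' : (a : ℝ) ≤ b := by exact_mod_cast hab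
        simp only [card_empty, Nat.cast_zero]
        positivity
  -- the weighted degrees are nearly affine in the level
  have hσcast : ∀ v, (σ v : ℝ) = ∑ u ∈ G.neighborFinset v, (W v u : ℝ) := fun v => by
    simp only [hσ, Nat.cast_sum]
  obtain ⟨CB, hCB⟩ := exists_sum_layerWeight_high (Q := g ^ 7) (M := κ * g ^ 7)
    (β := 14 * (κ * g ^ 7)) (c := 4 * (κ * g)) (β' := 46 * (κ * g ^ 7)) (K := κ * g ^ 8) hgg
  have hσB : ∀ v ∈ B, |(σ v : ℝ) - (e * (CB - κ * g ^ 8 * (g ^ 4 + g ^ 6)) +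
      e * (κ * g ^ 8) * ℓ v)| ≤ 2 * e * (κ * g ^ 8) := by
    intro v hv
    have h := hrow v (ℓ v) (hℓ v)
    have h2 := hCB (ℓ v) ((memB v).1 hv) (hℓ v)
    have h3 : ((ℓ v - (g ^ 4 + g ^ 6) : ℕ) : ℝ) = ℓ v - (g ^ 4 + g ^ 6) := by
      rw [Nat.cast_sub ((memB v).1 hv)]
      push_cast
      ring
    rw [← Nat.cast_sum (range _), h2, Nat.cast_add, Nat.cast_mul, h3] at h
    rw [hσcast]
    convert h using 2
    push_cast
    ring
  obtain ⟨CY, hCY⟩ := exists_sum_layerWeight_mid (Q := g ^ 7) (m₀ := g ^ 4) (m := g ^ 4 + g ^ 6)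
    (M := κ * g ^ 7) (β := 14 * (κ * g ^ 7)) (c := 4 * (κ * g)) (β' := 46 * (κ * g ^ 7))
    (K := κ * g ^ 8)
  have hσY : ∀ v ∈ Y, |(σ v : ℝ) - (e * CY + e * (4 * (κ * g) * (g ^ 7 - (g ^ 4 + g ^ 6))) *
      ℓ v)| ≤ 2 * e * (κ * g ^ 8) := by
    intro v hv
    have h := hrow v (ℓ v) (hℓ v)
    have h2 := hCY (ℓ v) ((memY v).1 hv).1 ((memY v).1 hv).2
    have h3 : ((g ^ 7 - (g ^ 4 + g ^ 6) : ℕ) : ℝ) = g ^ 7 - (g ^ 4 + g ^ 6) := by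
      rw [Nat.cast_sub hmQ]
      push_cast
      ring
    rw [← Nat.cast_sum (range _), h2, Nat.cast_add, Nat.cast_mul, Nat.cast_mul, h3] at h
    rw [hσcast]
    convert h using 2
    push_cast
    ring
  -- numerical facts
  set t : ℝ := e * κ with ht
  have ht1 : 1 ≤ t := one_le_mul_of_one_le_of_one_le he1 hκR
  have p34 : 50 * (g : ℝ) ^ 3 ≤ g ^ 4 := by
    rw [show (g : ℝ) ^ 4 = g * g ^ 3 by ring]; gcongr
  have p45 : 50 * (g : ℝ) ^ 4 ≤ g ^ 5 := by
    rw [show (g : ℝ) ^ 5 = g * g ^ 4 by ring]; gcongr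
  have p56 : 50 * (g : ℝ) ^ 5 ≤ g ^ 6 := by
    rw [show (g : ℝ) ^ 6 = g * g ^ 5 by ring]; gcongr
  have p67 : 50 * (g : ℝ) ^ 6 ≤ g ^ 7 := by
    rw [show (g : ℝ) ^ 7 = g * g ^ 6 by ring]; gcongr
  have p78 : 50 * (g : ℝ) ^ 7 ≤ g ^ 8 := by
    rw [show (g : ℝ) ^ 8 = g * g ^ 7 by ring]; gcongr
  have p89 : 50 * (g : ℝ) ^ 8 ≤ g ^ 9 := by
    rw [show (g : ℝ) ^ 9 = g * g ^ 8 by ring]; gcongr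
  have p910 : 50 * (g : ℝ) ^ 9 ≤ g ^ 10 := by
    rw [show (g : ℝ) ^ 10 = g * g ^ 9 by ring]; gcongr
  have p1011 : 50 * (g : ℝ) ^ 10 ≤ g ^ 11 := by
    rw [show (g : ℝ) ^ 11 = g * g ^ 10 by ring]; gcongr
  have p1213 : 50 * (g : ℝ) ^ 12 ≤ g ^ 13 := by
    rw [show (g : ℝ) ^ 13 = g * g ^ 12 by ring]; gcongr
  have p1112 : 50 * (g : ℝ) ^ 11 ≤ g ^ 12 := by
    rw [show (g : ℝ) ^ 12 = g * g ^ 11 by ring]; gcongr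
  have p3 : 50 ≤ (g : ℝ) ^ 3 := by nlinarith [sq_nonneg (g : ℝ)]
  have pm : 4 * (κ * g) * (g ^ 4 + g ^ 6) ≤ 5 * (κ * g ^ 7) := by
    have : (4 * (κ * g) * (g ^ 4 + g ^ 6) : ℝ) ≤ 5 * (κ * g ^ 7) := by
      have h1 : (κ : ℝ) * (4 * g ^ 5) ≤ κ * g ^ 7 := by gcongr; linarith
      linarith
    exact_mod_cast this
  have pκ7 : 1 ≤ κ * g ^ 7 := Nat.mul_pos hκ (by positivity)
  have pκ3 : κ * g ^ 3 ≤ κ * g ^ 7 :=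
    Nat.mul_le_mul_left _ (Nat.pow_le_pow_right (by omega) (by norm_num))
  have pκ8 : 50 * (κ * g ^ 7) ≤ κ * g ^ 8 := by
    rw [show κ * g ^ 8 = g * (κ * g ^ 7) by ring]
    exact Nat.mul_le_mul_right _ hg
  have hdκ : d ≤ d * (κ * g ^ 7) := Nat.le_mul_of_pos_right d pκ7
  have lower : ∀ v b, (∀ u ∈ B, b ≤ W v u) → d * b ≤ 2 * σ v := by
    intro v b hb
    have h1 : #{u ∈ G.neighborFinset v | u ∈ B} * b ≤ σ v := by
      rw [← smul_eq_mul]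
      refine (card_nsmul_le_sum _ (W v) b fun u hu => hb u (mem_filter.1 hu).2).trans ?_
      exact sum_le_sum_of_subset (filter_subset _ _)
    have h2 : d ≤ 2 * #{u ∈ G.neighborFinset v | u ∈ B} := by
      have : (d : ℝ) ≤ 2 * #{u ∈ G.neighborFinset v | u ∈ B} := by linarith [degB v]
      exact_mod_cast this
    nlinarith
  have upper : ∀ v b, (∀ u, W v u ≤ b) → σ v ≤ d * b := by
    intro v b hb
    have := sum_le_card_nsmul (G.neighborFinset v) (W v) b fun u _ => hb u
    rwa [hdeg, smul_eq_mul] at this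
  refine exists_weighting_of_layers G hd B Y Z ?_ ?_ ?_ ?_ W
    (fun u v => layerWeight_comm _ _) (fun u v => one_le_layerWeight (by omega) (by omega) _ _)
    σ (fun v => rfl) (s := κ * g ^ 3) (A := κ * g ^ 7) (M := κ * g ^ 7)
    (RB := ⌈6 * (t * (g : ℝ) ^ 8)⌉₊) (RY := ⌈4 * (t * (g : ℝ) ^ 8) + t * (g : ℝ) ^ 10⌉₊)
    (q := ⌈e * ((g : ℝ) ^ 6 - 1)⌉₊) (θ₁ := d * (7 * (κ * g ^ 7))) (θ₂ := d * (23 * (κ * g ^ 7)))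
    pκ7 ?_ ?_ ?_ ?_ ?_ ?_ ?_ ?_ ?_ ?_ ?_ ?_ ?_ ?_
  · intro v
    rw [memB, memY, memZ]
    omega
  · exact disjoint_left.2 fun v h1 h2 => by rw [memB] at h1; rw [memY] at h2; omega
  · exact disjoint_left.2 fun v h1 h2 => by rw [memB] at h1; rw [memZ] at h2; omega
  · exact disjoint_left.2 fun v h1 h2 => by rw [memY] at h1; rw [memZ] at h2; omega
  · exact Nat.mul_le_mul_left _ (by omega)
  · intro a b hab
    have h := mul_card_filter_le_of_affine ℓ (D := e * (κ * g ^ 8)) (by positivity) hcount B σ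
      (by positivity) zero_le_one (by rw [one_mul]) hσB hab
    have h2 := Nat.le_ceil (6 * (t * (g : ℝ) ^ 8))
    have h3 : (#{v ∈ B | a ≤ σ v ∧ σ v ≤ b} : ℝ) + a ≤ b + 1 + (⌈6 * (t * (g : ℝ) ^ 8)⌉₊ : ℕ) := by
      rw [ht] at h2 ⊢
      linarith
    exact_mod_cast h3
  · intro b _
    have h1 : 6 * (t * (g : ℝ) ^ 8) ≤
        ((κ * g ^ 3 * #{u ∈ G.neighborFinset b | u ∈ Y} : ℕ) : ℝ) := by
      push_cast
      calc 6 * (t * (g : ℝ) ^ 8) ≤ t * (g ^ 9 - g ^ 3) := by nlinarith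
        _ = κ * g ^ 3 * (e * ((g : ℝ) ^ 6 - 1)) := by rw [ht]; ring
        _ ≤ _ := by gcongr; exact degY b
    exact Nat.ceil_le.2 h1
  · intro f hf a b hab
    have h := mul_card_filter_le_of_affine ℓ (D := e * (κ * g ^ 8)) (r := 2)
      (C := e * CY) (l := e * (4 * (κ * g) * (g ^ 7 - (g ^ 4 + g ^ 6))))
      (E := 2 * (t * (g : ℝ) ^ 8) + t * g ^ 10)
      (by positivity) hcount Y f (by positivity) zero_le_two ?_ ?_ hab
    · have h2 := Nat.le_ceil (4 * (t * (g : ℝ) ^ 8) + t * (g : ℝ) ^ 10)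
      have h3 : 2 * (#{v ∈ Y | a ≤ f v ∧ f v ≤ b} : ℝ) ≤ ((b - a : ℕ) : ℝ) +
          2 * (⌈4 * (t * (g : ℝ) ^ 8) + t * (g : ℝ) ^ 10⌉₊ : ℕ) := by
        rw [Nat.cast_sub hab]
        rw [ht] at h2 h ⊢
        linarith
      exact_mod_cast h3
    · have : 2 * (e * (κ * (g : ℝ) ^ 8)) = e * (4 * (κ * g) * ((g : ℝ) ^ 7 / 2)) := by ring
      rw [this]
      gcongr
      linarith
    · intro v hv
      have h1 := abs_le.1 (hσY v hv)
      have h2 : (σ v : ℝ) ≤ f v := by exact_mod_cast (hf v hv).1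
      have h3 : (f v : ℝ) ≤ σ v + κ * g ^ 3 * d := by exact_mod_cast (hf v hv).2
      have h4 : (κ : ℝ) * g ^ 3 * d = t * g ^ 10 := by rw [hde, ht]; ring
      have h5 : 0 ≤ t * (g : ℝ) ^ 10 := by positivity
      have h6 : 2 * e * (κ * (g : ℝ) ^ 8) = 2 * (t * g ^ 8) := by rw [ht]; ring
      rw [h6] at h1
      rw [abs_le]
      constructor <;> linarith [h1.1, h1.2]
  · intro y _
    have h1 : 2 * (⌈4 * (t * (g : ℝ) ^ 8) + t * (g : ℝ) ^ 10⌉₊ : ℝ) + 4 * (κ * g ^ 7) ≤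
        κ * g ^ 7 * #{u ∈ G.neighborFinset y | u ∈ Z} := by
      have h2 := Nat.ceil_lt_add_one (a := 4 * (t * (g : ℝ) ^ 8) + t * (g : ℝ) ^ 10) (by positivity)
      have h3 : (κ : ℝ) * g ^ 7 ≤ t * g ^ 7 := by
        gcongr
        exact le_mul_of_one_le_left (by linarith) he1
      calc _ ≤ t * (8 * (g : ℝ) ^ 8 + 2 * g ^ 10 + 2 + 4 * g ^ 7) := by linarith
        _ ≤ t * (g ^ 11 - g ^ 7) := by gcongr; linarith
        _ = κ * g ^ 7 * (e * ((g : ℝ) ^ 4 - 1)) := by rw [ht]; ring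
        _ ≤ _ := by gcongr; exact degZ y
    exact_mod_cast h1
  · intro y _
    have h1 : (2 : ℝ) ≤ #{u ∈ G.neighborFinset y | u ∈ Z} := by
      refine le_trans ?_ (degZ y)
      nlinarith
    exact_mod_cast h1
  · exact fun z _ => Nat.ceil_le.2 (degY z)
  · have h1 : (#Z : ℝ) ≤ e * (κ * g ^ 8) * (g ^ 4 + 1) := by
      have := hcount 0 (g ^ 4) (Nat.zero_le _)
      simp only [Nat.zero_le, true_and] at this
      push_cast at this
      linarith
    have h2 := Nat.le_ceil (e * ((g : ℝ) ^ 6 - 1))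
    have h3 : 2 * (#Z : ℝ) < κ * g ^ 7 * (⌈e * ((g : ℝ) ^ 6 - 1)⌉₊ : ℕ) := by
      calc 2 * (#Z : ℝ) ≤ t * (2 * g ^ 12 + 2 * g ^ 8) := by rw [ht]; linarith
        _ < t * (g ^ 13 - g ^ 7) := by
          have : (0 : ℝ) < g ^ 12 := by positivity
          have : (0 : ℝ) < g ^ 8 := by positivity
          gcongr
          linarith
        _ = κ * g ^ 7 * (e * ((g : ℝ) ^ 6 - 1)) := by rw [ht]; ring
        _ ≤ _ := by gcongr
    exact_mod_cast h3
  · exact fun u v => layerWeight_le (by omega) (by omega) _ _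
  · intro b _ y hy
    have h := layerWeight_le_of_mid (Q := g ^ 7) (M := κ * g ^ 7) (β := 14 * (κ * g ^ 7))
      (c := 4 * (κ * g)) (β' := 46 * (κ * g ^ 7)) (K := κ * g ^ 8) ((memY y).1 hy).1
      ((memY y).1 hy).2 (by omega) (ℓ b)
    rw [layerWeight_comm] at h
    change layerWeight _ _ _ _ _ _ _ _ _ _ + _ ≤ _
    omega
  · intro y hy z hz
    have h : W y z = 1 + 2 * (κ * g ^ 7) :=
      layerWeight_mid_low ((memY y).1 hy).1 ((memY y).1 hy).2 ((memZ z).1 hz)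
    rw [h]
    omega
  · intro z hz
    have h := upper z (1 + 2 * (κ * g ^ 7)) fun u =>
      layerWeight_le_of_lt_left ((memZ z).1 hz) _
    linarith
  · intro y hy
    have h := upper y (14 * (κ * g ^ 7) + 4 * (κ * g) * (g ^ 4 + g ^ 6)) fun u =>
      layerWeight_le_of_mid ((memY y).1 hy).1 ((memY y).1 hy).2 (by omega) _
    have h' := lower y (14 * (κ * g ^ 7)) fun u hu =>
      le_layerWeight_mid_high ((memY y).1 hy).1 ((memY y).1 hy).2 ((memB u).1 hu)
    constructor
    · linarith
    · linarith [Nat.mul_le_mul_left d pm, Nat.mul_le_mul_left d pκ3,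
        Nat.le_mul_of_pos_left (κ * g ^ 7) hd0]
  · intro b hb
    have h' := lower b (46 * (κ * g ^ 7)) fun u hu =>
      le_layerWeight_high_high hgg ((memB b).1 hb) ((memB u).1 hu)
    linarith

/-- A regular graph of suitable degree has a weighting with distinct weighted degrees and weights
at most `κ g ^ 8 + 46 κ g ^ 7`. -/
theorem exists_weighting_of_regular {V : Type*} [Fintype V] (G : SimpleGraph V)
    [DecidableRel G.Adj] {d : ℕ} (hd : G.IsRegularOfDegree d) {g κ : ℕ} (hg : 50 ≤ g)
    (hκ : 1 ≤ κ) (hgd : g ^ 7 ≤ d) (hn : Fintype.card V ≤ d * (κ * g ^ 8))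
    (hsmall : 2 * (Fintype.card V : ℝ) * (g ^ 7 + (g ^ 7 + 1) * (g ^ 7 + 1)) *
      Real.exp (-2 * (d / g ^ 14)) < 1) :
    ∃ w : V → V → ℤ, (∀ u v, w u v = w v u) ∧
      (∀ u v, 1 ≤ w u v ∧ w u v ≤ (46 * (κ * g ^ 7) + κ * g ^ 8 : ℕ)) ∧
      Function.Injective fun v => ∑ u ∈ G.neighborFinset v, w v u := by
  have hgR : (50 : ℝ) ≤ g := by exact_mod_cast hg
  have hκR : (1 : ℝ) ≤ κ := by exact_mod_cast hκ
  have hg7 : 0 < g ^ 7 := by positivity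
  have hne : Nonempty (Fin (g ^ 7)) := ⟨⟨0, hg7⟩⟩
  have hmQ : 4 * (κ * g) * (g ^ 4 + g ^ 6) ≤ 5 * (κ * g ^ 7) := by
    have h1 : 4 * g ^ 4 ≤ g ^ 6 := by
      rw [show g ^ 6 = g * g * g ^ 4 by ring]
      exact Nat.mul_le_mul_right _ (by nlinarith)
    have h2 : κ * g * (4 * g ^ 4) ≤ κ * g * g ^ 6 := Nat.mul_le_mul_left _ h1
    linarith
  have pκ7 : 1 ≤ κ * g ^ 7 := Nat.mul_pos hκ hg7
  have hK : 46 * (κ * g ^ 7) + κ * g ^ 8 ≤ 2 * (κ * g ^ 8) := by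
    rw [show κ * g ^ 8 = g * (κ * g ^ 7) by ring]
    nlinarith
  let w₀ := layerWeight (g ^ 7) (g ^ 4) (g ^ 4 + g ^ 6) (κ * g ^ 7)
    (14 * (κ * g ^ 7)) (4 * (κ * g)) (46 * (κ * g ^ 7)) (κ * g ^ 8)
  have hw₀ : ∀ i j, (w₀ i j : ℝ) ≤ 2 * (κ * g ^ 8) := fun i j => by
    exact_mod_cast (layerWeight_le (by omega) (by omega) i j).trans hK
  have hKpos : (0 : ℝ) < 2 * (κ * g ^ 8) := by positivity
  let f : Fin (g ^ 7) ⊕ (Fin (g ^ 7 + 1) × Fin (g ^ 7 + 1)) → Fin (g ^ 7) → ℝ :=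
    Sum.elim (fun i j => w₀ i j / (2 * (κ * g ^ 8)))
      fun p j => if (p.1 : ℕ) ≤ j ∧ (j : ℕ) < p.2 then 1 else 0
  have hf : ∀ i j, f i j ∈ Set.Icc (0 : ℝ) 1 := by
    rintro (i | p) j
    · exact ⟨by simp only [f, Sum.elim_inl]; positivity, (div_le_one hKpos).2 (hw₀ i j)⟩
    · simp only [f, Sum.elim_inr]
      split_ifs <;> simp
  obtain ⟨x, hx⟩ := exists_labelling_of_concentration G hd f hf (η := 1 / g ^ 7) (by positivity) (by
    simp only [Fintype.card_sum, Fintype.card_prod, Fintype.card_fin]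
    push_cast
    convert hsmall using 3
    rw [div_pow, ← pow_mul]
    ring)
  refine exists_weighting_of_levels G hd hg hκ hgd hn (fun v => x v) (fun v => (x v).2) ?_ ?_
  · intro v i hi
    have h := hx v (.inl ⟨i, hi⟩)
    simp only [f, Sum.elim_inl, Fintype.card_fin, ← sum_div] at h
    rw [Fin.sum_univ_eq_sum_range (fun j => (w₀ i j : ℝ)) (g ^ 7)] at h
    change |∑ u ∈ G.neighborFinset v, (w₀ i (x u) : ℝ) -
      (d / g ^ 7 : ℝ) * ∑ j ∈ range (g ^ 7), (w₀ i j : ℝ)| ≤ _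
    generalize (∑ u ∈ G.neighborFinset v, (w₀ i (x u) : ℝ)) = S at h ⊢
    generalize (∑ j ∈ range (g ^ 7), (w₀ i j : ℝ)) = T at h ⊢
    have h2 := mul_le_mul_of_nonneg_right h hKpos.le
    rw [← abs_of_pos hKpos, ← abs_mul, abs_of_pos hKpos] at h2
    push_cast at h2
    have h3 : (S / (2 * (κ * g ^ 8)) - d * (T / (2 * (κ * g ^ 8)) / g ^ 7)) * (2 * (κ * g ^ 8)) =
        S - (d / g ^ 7 : ℝ) * T := by
      field_simp
    rw [h3] at h2
    exact h2.trans (le_of_eq (by ring))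
  · intro v a b hab hb
    have h := hx v (.inr (⟨a, by omega⟩, ⟨b, by omega⟩))
    simp only [f, Sum.elim_inr, Fintype.card_fin] at h
    rw [Fin.sum_univ_eq_sum_range (fun j => if a ≤ j ∧ j < b then (1 : ℝ) else 0) (g ^ 7)] at h
    have h' : {j ∈ range (g ^ 7) | a ≤ j ∧ j < b} = Ico a b := by
      ext j
      simp only [mem_filter, mem_range, mem_Ico]
      omega
    rw [sum_boole, sum_boole, h', Nat.card_Ico, Nat.cast_sub hab] at h
    push_cast at h
    rw [show (d : ℝ) * (((b : ℝ) - a) / g ^ 7) = d / g ^ 7 * ((b : ℝ) - a) by ring,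
      show 1 / (g : ℝ) ^ 7 * d = d / g ^ 7 by ring] at h
    exact h

/-- A symmetric weighting with distinct weighted degrees bounds the irregularity strength. -/
theorem irregularityStrength_le_of_weighting {V : Type} [Fintype V] (G : SimpleGraph V)
    [DecidableRel G.Adj] {k : ℕ} (w : V → V → ℤ) (hsymm : ∀ u v, w u v = w v u)
    (hw : ∀ u v, 1 ≤ w u v ∧ w u v ≤ k)
    (hinj : Function.Injective fun v => ∑ u ∈ G.neighborFinset v, w v u) :
    irregularityStrength G ≤ k := by
  refine Nat.sInf_le ⟨Sym2.lift ⟨fun u v => (w u v).toNat,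
    fun u v => congrArg Int.toNat (hsymm u v)⟩, ?_, ?_⟩
  · intro e _
    induction e with
    | _ u v =>
      have := hw u v
      simp only [Sym2.lift_mk]
      omega
  · intro u v huv h
    refine huv (hinj ?_)
    have hcast : ∀ v, ∑ u ∈ G.neighborFinset v, w v u =
        ((∑ u ∈ G.neighborFinset v, (w v u).toNat : ℕ) : ℤ) := by
      intro v
      rw [Nat.cast_sum]
      exact sum_congr rfl fun u _ => (Int.toNat_of_nonneg (by linarith [(hw v u).1])).symm
    simp only [weightedDeg, Sym2.lift_mk] at h
    change ∑ x ∈ G.neighborFinset u, w u x = ∑ x ∈ G.neighborFinset v, w v x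
    rw [hcast, hcast, h]

open Filter in
/-- Growth of powers of the logarithm. -/
theorem eventually_log_rpow_bounds {ε : ℝ} (hε : 0 < ε) : ∀ᶠ n : ℕ in atTop,
    1 ≤ Real.log n ∧ 100 ≤ Real.log n ^ (ε / 17) ∧
      200 * Real.log n ^ (ε / 19) ≤ Real.log n ^ (ε / 17) := by
  have hlog : Tendsto (fun n : ℕ => Real.log n) atTop atTop :=
    Real.tendsto_log_atTop.comp tendsto_natCast_atTop_atTop
  have h1 := hlog.eventually_ge_atTop 1
  have h2 := ((tendsto_rpow_atTop (y := ε / 17) (by positivity)).comp hlog).eventually_ge_atTop 100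
  have h3 := ((tendsto_rpow_atTop (y := ε / 17 - ε / 19) (by linarith)).comp
    hlog).eventually_ge_atTop 200
  filter_upwards [h1, h2, h3] with n h1 h2 h3
  refine ⟨h1, h2, ?_⟩
  simp only [Function.comp] at h3
  have hpos : 0 < Real.log n := by linarith
  rw [Real.rpow_sub hpos, le_div_iff₀ (Real.rpow_pos_of_pos hpos _)] at h3
  exact h3

theorem faudree_lehel_corollary_best (ε₀ : ℝ) (hε₀ : 0 < ε₀) :
    ∃ N : ℕ, ∀ (V : Type) [Fintype V] (G : SimpleGraph V) [DecidableRel G.Adj] (n d : ℕ),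
      n = Fintype.card V → G.IsRegularOfDegree d → N ≤ n →
      Real.log n ^ (1 + ε₀) ≤ (d : ℝ) →
      (d : ℝ) ≤ (n : ℝ) / Real.log n ^ ε₀ →
      (irregularityStrength G : ℝ) ≤
        ((n : ℝ) / (d : ℝ)) * (1 + 1 / Real.log n ^ (ε₀ / 19)) := by
  obtain ⟨N, hN⟩ := Filter.eventually_atTop.1 (eventually_log_rpow_bounds hε₀)
  refine ⟨max N 10, fun V _ G _ n d hcard hreg hn hdlow hdup => ?_⟩
  obtain ⟨hL, hr, hz⟩ := hN n (le_of_max_le_left hn)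
  have hn10 : (10 : ℝ) ≤ n := by exact_mod_cast le_of_max_le_right hn
  set L := Real.log n with hLdef
  set r := L ^ (ε₀ / 17) with hrdef
  set z := L ^ (ε₀ / 19) with hzdef
  have hL0 : 0 < L := by linarith
  have hz0 : 0 < z := Real.rpow_pos_of_pos hL0 _
  have hr17 : L ^ ε₀ = r ^ 17 := by
    rw [hrdef, ← Real.rpow_natCast, ← Real.rpow_mul hL0.le]
    congr 1
    push_cast
    ring
  rw [Real.rpow_add hL0, Real.rpow_one, hr17] at hdlow
  rw [hr17, le_div_iff₀ (by positivity)] at hdup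
  set g := ⌊r⌋₊ with hgdef
  have hgr : (g : ℝ) ≤ r := Nat.floor_le (by linarith)
  have hrg : r < g + 1 := Nat.lt_floor_add_one r
  have hg : 50 ≤ g := Nat.le_floor (by push_cast; linarith)
  have hgR : (50 : ℝ) ≤ g := by exact_mod_cast hg
  have hg0 : (0 : ℝ) < g := by linarith
  have hgpow : (g : ℝ) ^ 17 ≤ r ^ 17 := by gcongr
  have hr1 : 1 ≤ r ^ 17 := one_le_pow₀ (by linarith)
  have hdr : r ^ 17 ≤ d := le_trans (le_mul_of_one_le_left (by positivity) hL) hdlow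
  have hd0 : (0 : ℝ) < d := by linarith
  have hdn : (d : ℝ) ≤ n := le_trans (le_mul_of_one_le_right hd0.le hr1) hdup
  set κ := ⌈(n : ℝ) / (d * g ^ 8)⌉₊ with hκdef
  have hκ : 1 ≤ κ := Nat.ceil_pos.2 (by positivity)
  have hκlow : (n : ℝ) / (d * g ^ 8) ≤ κ := Nat.le_ceil _
  have hκup : (κ : ℝ) < n / (d * g ^ 8) + 1 := Nat.ceil_lt_add_one (by positivity)
  obtain ⟨w, hw1, hw2, hw3⟩ := exists_weighting_of_regular G hreg hg hκ
    (by
      have h1 : (g : ℝ) ^ 7 ≤ g ^ 17 := pow_le_pow_right₀ (by linarith) (by norm_num)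
      have h2 : (g : ℝ) ^ 7 ≤ d := by linarith
      exact_mod_cast h2)
    (by
      rw [div_le_iff₀ (by positivity)] at hκlow
      have h2 : (Fintype.card V : ℝ) ≤ d * (κ * g ^ 8) := by
        rw [← hcard]
        linarith
      exact_mod_cast h2)
    (by
      rw [← hcard]
      have h1 : 3 * L ≤ d / g ^ 14 := by
        rw [le_div_iff₀ (by positivity)]
        calc 3 * L * (g : ℝ) ^ 14 ≤ L * (r ^ 3 * r ^ 14) := by
              have : 3 ≤ r ^ 3 := by nlinarith [sq_nonneg r]
              have : 3 * (g : ℝ) ^ 14 ≤ r ^ 3 * r ^ 14 := by gcongr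
              nlinarith
          _ = L * r ^ 17 := by ring
          _ ≤ d := hdlow
      have h2 : Real.exp (-2 * (d / g ^ 14)) ≤ 1 / (n : ℝ) ^ 6 := by
        calc Real.exp (-2 * (d / g ^ 14)) ≤ Real.exp (-((6 : ℕ) * L)) := by
              gcongr
              push_cast
              linarith
          _ = 1 / (n : ℝ) ^ 6 := by
            rw [Real.exp_neg, Real.exp_nat_mul, hLdef, Real.exp_log (by linarith), one_div]
      have h3 : (g : ℝ) ^ 7 + (g ^ 7 + 1) * (g ^ 7 + 1) ≤ 5 * n := by
        have h4 : (1 : ℝ) ≤ g ^ 7 := one_le_pow₀ (by linarith)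
        have h5 : (g : ℝ) ^ 14 ≤ g ^ 17 := pow_le_pow_right₀ (by linarith) (by norm_num)
        have h6 : (g : ℝ) ^ 14 = g ^ 7 * g ^ 7 := by ring
        nlinarith
      calc 2 * (n : ℝ) * (g ^ 7 + (g ^ 7 + 1) * (g ^ 7 + 1)) * Real.exp (-2 * (d / g ^ 14))
          ≤ 2 * (n : ℝ) * (5 * n) * (1 / (n : ℝ) ^ 6) := by gcongr
        _ = 10 / (n : ℝ) ^ 4 := by field_simp; norm_num
        _ < 1 := by
          rw [div_lt_one (by positivity)]
          calc (10 : ℝ) < 10 ^ 4 := by norm_num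
            _ ≤ (n : ℝ) ^ 4 := by gcongr)
  have hs := irregularityStrength_le_of_weighting G w hw1 hw2 hw3
  have hs' : (irregularityStrength G : ℝ) ≤ 46 * (κ * g ^ 7) + κ * g ^ 8 := by exact_mod_cast hs
  set ρ : ℝ := n / d with hρ
  have hρ0 : 0 < ρ := by positivity
  have hρg : (g : ℝ) ^ 9 ≤ ρ := by
    have h1 : (g : ℝ) ^ 9 ≤ g ^ 17 := pow_le_pow_right₀ (by linarith) (by norm_num)
    rw [hρ, le_div_iff₀ hd0]
    nlinarith
  have hκ8 : κ * (g : ℝ) ^ 8 ≤ ρ * (1 + 1 / g) := by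
    have h1 : κ * (g : ℝ) ^ 8 ≤ (n / (d * g ^ 8) + 1) * g ^ 8 := by gcongr
    have h2 : ((n : ℝ) / (d * g ^ 8) + 1) * g ^ 8 = ρ + g ^ 8 := by
      rw [hρ]
      field_simp
    have h3 : (g : ℝ) ^ 8 ≤ ρ * (1 / g) := by
      rw [mul_one_div, le_div_iff₀ hg0]
      linarith
    linarith
  have hfac : (1 + 1 / (g : ℝ)) * (1 + 46 / g) ≤ 1 + 1 / z := by
    have h1 : (1 + 1 / (g : ℝ)) * (1 + 46 / g) ≤ 1 + 93 / g := by
      have h2 : 1 / (g : ℝ) ≤ 1 := by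
        rw [div_le_one hg0]
        linarith
      have h3 : 0 < 1 / (g : ℝ) := by positivity
      have h4 : 46 / (g : ℝ) = 46 * (1 / g) := by ring
      have h5 : 93 / (g : ℝ) = 93 * (1 / g) := by ring
      rw [h4, h5]
      nlinarith
    have h2 : 93 / (g : ℝ) ≤ 1 / z := by
      rw [div_le_div_iff₀ hg0 hz0]
      linarith
    linarith
  calc (irregularityStrength G : ℝ) ≤ 46 * (κ * g ^ 7) + κ * g ^ 8 := hs'
    _ = κ * (g : ℝ) ^ 8 * (1 + 46 / g) := by field_simp; ring
    _ ≤ ρ * (1 + 1 / g) * (1 + 46 / g) := by gcongr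
    _ = ρ * ((1 + 1 / g) * (1 + 46 / g)) := by ring
    _ ≤ ρ * (1 + 1 / z) := by gcongr
end

section
/- For every fixed real ε₀ > 0 and every real η > 0 there exists a constant N such that for every d-regular simple graph G with n vertices, where n ≥ N and ln^{1+ε₀} n ≤ d ≤ n / ln^{ε₀} n, the irregularity strength of G satisfies n/d ≤ s(G) ≤ (1 + η)·n/d; in other words, s(G) = (1 + o(1))·n/d in this range of degrees. -/
open Finset

open Real in
/-- Exponential moment of a centred function of a uniformly random colouring, summed over a set. -/
lemma sum_exp_sum_le {V ι : Type*} [Fintype V] [DecidableEq V] [Fintype ι]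
    (s : Finset V) (g : ι → ℝ) (t : ℝ) (hg : ∑ i, g i = 0) (ht : ∀ i, |g i| ≤ t) (ht1 : t ≤ 1) :
    ∑ c : V → ι, exp (∑ u ∈ s, g (c u)) ≤
      (Fintype.card ι : ℝ) ^ Fintype.card V * exp (t ^ 2 * #s) := by
  have factor : ∑ i, exp (g i) ≤ Fintype.card ι * exp (t ^ 2) := by
    have h1 : ∀ i, exp (g i) ≤ 1 + g i + t ^ 2 := by
      intro i
      have h2 := Real.abs_exp_sub_one_sub_id_le ((ht i).trans ht1)
      have h3 : g i ^ 2 ≤ t ^ 2 := sq_le_sq' (by linarith [neg_abs_le (g i), ht i])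
        (by linarith [le_abs_self (g i), ht i])
      linarith [le_abs_self (exp (g i) - 1 - g i)]
    calc ∑ i, exp (g i) ≤ ∑ i, (1 + g i + t ^ 2) := Finset.sum_le_sum fun i _ => h1 i
      _ = Fintype.card ι * (t ^ 2 + 1) := by
        simp [Finset.sum_add_distrib, hg]; ring
      _ ≤ _ := by gcongr; exact add_one_le_exp _
  have expand : ∀ c : V → ι, exp (∑ u ∈ s, g (c u)) =
      ∏ u, if u ∈ s then exp (g (c u)) else 1 := by
    intro c
    rw [exp_sum, Finset.prod_ite_mem, Finset.univ_inter]
  calc ∑ c : V → ι, exp (∑ u ∈ s, g (c u))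
      = ∏ u : V, ∑ i : ι, if u ∈ s then exp (g i) else 1 := by
        simp_rw [expand]
        rw [Finset.prod_univ_sum, Fintype.piFinset_univ]
    _ ≤ ∏ u : V, ((Fintype.card ι : ℝ) * if u ∈ s then exp (t ^ 2) else 1) := by
        refine Finset.prod_le_prod (fun u _ => ?_) fun u _ => ?_
        · split_ifs <;> positivity
        · split_ifs
          · exact factor
          · simp
    _ = _ := by
        rw [Finset.prod_mul_distrib, Finset.prod_ite_mem, Finset.univ_inter]
        simp [← Real.exp_nat_mul, mul_comm]

open Real in
/-- A regular graph of large degree has a colouring in which every vertex sees every colour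
almost equally often. -/
lemma exists_balanced_coloring {V ι : Type*} [Fintype V] [Fintype ι] [DecidableEq ι]
    [Nonempty ι] (G : SimpleGraph V) [DecidableRel G.Adj] {d : ℕ}
    (hreg : G.IsRegularOfDegree d) {γ : ℝ} (hγ : 0 < γ) (hγ1 : γ ≤ 1)
    (h : 2 * Fintype.card V * Fintype.card ι * exp (-(γ ^ 2 * d / 4)) < 1) :
    ∃ c : V → ι, ∀ v j,
      |(#{u ∈ G.neighborFinset v | c u = j} : ℝ) - d / Fintype.card ι| ≤ γ * d := by
  classical
  set q : ℝ := (Fintype.card ι : ℝ) with hq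
  have hq1 : 1 ≤ q := by
    rw [hq]; exact_mod_cast Fintype.card_pos
  let X : ι → ι → ℝ := fun j i => (if i = j then 1 else 0) - 1 / q
  have hXsum : ∀ j, ∑ i, X j i = 0 := by
    intro j
    simp only [X, Finset.sum_sub_distrib, Finset.sum_ite_eq', Finset.mem_univ, if_true,
      Finset.sum_const, Finset.card_univ, nsmul_eq_mul]
    rw [← hq]; field_simp; ring
  have hXabs : ∀ j i, |X j i| ≤ 1 := by
    intro j i
    have h1 : 1 / q ≤ 1 := by rw [div_le_one (by linarith)]; exact hq1
    have h2 : 0 ≤ 1 / q := by positivity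
    simp only [X]
    rw [abs_le]
    split_ifs <;> constructor <;> linarith
  have hY : ∀ (c : V → ι) v j, ∑ u ∈ G.neighborFinset v, X j (c u) =
      (#{u ∈ G.neighborFinset v | c u = j} : ℝ) - d / q := by
    intro c v j
    simp only [X, Finset.sum_sub_distrib, Finset.sum_const, Finset.sum_boole,
      G.card_neighborFinset_eq_degree, hreg v, nsmul_eq_mul]
    ring
  have key : ∀ (e : ℝ), |e| = 1 → ∀ v j,
      ∑ c : V → ι, exp (∑ u ∈ G.neighborFinset v, e * (γ / 2) * X j (c u)) ≤
        q ^ Fintype.card V * exp ((γ / 2) ^ 2 * d) := by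
    intro e he v j
    have := sum_exp_sum_le (G.neighborFinset v) (fun i => e * (γ / 2) * X j i) (γ / 2)
      (by rw [← Finset.mul_sum, hXsum, mul_zero])
      (by
        intro i
        rw [abs_mul, abs_mul, he, one_mul, abs_of_pos (by positivity : 0 < γ / 2)]
        exact mul_le_of_le_one_right (by positivity) (hXabs j i))
      (by linarith)
    rwa [G.card_neighborFinset_eq_degree, hreg v] at this
  let F : (V → ι) → ℝ := fun c => ∑ v, ∑ j,
    (exp (∑ u ∈ G.neighborFinset v, 1 * (γ / 2) * X j (c u)) +
      exp (∑ u ∈ G.neighborFinset v, (-1) * (γ / 2) * X j (c u))) * exp (-(γ / 2 * (γ * d)))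
  have hF : ∑ c, F c < ∑ c : V → ι, (1 : ℝ) := by
    have e1 : exp ((γ / 2) ^ 2 * d) * exp (-(γ / 2 * (γ * d))) = exp (-(γ ^ 2 * d / 4)) := by
      rw [← exp_add]; ring_nf
    calc ∑ c, F c = ∑ v, ∑ j,
          (∑ c : V → ι, exp (∑ u ∈ G.neighborFinset v, 1 * (γ / 2) * X j (c u)) +
          ∑ c : V → ι, exp (∑ u ∈ G.neighborFinset v, (-1) * (γ / 2) * X j (c u))) *
            exp (-(γ / 2 * (γ * d))) := by
          rw [Finset.sum_comm]
          refine Finset.sum_congr rfl fun v _ => ?_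
          rw [Finset.sum_comm]
          refine Finset.sum_congr rfl fun j _ => ?_
          rw [← Finset.sum_mul, Finset.sum_add_distrib]
      _ ≤ ∑ v : V, ∑ j : ι, (q ^ Fintype.card V * exp ((γ / 2) ^ 2 * d) +
          q ^ Fintype.card V * exp ((γ / 2) ^ 2 * d)) * exp (-(γ / 2 * (γ * d))) := by
          refine Finset.sum_le_sum fun v _ => Finset.sum_le_sum fun j _ => ?_
          gcongr
          · exact key 1 (by simp) v j
          · exact key (-1) (by simp) v j
      _ = q ^ Fintype.card V *
          (2 * Fintype.card V * Fintype.card ι * exp (-(γ ^ 2 * d / 4))) := by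
          rw [← e1]
          simp only [Finset.sum_const, Finset.card_univ, nsmul_eq_mul]
          ring
      _ < q ^ Fintype.card V * 1 := by gcongr
      _ = ∑ c : V → ι, (1 : ℝ) := by simp [hq]
  obtain ⟨c, -, hc⟩ := Finset.exists_lt_of_sum_lt hF
  refine ⟨c, fun v j => ?_⟩
  rw [← hY c v j]
  have hterm : (exp (∑ u ∈ G.neighborFinset v, 1 * (γ / 2) * X j (c u)) +
      exp (∑ u ∈ G.neighborFinset v, (-1) * (γ / 2) * X j (c u))) *
        exp (-(γ / 2 * (γ * d))) < 1 := by
    refine lt_of_le_of_lt ?_ hc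
    refine le_trans ?_ (Finset.single_le_sum (fun v _ => Finset.sum_nonneg fun j _ => by positivity)
      (Finset.mem_univ v))
    exact Finset.single_le_sum (f := fun j =>
      (exp (∑ u ∈ G.neighborFinset v, 1 * (γ / 2) * X j (c u)) +
      exp (∑ u ∈ G.neighborFinset v, (-1) * (γ / 2) * X j (c u))) *
        exp (-(γ / 2 * (γ * d)))) (fun j _ => by positivity) (Finset.mem_univ j)
  have bound : ∀ e : ℝ, exp (∑ u ∈ G.neighborFinset v, e * (γ / 2) * X j (c u)) *
      exp (-(γ / 2 * (γ * d))) < 1 → e * ∑ u ∈ G.neighborFinset v, X j (c u) ≤ γ * d := by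
    intro e he
    rw [← exp_add, ← Finset.mul_sum, exp_lt_one_iff] at he
    have : γ / 2 * (e * ∑ u ∈ G.neighborFinset v, X j (c u)) < γ / 2 * (γ * d) := by linarith
    exact (lt_of_mul_lt_mul_left this (by positivity)).le
  have pos : ∀ x : ℝ, 0 < exp x * exp (-(γ / 2 * (γ * d))) := fun x => by positivity
  rw [add_mul] at hterm
  rw [abs_le']
  constructor
  · simpa using bound 1 (by linarith [pos (∑ u ∈ G.neighborFinset v, (-1) * (γ / 2) * X j (c u))])
  · simpa using bound (-1) (by linarith [pos (∑ u ∈ G.neighborFinset v, 1 * (γ / 2) * X j (c u))])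

/-- Shifting two elements by a uniformly random amount: if no shift decreases the number of
coincidences, then few elements coincide with a shifted one. -/
lemma card_coincidence_le_of_forall_shift {V : Type*} [DecidableEq V] (C : Finset V) {p : ℕ}
    [NeZero p] (lev : V → ℕ) {S : ℕ} (hS : ∀ i, #{a ∈ C | lev a = i} ≤ S) (f : V → ZMod p)
    {u v : V} (hv : v ∈ C)
    (hmin : ∀ r : ZMod p, #{x ∈ C ×ˢ C | lev x.1 = lev x.2 ∧ f x.1 = f x.2} ≤
      #{x ∈ C ×ˢ C | lev x.1 = lev x.2 ∧
        f x.1 + (if x.1 = u ∨ x.1 = v then r else 0) =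
          f x.2 + (if x.2 = u ∨ x.2 = v then r else 0)}) :
    p * #{a ∈ C | lev a = lev v ∧ f a = f v} ≤ 4 * S + 2 * p := by
  classical
  let T : V → Prop := fun a => a = u ∨ a = v
  let mixed : V × V → Prop := fun x => ¬ (T x.1 ↔ T x.2)
  have pair : ∀ x : V × V,
      (∑ r : ZMod p, if lev x.1 = lev x.2 ∧ f x.1 + (if T x.1 then r else 0) =
          f x.2 + (if T x.2 then r else 0) then 1 else 0) +
        p * (if mixed x ∧ lev x.1 = lev x.2 ∧ f x.1 = f x.2 then 1 else 0) =
      p * (if lev x.1 = lev x.2 ∧ f x.1 = f x.2 then 1 else 0) +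
        (if mixed x ∧ lev x.1 = lev x.2 then 1 else 0) := by
    rintro ⟨a, b⟩
    by_cases hl : lev a = lev b
    swap
    · simp [hl]
    by_cases ha : T a <;> by_cases hb : T b
    · simp [hl, ha, hb, mixed, ZMod.card]
    · have : ∀ r : ZMod p, (f a + r = f b) ↔ r = f b - f a :=
        fun r => by rw [eq_sub_iff_add_eq, add_comm]
      simp [hl, ha, hb, mixed, this]
      ring
    · have : ∀ r : ZMod p, (f a = f b + r) ↔ r = f a - f b :=
        fun r => by rw [eq_sub_iff_add_eq, add_comm, eq_comm]
      simp [hl, ha, hb, mixed, this]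
      ring
    · simp [hl, ha, hb, mixed, ZMod.card]
  have total := Finset.sum_congr (rfl : C ×ˢ C = C ×ˢ C) fun x _ => pair x
  rw [Finset.sum_add_distrib, Finset.sum_add_distrib, Finset.sum_comm, ← Finset.mul_sum,
    ← Finset.mul_sum] at total
  have lower : p * #{x ∈ C ×ˢ C | lev x.1 = lev x.2 ∧ f x.1 = f x.2} ≤
      ∑ r : ZMod p, #{x ∈ C ×ˢ C | lev x.1 = lev x.2 ∧ f x.1 + (if T x.1 then r else 0) =
          f x.2 + (if T x.2 then r else 0)} := by
    have := Finset.card_nsmul_le_sum (Finset.univ : Finset (ZMod p)) _ _ fun r _ => hmin r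
    simpa [ZMod.card] using this
  have main : p * #{x ∈ C ×ˢ C | mixed x ∧ lev x.1 = lev x.2 ∧ f x.1 = f x.2} ≤
      #{x ∈ C ×ˢ C | mixed x ∧ lev x.1 = lev x.2} := by
    simp only [Finset.card_filter] at lower ⊢
    omega
  have line : ∀ w : V, #{b ∈ C | lev w = lev b} ≤ S := fun w => by
    simpa only [eq_comm] using hS (lev w)
  have upper : #{x ∈ C ×ˢ C | mixed x ∧ lev x.1 = lev x.2} ≤ 4 * S := by
    have sub : {x ∈ C ×ˢ C | mixed x ∧ lev x.1 = lev x.2} ⊆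
        ({b ∈ C | lev u = lev b}.image (fun b => (u, b)) ∪
          {b ∈ C | lev v = lev b}.image (fun b => (v, b))) ∪
        ({b ∈ C | lev u = lev b}.image (fun b => (b, u)) ∪
          {b ∈ C | lev v = lev b}.image (fun b => (b, v))) := by
      rintro ⟨a, b⟩ hx
      simp only [Finset.mem_filter, Finset.mem_product, mixed, T] at hx
      simp only [Finset.mem_union, Finset.mem_image, Finset.mem_filter, Prod.mk.injEq]
      grind
    refine (Finset.card_le_card sub).trans ?_
    refine (Finset.card_union_le _ _).trans ?_
    have h1 := Finset.card_union_le ({b ∈ C | lev u = lev b}.image (fun b => (u, b)))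
      ({b ∈ C | lev v = lev b}.image (fun b => (v, b)))
    have h2 := Finset.card_union_le ({b ∈ C | lev u = lev b}.image (fun b => (b, u)))
      ({b ∈ C | lev v = lev b}.image (fun b => (b, v)))
    have i1 := (Finset.card_image_le (s := {b ∈ C | lev u = lev b}) (f := fun b => (u, b))).trans
      (line u)
    have i2 := (Finset.card_image_le (s := {b ∈ C | lev v = lev b}) (f := fun b => (v, b))).trans
      (line v)
    have i3 := (Finset.card_image_le (s := {b ∈ C | lev u = lev b}) (f := fun b => (b, u))).trans
      (line u)
    have i4 := (Finset.card_image_le (s := {b ∈ C | lev v = lev b}) (f := fun b => (b, v))).trans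
      (line v)
    omega
  have row : #{a ∈ C | lev a = lev v ∧ f a = f v} ≤
      #{x ∈ C ×ˢ C | mixed x ∧ lev x.1 = lev x.2 ∧ f x.1 = f x.2} + 2 := by
    have sub : {a ∈ C | lev a = lev v ∧ f a = f v} ⊆
        ({x ∈ C ×ˢ C | mixed x ∧ lev x.1 = lev x.2 ∧ f x.1 = f x.2}.filter
          (fun x => x.2 = v)).image Prod.fst ∪ {u, v} := by
      intro a ha
      simp only [Finset.mem_filter] at ha
      by_cases hT : T a
      · exact Finset.mem_union_right _ (by simpa [T] using hT)
      · refine Finset.mem_union_left _ (Finset.mem_image.2 ⟨(a, v), ?_, rfl⟩)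
        simp [ha, hv, mixed, hT, T]
    refine (Finset.card_le_card sub).trans ((Finset.card_union_le _ _).trans ?_)
    exact Nat.add_le_add (Finset.card_image_le.trans (Finset.card_filter_le _ _))
      Finset.card_le_two
  calc p * #{a ∈ C | lev a = lev v ∧ f a = f v}
      ≤ p * (#{x ∈ C ×ˢ C | mixed x ∧ lev x.1 = lev x.2 ∧ f x.1 = f x.2} + 2) := by gcongr
    _ ≤ 4 * S + 2 * p := by rw [mul_add]; omega

/-- Weights in `{0, …, p - 1}` on the edges inside `C` can be chosen so that, in every level, the
vertices of `C` are well spread over the residue classes modulo `p`. -/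
lemma exists_spread_residues {V : Type*} [Fintype V] [DecidableEq V] (G : SimpleGraph V)
    [DecidableRel G.Adj] (C : Finset V) (hC : ∀ v ∈ C, ∃ u ∈ C, G.Adj v u) {p : ℕ} (hp : 0 < p)
    (b : V → ℤ) (lev : V → ℕ) {S : ℕ} (hS : ∀ i, #{a ∈ C | lev a = i} ≤ S) :
    ∃ ρ : Sym2 V → ℕ, (∀ e, ρ e < p) ∧ ∀ v ∈ C,
      p * #{a ∈ C | lev a = lev v ∧
        ((b a + ∑ w ∈ G.neighborFinset a with w ∈ C, (ρ s(a, w) : ℤ) : ℤ) : ZMod p) =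
        ((b v + ∑ w ∈ G.neighborFinset v with w ∈ C, (ρ s(v, w) : ℤ) : ℤ) : ZMod p)}
      ≤ 4 * S + 2 * p := by
  classical
  have : NeZero p := ⟨hp.ne'⟩
  let res : (Sym2 V → ZMod p) → V → ZMod p := fun ρ a =>
    (b a : ZMod p) + ∑ w ∈ G.neighborFinset a with w ∈ C, ρ s(a, w)
  obtain ⟨ρ, hρ⟩ := Finite.exists_min fun ρ : Sym2 V → ZMod p =>
    #{x ∈ C ×ˢ C | lev x.1 = lev x.2 ∧ res ρ x.1 = res ρ x.2}
  refine ⟨fun e => (ρ e).val, fun e => ZMod.val_lt _, fun v hv => ?_⟩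
  obtain ⟨u, hu, huv⟩ := hC v hv
  have shift : ∀ r : ZMod p, ∀ a ∈ C, res (fun e => ρ e + if e = s(u, v) then r else 0) a =
      res ρ a + if a = u ∨ a = v then r else 0 := by
    intro r a ha
    simp only [res, Finset.sum_add_distrib, add_assoc]
    congr 2
    have huv' := huv.ne
    rw [← Finset.sum_filter, Finset.sum_const]
    by_cases h1 : a = u
    · have : {w ∈ {w ∈ G.neighborFinset a | w ∈ C} | s(a, w) = s(u, v)} = {v} := by
        ext w
        simp only [Finset.mem_filter, SimpleGraph.mem_neighborFinset, Finset.mem_singleton,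
          Sym2.eq_iff]
        constructor
        · grind
        · rintro rfl
          exact ⟨⟨h1 ▸ huv.symm, hv⟩, Or.inl ⟨h1, rfl⟩⟩
      rw [this]; simp [h1]
    by_cases h2 : a = v
    · have : {w ∈ {w ∈ G.neighborFinset a | w ∈ C} | s(a, w) = s(u, v)} = {u} := by
        ext w
        simp only [Finset.mem_filter, SimpleGraph.mem_neighborFinset, Finset.mem_singleton,
          Sym2.eq_iff]
        constructor
        · grind
        · rintro rfl
          exact ⟨⟨h2 ▸ huv, hu⟩, Or.inr ⟨h2, rfl⟩⟩
      rw [this]; simp [h2]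
    · have : {w ∈ {w ∈ G.neighborFinset a | w ∈ C} | s(a, w) = s(u, v)} = ∅ := by
        ext w
        simp [h1, h2]
      rw [this]; simp [h1, h2]
  have := card_coincidence_le_of_forall_shift C lev hS (res ρ) (u := u) hv fun r => by
    refine (hρ fun e => ρ e + if e = s(u, v) then r else 0).trans (le_of_eq ?_)
    congr 1
    refine Finset.filter_congr fun x hx => ?_
    rw [Finset.mem_product] at hx
    rw [shift r _ hx.1, shift r _ hx.2]
  simpa [res] using this

/-- Switching a `0`-`1`-valued state on a suitable set changes its total by any prescribed amount
in the possible range. -/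
lemma exists_switch {V : Type*} [DecidableEq V] (N : Finset V) (s : V → ℤ) {t : ℤ}
    (hs : ∀ u ∈ N, s u = 0 ∨ s u = 1) (ht : -(#{u ∈ N | s u = 1} : ℤ) ≤ t)
    (ht' : t ≤ #{u ∈ N | s u = 0}) :
    ∃ g : V → ℤ, (∀ u, |g u| ≤ 1) ∧ (∀ u ∉ N, g u = 0) ∧
      (∀ u ∈ N, s u + g u = 0 ∨ s u + g u = 1) ∧ ∑ u ∈ N, g u = t := by
  rcases le_total 0 t with h | h
  · obtain ⟨X, hX, hcard⟩ := Finset.exists_subset_card_eq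
      (show t.toNat ≤ #{u ∈ N | s u = 0} by omega)
    have hXN : X ⊆ N := hX.trans (Finset.filter_subset _ _)
    refine ⟨fun u => if u ∈ X then 1 else 0, fun u => ?_, fun u hu => ?_, fun u hu => ?_, ?_⟩
    · dsimp only; split_ifs <;> simp
    · exact if_neg fun h' => hu (hXN h')
    · dsimp only
      split_ifs with hux
      · have := hX hux
        simp only [Finset.mem_filter] at this
        omega
      · simpa using hs u hu
    · rw [Finset.sum_boole, Finset.filter_mem_eq_inter, Finset.inter_eq_right.2 hXN, hcard]
      simpa using h
  · obtain ⟨X, hX, hcard⟩ := Finset.exists_subset_card_eq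
      (show (-t).toNat ≤ #{u ∈ N | s u = 1} by omega)
    have hXN : X ⊆ N := hX.trans (Finset.filter_subset _ _)
    refine ⟨fun u => -if u ∈ X then 1 else 0, fun u => ?_, fun u hu => ?_, fun u hu => ?_, ?_⟩
    · dsimp only; split_ifs <;> simp
    · dsimp only; rw [if_neg fun h' => hu (hXN h'), neg_zero]
    · dsimp only
      split_ifs with hux
      · have := hX hux
        simp only [Finset.mem_filter] at this
        omega
      · simpa using hs u hu
    · rw [Finset.sum_neg_distrib, Finset.sum_boole, Finset.filter_mem_eq_inter,
        Finset.inter_eq_right.2 hXN, hcard]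
      omega

/-- Among `T` consecutive terms of an arithmetic progression with difference `p` there is one
whose residue modulo `m * p` is less than `p` and which avoids a small set. -/
lemma exists_shift_avoiding {p m T : ℕ} (hp : 0 < p) (hm : 0 < m) (b l : ℤ) (U : Finset ℤ)
    (hU : #{x ∈ U | ((x : ℤ) : ZMod p) = (b : ZMod p) ∧ b + p * l ≤ x ∧ x ≤ b + p * (l + T)} < T / m) :
    ∃ t : ℤ, l ≤ t ∧ t ≤ l + T ∧ (b + p * t) % (m * p : ℕ) < p ∧ b + p * t ∉ U := by
  set q := b / p with hq
  set t₀ : ℤ := l + (-(q + l)) % m with ht₀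
  have hpZ : (0 : ℤ) < p := by exact_mod_cast hp
  have hmZ : (0 : ℤ) < m := by exact_mod_cast hm
  have hr0 := Int.emod_nonneg (-(q + l)) hmZ.ne'
  have hr1 := Int.emod_lt_of_pos (-(q + l)) hmZ
  have htop : ∀ j : ℕ, j < T / m → t₀ + m * j ≤ l + T := by
    intro j hj
    have h1 : m * (j + 1) ≤ T := (Nat.mul_le_mul_left m hj).trans (Nat.mul_div_le T m)
    have h2 : (m : ℤ) * (j + 1) ≤ T := by exact_mod_cast h1
    linarith
  have hbot : ∀ j : ℕ, l ≤ t₀ + m * j := fun j => by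
    have : (0 : ℤ) ≤ m * j := by positivity
    omega
  have hinj : Function.Injective fun j : ℕ => b + p * (t₀ + m * j) := by
    intro i j hij
    have h1 : (p : ℤ) * (t₀ + m * i) = p * (t₀ + m * j) := by simpa using hij
    have h2 := mul_left_cancel₀ hpZ.ne' h1
    have h3 : (m : ℤ) * i = m * j := by linarith
    exact_mod_cast mul_left_cancel₀ hmZ.ne' h3
  obtain ⟨x, hx, hxU⟩ := Finset.exists_mem_notMem_of_card_lt_card
    (t := (Finset.range (T / m)).image fun j : ℕ => b + p * (t₀ + m * j))
    (hU.trans_eq (by rw [Finset.card_image_of_injective _ hinj, Finset.card_range]))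
  obtain ⟨j, hj, rfl⟩ := Finset.mem_image.1 hx
  rw [Finset.mem_range] at hj
  refine ⟨t₀ + m * j, hbot j, htop j hj, ?_, fun hmem => hxU ?_⟩
  · have hdvd : (m : ℤ) ∣ q + t₀ := by
      have h1 : q + t₀ = (-(q + l)) % m - (-(q + l)) := by rw [ht₀]; ring
      rw [h1, Int.emod_def]
      exact ⟨-(-(q + l) / m), by ring⟩
    obtain ⟨z, hz⟩ := hdvd
    have hb : b = p * q + b % p := (Int.mul_ediv_add_emod b p).symm
    have h0 := Int.emod_nonneg b hpZ.ne'
    have h1 := Int.emod_lt_of_pos b hpZ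
    have hval : b + p * (t₀ + m * j) = b % p + (m * p : ℕ) * (z + j) := by
      push_cast
      linear_combination hb + (p : ℤ) * hz
    have hle : (p : ℤ) ≤ (m * p : ℕ) := by exact_mod_cast Nat.le_mul_of_pos_left p hm
    rw [hval, Int.add_mul_emod_self_left, Int.emod_eq_of_lt h0 (h1.trans_le hle)]
    exact h1
  · refine Finset.mem_filter.2 ⟨hmem, by simp, ?_, ?_⟩
    · have := hbot j; gcongr
    · have := htop j hj; gcongr

/-- Switching edges between `C` and `D` one vertex of `C` at a time: the vertices of `D` keep their
values up to one switch, and the vertices of `C` get distinct values. -/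
lemma exists_toggles {V : Type*} [Fintype V] [DecidableEq V] (G : SimpleGraph V)
    [DecidableRel G.Adj] (C D : Finset V) {p m T T' : ℕ} (hp : 0 < p) (hm : 0 < m) (b : V → ℤ)
    (hT : ∀ v ∈ C, T ≤ #{u ∈ G.neighborFinset v | u ∈ D})
    (hT' : ∀ v ∈ C, #{u ∈ G.neighborFinset v | u ∈ D} ≤ T')
    (hconf : ∀ v ∈ C,
      #{a ∈ C | (b a : ZMod p) = (b v : ZMod p) ∧ |b a - b v| ≤ 2 * p * T'} < T / m) :
    ∃ χ : V → V → ℤ, (∀ u v, |χ u v| ≤ 1) ∧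
      (∀ u ∈ D, (∑ c ∈ G.neighborFinset u with c ∈ C, χ u c = 0) ∨
        ∑ c ∈ G.neighborFinset u with c ∈ C, χ u c = 1) ∧
      (∀ v ∈ C, (b v + p * ∑ u ∈ G.neighborFinset v with u ∈ D, χ u v) % (m * p : ℕ) < p) ∧
      Set.InjOn (fun v => b v + p * ∑ u ∈ G.neighborFinset v with u ∈ D, χ u v) C := by
  suffices H : ∀ C' ⊆ C, ∃ χ : V → V → ℤ, (∀ u v, |χ u v| ≤ 1) ∧ (∀ v ∉ C', ∀ u, χ u v = 0) ∧
      (∀ u ∈ D, (∑ c ∈ G.neighborFinset u with c ∈ C, χ u c = 0) ∨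
        ∑ c ∈ G.neighborFinset u with c ∈ C, χ u c = 1) ∧
      (∀ v ∈ C', (b v + p * ∑ u ∈ G.neighborFinset v with u ∈ D, χ u v) % (m * p : ℕ) < p) ∧
      Set.InjOn (fun v => b v + p * ∑ u ∈ G.neighborFinset v with u ∈ D, χ u v) C' by
    obtain ⟨χ, h1, -, h⟩ := H C subset_rfl
    exact ⟨χ, h1, h⟩
  intro C'
  induction C' using Finset.induction_on with
  | empty => exact fun _ => ⟨fun _ _ => 0, by simp⟩
  | insert v C' hv ih =>
    intro hsub
    obtain ⟨hvC, hsub'⟩ := Finset.insert_subset_iff.1 hsub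
    obtain ⟨χ, hχ, hzero, hstate, hzone, hinj⟩ := ih hsub'
    set N := {u ∈ G.neighborFinset v | u ∈ D} with hN
    set s : V → ℤ := fun u => ∑ c ∈ G.neighborFinset u with c ∈ C, χ u c with hs
    set f : V → ℤ := fun v => b v + p * ∑ u ∈ G.neighborFinset v with u ∈ D, χ u v with hf
    have hND : ∀ u ∈ N, u ∈ D := fun u hu => (Finset.mem_filter.1 hu).2
    have hcard : #{u ∈ N | s u = 0} + #{u ∈ N | s u = 1} = #N := by
      rw [← Finset.card_filter_add_card_filter_not (s := N) (fun u => s u = 0)]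
      congr 2
      refine Finset.filter_congr fun u hu => ?_
      rcases hstate u (hND u hu) with h | h <;> simp [hs, h]
    have hfb : ∀ a ∈ C, |f a - b a| ≤ p * T' := by
      intro a ha
      have h1 : |∑ u ∈ G.neighborFinset a with u ∈ D, χ u a| ≤ T' := by
        refine (Finset.abs_sum_le_sum_abs _ _).trans ?_
        refine (Finset.sum_le_card_nsmul _ _ 1 fun u _ => hχ u a).trans ?_
        rw [nsmul_one]
        exact_mod_cast hT' a ha
      simp only [hf, add_sub_cancel_left, abs_mul, Nat.abs_cast]
      gcongr
    obtain ⟨t, ht, ht', htz, htU⟩ := exists_shift_avoiding (T := T) hp hm (b v)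
      (-(#{u ∈ N | s u = 1} : ℤ)) (C'.image f) (by
        refine lt_of_le_of_lt ?_ (hconf v hvC)
        refine le_trans (Finset.card_le_card ?_) (Finset.card_image_le (f := f))
        intro x hx
        obtain ⟨hx1, hx2, hx3, hx4⟩ := Finset.mem_filter.1 hx
        obtain ⟨a, ha, rfl⟩ := Finset.mem_image.1 hx1
        refine Finset.mem_image.2 ⟨a, Finset.mem_filter.2 ⟨hsub' ha, ?_, ?_⟩, rfl⟩
        · simpa [hf] using hx2
        · have h1 := abs_le.1 (hfb a (hsub' ha))
          have h2 : (#{u ∈ N | s u = 1} : ℤ) ≤ T' := by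
            have : #N ≤ T' := hT' v hvC
            have := Finset.card_filter_le N fun u => s u = 1
            omega
          have h3 : -((#{u ∈ N | s u = 1} : ℕ) : ℤ) + T ≤ T' := by
            have := (hT v hvC).trans (hT' v hvC)
            omega
          have h4 : (p : ℤ) * (-((#{u ∈ N | s u = 1} : ℕ) : ℤ) + T) ≤ p * T' := by gcongr
          have h5 : (p : ℤ) * (#{u ∈ N | s u = 1} : ℕ) ≤ p * T' := by gcongr
          rw [abs_le]
          constructor <;> linarith)
    obtain ⟨g, hg, hgN, hgs, hgsum⟩ := exists_switch N s (t := t)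
      (fun u hu => hstate u (hND u hu)) ht (by have : T ≤ #N := hT v hvC; omega)
    have hsumv : ∀ w, ∑ u ∈ G.neighborFinset w with u ∈ D,
        (χ u w + if w = v then g u else 0) =
        if w = v then t else ∑ u ∈ G.neighborFinset w with u ∈ D, χ u w := by
      intro w
      split_ifs with hw
      · subst hw
        simp only [hzero w hv, zero_add]
        exact hgsum
      · simp
    have hne : ∀ w ∈ C', w ≠ v := fun w hw h => hv (h ▸ hw)
    refine ⟨fun u w => χ u w + if w = v then g u else 0, fun u w => ?_, fun w hw u => ?_,
      fun u hu => ?_, fun w hw => ?_, ?_⟩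
    · by_cases h : w = v
      · subst h
        simpa [hzero w hv u] using hg u
      · simpa [h] using hχ u w
    · rw [Finset.mem_insert, not_or] at hw
      simp [hw.1, hzero w hw.2 u]
    · have h1 : ∑ c ∈ G.neighborFinset u with c ∈ C, (χ u c + if c = v then g u else 0) =
          s u + if G.Adj u v then g u else 0 := by
        rw [Finset.sum_add_distrib, Finset.sum_ite_eq']
        simp [hs, hvC]
      rw [h1]
      by_cases h2 : u ∈ N
      · have h3 : G.Adj u v := by
          simpa [hN, G.adj_comm] using (Finset.mem_filter.1 h2).1
        simpa [h3] using hgs u h2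
      · simpa [hgN u h2] using hstate u hu
    · rw [hsumv]
      rcases Finset.mem_insert.1 hw with rfl | hw
      · simpa using htz
      · simpa [hne w hw] using hzone w hw
    · simp only [hsumv]
      rw [Finset.coe_insert, Set.injOn_insert (by simpa using hv)]
      constructor
      · refine hinj.congr fun w hw => ?_
        simp [hf, hne w hw]
      · rintro ⟨a, ha, hav⟩
        refine htU (Finset.mem_image.2 ⟨a, ha, ?_⟩)
        simpa [hne a ha, hf] using hav

/-- A number can be distributed over a set with bounded parts. -/
lemma exists_sum_eq_of_le {V : Type*} [DecidableEq V] (s : Finset V) (M : ℕ) :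
    ∀ t ≤ M * #s, ∃ F : V → ℕ, (∀ u, F u ≤ M) ∧ ∑ u ∈ s, F u = t := by
  induction s using Finset.induction_on with
  | empty => exact fun t ht => ⟨fun _ => 0, by simp, by simp at ht; simp [ht]⟩
  | insert a s ha ih =>
    intro t ht
    rw [Finset.card_insert_of_notMem ha, mul_add_one] at ht
    obtain ⟨F, hF, hsum⟩ := ih (t - min t M) (by omega)
    refine ⟨Function.update F a (min t M), fun u => ?_, ?_⟩
    · by_cases h : u = a
      · subst h; simp
      · simpa [h] using hF u
    · rw [Finset.sum_insert ha, Finset.sum_update_of_notMem ha, hsum, Function.update_self]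
      omega

/-- Few vertices per level can be given distinct values near their level, with residues modulo `P`
in a prescribed interval. -/
lemma exists_targets {V : Type*} (X : Finset V) (lev : V → ℕ) {h a o P : ℕ}
    (hX : ∀ i, #{v ∈ X | lev v = i} ≤ h * a) (ho : o + a ≤ P) :
    ∃ τ : V → ℕ, Set.InjOn τ X ∧ ∀ v ∈ X, (lev v + 1) * (h * P) ≤ τ v ∧
      τ v < (lev v + 2) * (h * P) ∧ o ≤ τ v % P ∧ τ v % P < o + a := by
  classical
  let j : V → ℕ := fun v =>
    if hv : v ∈ X then ({w ∈ X | lev w = lev v}.equivFin ⟨v, by simp [hv]⟩ : ℕ) else 0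
  have hjlt : ∀ v ∈ X, j v < h * a := by
    intro v hv
    simp only [j, dif_pos hv]
    exact (Fin.is_lt _).trans_le (hX _)
  have hjinj : ∀ v ∈ X, ∀ w ∈ X, lev v = lev w → j v = j w → v = w := by
    intro v hv w hw hl hj
    simp only [j, dif_pos hv, dif_pos hw] at hj
    have : ∀ (i i' : ℕ) (hi : i = i') (h1 : v ∈ {w ∈ X | lev w = i})
        (h2 : w ∈ {w ∈ X | lev w = i'}), ({w ∈ X | lev w = i}.equivFin ⟨v, h1⟩ : ℕ) =
          ({w ∈ X | lev w = i'}.equivFin ⟨w, h2⟩ : ℕ) → v = w := by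
      rintro i _ rfl h1 h2 h3
      simpa using ({w ∈ X | lev w = i}.equivFin).injective (Fin.ext h3)
    exact this _ _ hl _ _ hj
  have ha : ∀ v ∈ X, 0 < a := fun v hv => Nat.pos_of_ne_zero fun h0 => by
    have := hjlt v hv
    simp [h0] at this
  have hmod : ∀ v ∈ X, j v % a < a := fun v hv => Nat.mod_lt _ (ha v hv)
  have hdiv : ∀ v ∈ X, j v / a < h := fun v hv => Nat.div_lt_of_lt_mul (by
    rw [mul_comm]; exact hjlt v hv)
  let y : V → ℕ := fun v => P * (j v / a) + (o + j v % a)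
  have hy : ∀ v ∈ X, y v < h * P := by
    intro v hv
    have h1 := hmod v hv
    calc y v < P * (j v / a) + P := by simp only [y]; omega
      _ = P * (j v / a + 1) := by ring
      _ ≤ P * h := Nat.mul_le_mul_left _ (hdiv v hv)
      _ = h * P := mul_comm _ _
  have hτmod : ∀ v ∈ X, ((lev v + 1) * (h * P) + y v) % P = o + j v % a := by
    intro v hv
    have h1 := hmod v hv
    have h2 : (lev v + 1) * (h * P) + y v = (o + j v % a) + P * ((lev v + 1) * h + j v / a) := by
      simp only [y]; ring
    rw [h2, Nat.add_mul_mod_self_left, Nat.mod_eq_of_lt (by omega)]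
  refine ⟨fun v => (lev v + 1) * (h * P) + y v, fun v hv w hw hvw => ?_, fun v hv => ?_⟩
  · dsimp only at hvw
    have hL : 0 < h * P := (Nat.zero_le _).trans_lt (hy v hv)
    have hlev : lev v = lev w := by
      have e : ∀ v ∈ X, ((lev v + 1) * (h * P) + y v) / (h * P) = lev v + 1 := by
        intro v hv
        rw [add_comm, Nat.add_mul_div_right _ _ hL, Nat.div_eq_of_lt (hy v hv), zero_add]
      have h1 := e v hv
      rw [hvw, e w hw] at h1
      omega
    have hmod' : j v % a = j w % a := by
      have h1 := hτmod v hv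
      rw [hvw, hτmod w hw] at h1
      omega
    have hyy : y v = y w := by rw [hlev] at hvw; omega
    have hPpos : 0 < P := Nat.pos_of_ne_zero (by rintro rfl; simp at hL)
    have hdiv' : j v / a = j w / a := by
      simp only [y, hmod'] at hyy
      exact Nat.eq_of_mul_eq_mul_left hPpos (by omega)
    refine hjinj v hv w hw hlev ?_
    rw [← Nat.div_add_mod (j v) a, ← Nat.div_add_mod (j w) a, hdiv', hmod']
  · have h1 := hmod v hv
    have h2 := hy v hv
    have h3 := hτmod v hv
    refine ⟨Nat.le_add_right _ _, ?_, ?_, ?_⟩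
    · dsimp only
      have : (lev v + 2) * (h * P) = (lev v + 1) * (h * P) + h * P := by ring
      omega
    · dsimp only; omega
    · dsimp only; omega

/-- Vertices at similar heights with equal residues are few, when every level is well spread over
the residue classes. -/
lemma card_near_lt {V : Type*} [DecidableEq V] (C : Finset V) (lev : V → ℕ) (b : V → ℤ)
    {p L W B X k : ℕ} (hL : 0 < L) (hlow : ∀ v ∈ C, (lev v * L : ℤ) - L ≤ b v)
    (hhigh : ∀ v ∈ C, b v ≤ lev v * L + L + B) (hW : 2 * L + B + X ≤ W * L)
    {R : ℕ} (hspread : ∀ v ∈ C, p * #{a ∈ C | lev a = lev v ∧ (b a : ZMod p) = (b v : ZMod p)} ≤ R)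
    (hR : (2 * W + 1) * R < p * k) {v : V} (hv : v ∈ C) :
    #{a ∈ C | (b a : ZMod p) = (b v : ZMod p) ∧ |b a - b v| ≤ X} < k := by
  have hsub : {a ∈ C | (b a : ZMod p) = (b v : ZMod p) ∧ |b a - b v| ≤ X} ⊆
      (Finset.Icc (lev v - W) (lev v + W)).biUnion fun i =>
        {a ∈ C | lev a = i ∧ (b a : ZMod p) = (b v : ZMod p)} := by
    intro a ha
    obtain ⟨haC, hres, hnear⟩ := Finset.mem_filter.1 ha
    rw [abs_le] at hnear
    have h1 := hlow v hv
    have h2 := hhigh v hv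
    have h3 := hlow a haC
    have h4 := hhigh a haC
    have hW' : (2 * L + B + X : ℤ) ≤ W * L := by exact_mod_cast hW
    have hLZ : (0 : ℤ) < L := by exact_mod_cast hL
    have h5 : (lev a : ℤ) ≤ lev v + W := by
      refine le_of_mul_le_mul_right ?_ hLZ
      linarith
    have h6 : (lev v : ℤ) ≤ lev a + W := by
      refine le_of_mul_le_mul_right ?_ hLZ
      linarith
    simp only [Finset.mem_biUnion, Finset.mem_Icc, Finset.mem_filter]
    exact ⟨lev a, by omega, haC, rfl, hres⟩
  have hclass : ∀ i, p * #{a ∈ C | lev a = i ∧ (b a : ZMod p) = (b v : ZMod p)} ≤ R := by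
    intro i
    rcases Finset.eq_empty_or_nonempty {a ∈ C | lev a = i ∧ (b a : ZMod p) = (b v : ZMod p)} with
      h | ⟨w, hw⟩
    · simp [h]
    · obtain ⟨hwC, hwl, hwr⟩ := Finset.mem_filter.1 hw
      have := hspread w hwC
      rwa [hwl, hwr] at this
  have hcount : p * #{a ∈ C | (b a : ZMod p) = (b v : ZMod p) ∧ |b a - b v| ≤ X} ≤
      (2 * W + 1) * R := by
    calc _ ≤ p * ∑ i ∈ Finset.Icc (lev v - W) (lev v + W),
          #{a ∈ C | lev a = i ∧ (b a : ZMod p) = (b v : ZMod p)} := by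
          gcongr
          exact (Finset.card_le_card hsub).trans Finset.card_biUnion_le
      _ = ∑ i ∈ Finset.Icc (lev v - W) (lev v + W),
          p * #{a ∈ C | lev a = i ∧ (b a : ZMod p) = (b v : ZMod p)} := Finset.mul_sum _ _ _
      _ ≤ #(Finset.Icc (lev v - W) (lev v + W)) • R :=
          Finset.sum_le_card_nsmul _ _ _ fun i _ => hclass i
      _ ≤ (2 * W + 1) * R := by
          rw [smul_eq_mul, Nat.card_Icc]
          gcongr
          omega
  exact lt_of_mul_lt_mul_left (hcount.trans_lt hR) (Nat.zero_le p)

/-- The construction: given levels and two special sets `C` and `D` that are seen regularly by all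
vertices, there is an irregular weighting. -/
lemma exists_irregular_weighting {V : Type} [Fintype V] [DecidableEq V] (G : SimpleGraph V)
    [DecidableRel G.Adj] {d : ℕ} (hreg : G.IsRegularOfDegree d) (C D : Finset V)
    (hCD : Disjoint C D) (lev : V → ℕ) {Q K M p m h T T' S W : ℕ} (hp : 0 < p) (hh : 0 < h)
    (hm : 3 < m)
    (hbase : ∀ v, |(K * #{u ∈ G.neighborFinset v | Q ≤ lev v + lev u} : ℤ) -
      lev v * (h * (m * p) : ℕ)| ≤ (h * (m * p) : ℕ))
    (hC : ∀ v, T ≤ #{u ∈ G.neighborFinset v | u ∈ C})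
    (hC' : ∀ v, #{u ∈ G.neighborFinset v | u ∈ C} ≤ T')
    (hD : ∀ v, T ≤ #{u ∈ G.neighborFinset v | u ∈ D})
    (hD' : ∀ v, #{u ∈ G.neighborFinset v | u ∈ D} ≤ T')
    (hM : 3 * (h * (m * p)) ≤ M * T)
    (hcardA : ∀ i, #{v ∈ (C ∪ D)ᶜ | lev v = i} ≤ h * ((m - 3) * p))
    (hcardD : ∀ i, #{v ∈ D | lev v = i} ≤ h * p)
    (hcardC : ∀ i, #{v ∈ C | lev v = i} ≤ S)
    (hW : 2 * (h * (m * p)) + (M * d + p * T') + 2 * p * T' ≤ W * (h * (m * p)))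
    (hconf : (2 * W + 1) * (4 * S + 2 * p) < p * (T / m)) :
    ∃ ω : Sym2 V → ℕ, (∀ e, 1 ≤ ω e ∧ ω e ≤ 1 + 2 * p + K + M) ∧
      ∀ u v : V, u ≠ v → weightedDeg G ω u ≠ weightedDeg G ω v := by
  set L := h * (m * p) with hL
  have hmp : 0 < m * p := Nat.mul_pos (by omega) hp
  have hLpos : 0 < L := Nat.mul_pos hh hmp
  have hTpos : 0 < T := by
    by_contra h0
    have : T = 0 := by omega
    simp [this] at hconf
  have h3p : 3 * p + (m - 3) * p = m * p := by
    rw [← add_mul]; congr 1; omega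
  let N₀ : V → ℕ := fun v => #{u ∈ G.neighborFinset v | Q ≤ lev v + lev u}
  -- targets for the vertices outside `C`
  obtain ⟨τA, hτAinj, hτA⟩ := exists_targets (C ∪ D)ᶜ lev (o := 3 * p) hcardA h3p.le
  obtain ⟨τD, hτDinj, hτD⟩ := exists_targets D lev (o := p) (P := m * p) hcardD (by nlinarith)
  let τ : V → ℕ := fun v => if v ∈ D then τD v else τA v
  have hτ : ∀ v ∉ C, (lev v + 1) * L ≤ τ v ∧ τ v < (lev v + 2) * L := by
    intro v hv
    by_cases hvD : v ∈ D
    · simp only [τ, if_pos hvD]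
      exact ⟨(hτD v hvD).1, (hτD v hvD).2.1⟩
    · simp only [τ, if_neg hvD]
      have := hτA v (by simp [hv, hvD])
      exact ⟨this.1, this.2.1⟩
  have hadj : ∀ v, ∃ F : V → ℕ, (∀ u, F u ≤ M) ∧
      (v ∉ C → (K * N₀ v : ℤ) + ∑ u ∈ G.neighborFinset v with u ∈ C, (F u : ℤ) = τ v) := by
    intro v
    by_cases hv : v ∈ C
    · exact ⟨fun _ => 0, by simp, fun h => absurd hv h⟩
    have h1 := hτ v hv
    have h2 := abs_le.1 (hbase v)
    have h3 : K * N₀ v ≤ lev v * L + L := by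
      zify; simp only [N₀]; linarith [h2.2]
    have h4 : lev v * L ≤ K * N₀ v + L := by
      zify; simp only [N₀]; linarith [h2.1]
    have e1 : (lev v + 1) * L = lev v * L + L := by ring
    have e2 : (lev v + 2) * L = lev v * L + 2 * L := by ring
    have h5 : M * T ≤ M * #{u ∈ G.neighborFinset v | u ∈ C} := Nat.mul_le_mul_left _ (hC v)
    obtain ⟨F, hF, hsum⟩ := exists_sum_eq_of_le {u ∈ G.neighborFinset v | u ∈ C} M
      (τ v - K * N₀ v) (by omega)
    refine ⟨F, hF, fun _ => ?_⟩
    have h6 : K * N₀ v + ∑ u ∈ G.neighborFinset v with u ∈ C, F u = τ v := by omega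
    exact_mod_cast h6
  choose F hFM hFτ using hadj
  -- residues of the vertices in `C`
  let b₀ : V → ℤ := fun v => K * N₀ v + ∑ u ∈ G.neighborFinset v with u ∉ C, (F u v : ℤ)
  obtain ⟨ρ, hρp, hρ⟩ := exists_spread_residues G C (fun v _ => by
    obtain ⟨u, hu⟩ := Finset.card_pos.1 (hTpos.trans_le (hC v))
    rw [Finset.mem_filter, SimpleGraph.mem_neighborFinset] at hu
    exact ⟨u, hu.2, hu.1⟩) hp b₀ lev hcardC
  let b : V → ℤ := fun v => b₀ v + ∑ w ∈ G.neighborFinset v with w ∈ C, (ρ s(v, w) : ℤ)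
  have hblow : ∀ v ∈ C, (lev v * L : ℤ) - L ≤ b v := by
    intro v _
    have h1 := (abs_le.1 (hbase v)).1
    have h2 : 0 ≤ ∑ u ∈ G.neighborFinset v with u ∉ C, (F u v : ℤ) := by positivity
    have h3 : 0 ≤ ∑ w ∈ G.neighborFinset v with w ∈ C, (ρ s(v, w) : ℤ) := by positivity
    simp only [b, b₀, N₀]
    linarith
  have hbhigh : ∀ v ∈ C, b v ≤ lev v * L + L + (M * d + p * T' : ℕ) := by
    intro v _
    have h1 := (abs_le.1 (hbase v)).2
    have h2 : ∑ u ∈ G.neighborFinset v with u ∉ C, F u v ≤ M * d := by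
      refine (Finset.sum_le_card_nsmul _ _ M fun u _ => hFM u v).trans ?_
      rw [smul_eq_mul, mul_comm]
      gcongr
      refine (Finset.card_filter_le _ _).trans_eq ?_
      rw [G.card_neighborFinset_eq_degree, hreg v]
    have h3 : ∑ w ∈ G.neighborFinset v with w ∈ C, ρ s(v, w) ≤ p * T' := by
      refine (Finset.sum_le_card_nsmul _ _ p fun u _ => (hρp _).le).trans ?_
      rw [smul_eq_mul, mul_comm]
      gcongr
      exact hC' v
    zify at h2 h3
    simp only [b, b₀, N₀]
    push_cast
    linarith
  obtain ⟨χ, hχ1, hχD, hχz, hχinj⟩ := exists_toggles G C D hp (by omega : 0 < m) b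
    (fun v _ => hD v) (fun v _ => hD' v) fun v hv => by
      have := card_near_lt C lev b (X := 2 * p * T') hLpos hblow hbhigh hW hρ hconf hv
      exact_mod_cast this
  -- the weighting
  let wt : V → V → ℤ := fun u v => (1 + p) + (if Q ≤ lev u + lev v then (K : ℤ) else 0) +
    (if u ∈ C then
      (if v ∈ C then (ρ s(u, v) : ℤ) else F v u + if v ∈ D then p * χ v u else 0)
    else (if v ∈ C then F u v + (if u ∈ D then p * χ u v else 0) else 0))
  have hsymm : ∀ u v, wt u v = wt v u := by
    intro u v
    simp only [wt, add_comm (lev u), Sym2.eq_swap (a := u)]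
    by_cases hu : u ∈ C <;> by_cases hv : v ∈ C <;> simp [hu, hv]
  have hbound : ∀ u v, 1 ≤ wt u v ∧ wt u v ≤ (1 + 2 * p + K + M : ℕ) := by
    intro u v
    have hpχ : ∀ u v, -(p : ℤ) ≤ p * χ u v ∧ p * χ u v ≤ p := by
      intro u v
      have := abs_le.1 (hχ1 u v)
      constructor <;> nlinarith
    have h1 := hpχ u v
    have h2 := hpχ v u
    have h3 := hFM u v
    have h4 := hFM v u
    have h5 := hρp s(u, v)
    simp only [wt]
    push_cast
    split_ifs <;> constructor <;> linarith
  let ω : Sym2 V → ℕ := Sym2.lift ⟨fun u v => (wt u v).toNat, fun u v => congrArg Int.toNat (hsymm u v)⟩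
  have hω : ∀ u v, (ω s(u, v) : ℤ) = wt u v := by
    intro u v
    simp only [ω, Sym2.lift_mk]
    exact Int.toNat_of_nonneg (by linarith [(hbound u v).1])
  have hdeg : ∀ v, (weightedDeg G ω v : ℤ) = ∑ u ∈ G.neighborFinset v, wt v u := by
    intro v
    simp [weightedDeg, hω]
  have hbaseSum : ∀ v, ∑ u ∈ G.neighborFinset v,
      ((1 + p : ℤ) + if Q ≤ lev v + lev u then (K : ℤ) else 0) = d * (1 + p) + K * N₀ v := by
    intro v
    rw [Finset.sum_add_distrib, Finset.sum_const, G.card_neighborFinset_eq_degree, hreg v,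
      nsmul_eq_mul, ← Finset.sum_filter, Finset.sum_const, nsmul_eq_mul, mul_comm (K : ℤ)]
  let val : V → ℤ := fun v => (weightedDeg G ω v : ℤ) - d * (1 + p)
  have hvalC : ∀ v ∈ C, val v = b v + p * ∑ u ∈ G.neighborFinset v with u ∈ D, χ u v := by
    intro v hv
    have hsplit : ∑ u ∈ G.neighborFinset v, (if u ∈ C then (ρ s(v, u) : ℤ) else
        F u v + if u ∈ D then p * χ u v else 0) =
        ∑ u ∈ G.neighborFinset v with u ∈ C, (ρ s(v, u) : ℤ) +
          ∑ u ∈ G.neighborFinset v with u ∉ C, (F u v : ℤ) +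
          p * ∑ u ∈ G.neighborFinset v with u ∈ D, χ u v := by
      rw [Finset.mul_sum, Finset.sum_filter, Finset.sum_filter, Finset.sum_filter,
        ← Finset.sum_add_distrib, ← Finset.sum_add_distrib]
      refine Finset.sum_congr rfl fun u _ => ?_
      by_cases huC : u ∈ C
      · simp [huC, Finset.disjoint_left.1 hCD huC]
      · simp [huC]
    simp only [val, hdeg, wt, if_pos hv]
    rw [Finset.sum_add_distrib, hbaseSum, hsplit]
    simp only [b, b₀]
    ring
  have hvalN : ∀ v ∉ C, val v = τ v +
      if v ∈ D then p * ∑ u ∈ G.neighborFinset v with u ∈ C, χ v u else 0 := by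
    intro v hv
    simp only [val, hdeg, wt, if_neg hv]
    rw [Finset.sum_add_distrib, hbaseSum, ← hFτ v hv, ← Finset.sum_filter, Finset.sum_add_distrib]
    split_ifs with hvD
    · rw [Finset.mul_sum]; ring
    · rw [Finset.sum_const_zero]; ring
  have hzA : ∀ v, v ∉ C → v ∉ D → val v = τA v ∧ (3 * p : ℤ) ≤ val v % (m * p : ℕ) := by
    intro v hv hvD
    have h1 : val v = τA v := by simp [hvalN v hv, τ, hvD]
    have h2 := (hτA v (by simp [hv, hvD])).2.2.1
    rw [h1]
    exact ⟨rfl, by exact_mod_cast h2⟩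
  have hzC : ∀ v ∈ C, val v % (m * p : ℕ) < p := fun v hv => by
    rw [hvalC v hv]; exact hχz v hv
  have hzD : ∀ v ∈ D,
      (val v = τD v ∧ (p : ℤ) ≤ val v % (m * p : ℕ) ∧ val v % (m * p : ℕ) < 2 * p) ∨
      (val v = τD v + p ∧ (2 * p : ℤ) ≤ val v % (m * p : ℕ) ∧
        val v % (m * p : ℕ) < 3 * p) := by
    intro v hv
    have hvC : v ∉ C := Finset.disjoint_right.1 hCD hv
    obtain ⟨-, -, h1, h2⟩ := hτD v hv
    have h4 : 4 * p ≤ m * p := Nat.mul_le_mul_right p hm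
    rcases hχD v hv with h | h
    · left
      have h3 : val v = τD v := by simp [hvalN v hvC, τ, hv, h]
      rw [h3]
      refine ⟨rfl, by exact_mod_cast h1, ?_⟩
      have : τD v % (m * p) < 2 * p := by omega
      exact_mod_cast this
    · right
      have h3 : val v = (τD v + p : ℕ) := by simp [hvalN v hvC, τ, hv, h]
      have h5 : (τD v + p) % (m * p) = τD v % (m * p) + p := by
        rw [Nat.add_mod, Nat.mod_eq_of_lt (show p < m * p by omega), Nat.mod_eq_of_lt (by omega)]
      rw [h3]
      have h6 : 2 * p ≤ (τD v + p) % (m * p) := by omega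
      have h7 : (τD v + p) % (m * p) < 3 * p := by omega
      exact ⟨by push_cast; rfl, by exact_mod_cast h6, by exact_mod_cast h7⟩
  have hvalinj : ∀ u v, val u = val v → u = v := by
    intro u v huv
    have hDC : ∀ w ∈ D, w ∉ C := fun w hw => Finset.disjoint_right.1 hCD hw
    have hpZ : (0 : ℤ) < p := by exact_mod_cast hp
    by_cases huC : u ∈ C
    · have h1 := hzC u huC
      by_cases hvC : v ∈ C
      · refine hχinj huC hvC ?_
        dsimp only
        rw [← hvalC u huC, ← hvalC v hvC, huv]
      · rw [huv] at h1
        by_cases hvD : v ∈ D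
        · rcases hzD v hvD with h | h <;> omega
        · have := (hzA v hvC hvD).2
          omega
    by_cases huD : u ∈ D
    · by_cases hvC : v ∈ C
      · have h1 := hzC v hvC
        rw [← huv] at h1
        rcases hzD u huD with h | h <;> omega
      by_cases hvD : v ∈ D
      · refine hτDinj huD hvD ?_
        have h1 := hzD u huD
        have h2 := hzD v hvD
        rw [huv] at h1
        omega
      · have h1 := hzD u huD
        have h2 := (hzA v hvC hvD).2
        rw [huv] at h1
        omega
    · have h1 := hzA u huC huD
      by_cases hvC : v ∈ C
      · have h2 := hzC v hvC
        rw [← huv] at h2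
        omega
      by_cases hvD : v ∈ D
      · have h2 := hzD v hvD
        rw [← huv] at h2
        omega
      · have h2 := hzA v hvC hvD
        exact hτAinj (by simp [huC, huD]) (by simp [hvC, hvD]) (by omega)
  refine ⟨ω, fun e => ?_, fun u v huv heq => huv (hvalinj u v ?_)⟩
  · induction e with
    | _ u v =>
      have h1 := hω u v
      have h2 := hbound u v
      omega
  · simp only [val, heq]

set_option maxHeartbeats 1000000 in
/-- The choice of the parameters of the construction. -/
lemma exists_parameters {η κ : ℝ} (hη : 0 < η) (hη1 : η ≤ 1 / 4) (hκη : κ ≤ η / 2)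
    {m R Q n d : ℕ} (hm4 : 4 ≤ m) (hm : 12 ≤ η * m) (hR : R = 4000 * m)
    (hQ : 16 * (R : ℝ) ^ 2 ≤ η * Q) (hκQ : 2 * Q * κ ≤ 1) (hd : 2 * R ^ 3 ≤ d)
    (hn : 4 * Q * d ≤ n) :
    ∃ h p K M : ℕ, 0 < h ∧ 0 < p ∧
      (1 + κ) * n ≤ Q * (h * ((m - 3 : ℕ) * p) : ℕ) ∧
      2 * n ≤ Q * R * (h * p) ∧
      3 * (h * (m * p)) ≤ M * (d / (2 * R)) ∧
      2 * (h * (m * p)) + (M * d + p * (2 * d / R)) + 2 * p * (2 * d / R) ≤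
        27 * R * (h * (m * p)) ∧
      (2 * (27 * R) + 1) * (4 * (2 * n / (Q * R)) + 2 * p) < p * (d / (2 * R) / m) ∧
      h * (m * p) * Q ≤ K * d ∧ K * d ≤ h * (m * p) * Q + d ∧
      κ * Q * (h * (m * p) : ℕ) + 2 * d ≤ (h * (m * p) : ℕ) ∧
      ((1 + 2 * p + K + M : ℕ) : ℝ) ≤ 3 + 2 * Q + (1 + η) ^ 2 * (n / d) := by
  have hmpos : 0 < m := by omega
  have hRpos : 0 < R := by omega
  have hRm : 4 * m ≤ R := by omega
  have hmR : (m : ℝ) * 4000 = R := by rw [hR]; push_cast; ring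
  have hm0 : (0 : ℝ) < m := by exact_mod_cast hmpos
  have hm4' : (4 : ℝ) ≤ m := by exact_mod_cast hm4
  have hR0 : (0 : ℝ) < R := by exact_mod_cast hRpos
  have hR1 : (16000 : ℝ) ≤ R := by linarith
  have hQ0 : (0 : ℝ) < Q := by
    by_contra h0
    have : (Q : ℝ) ≤ 0 := not_lt.1 h0
    nlinarith [sq_nonneg (R : ℝ), pow_pos hR0 2]
  have hQ1 : (1 : ℝ) ≤ Q := by
    have : 0 < Q := by exact_mod_cast hQ0
    exact_mod_cast this
  have hdR : 2 * (R : ℝ) ^ 3 ≤ d := by exact_mod_cast hd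
  have hd0 : (0 : ℝ) < d := lt_of_lt_of_le (by positivity) hdR
  have hnR : 4 * (Q : ℝ) * d ≤ n := by exact_mod_cast hn
  have hn0 : (0 : ℝ) < n := lt_of_lt_of_le (by positivity) hnR
  -- the number of blocks
  set h : ℕ := d / (m * R ^ 2) with hh
  have hmR2 : (m : ℝ) * R ^ 2 * 2 ≤ d := by
    have : (m : ℝ) * R ^ 2 ≤ R * R ^ 2 := by gcongr; linarith
    linarith only [this, hdR]
  have hhle : (h : ℝ) * (m * R ^ 2) ≤ d := by
    have := Nat.div_mul_le_self d (m * R ^ 2)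
    exact_mod_cast this
  have hhge : (d : ℝ) ≤ 2 * (h * (m * R ^ 2)) := by
    have h1 : d < m * R ^ 2 * (h + 1) := Nat.lt_mul_div_succ d (by positivity)
    have h2 : (d : ℝ) < m * R ^ 2 * (h + 1) := by exact_mod_cast h1
    linarith
  have hh0 : (0 : ℝ) < h := by
    by_contra h0
    have : (h : ℝ) ≤ 0 := not_lt.1 h0
    have : 2 * ((h : ℝ) * (m * R ^ 2)) ≤ 0 := by
      have := mul_nonneg (neg_nonneg.2 this) (by positivity : (0 : ℝ) ≤ m * R ^ 2)
      linarith
    linarith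
  set p : ℕ := ⌈(1 + η) * n / (Q * m * h)⌉₊ with hp
  have hpge : (1 + η) * n ≤ Q * (h * (m * p)) := by
    have := Nat.le_ceil ((1 + η) * n / (Q * m * h))
    rw [div_le_iff₀ (by positivity)] at this
    linarith
  have hple : Q * (h * (m * p)) ≤ (1 + η) * n + Q * (h * m) := by
    have := (Nat.ceil_lt_add_one (show 0 ≤ (1 + η) * n / (Q * m * h) by positivity)).le
    rw [← hp, ← sub_le_iff_le_add, le_div_iff₀ (by positivity)] at this
    linarith
  have hp0 : (0 : ℝ) < p := by
    have : 0 < p := Nat.ceil_pos.2 (by positivity)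
    exact_mod_cast this
  set L : ℝ := h * (m * p) with hL
  have hL0 : 0 < L := by positivity
  have hQL : n ≤ Q * L := by
    have : 0 ≤ η * n := by positivity
    linarith
  have hdL : 4 * d ≤ L := by
    have : Q * (4 * d) ≤ Q * L := by linarith
    exact le_of_mul_le_mul_left this hQ0
  have hpdle : (p : ℝ) * d ≤ 2 * R ^ 2 * L := by
    calc (p : ℝ) * d ≤ p * (2 * (h * (m * R ^ 2))) := by gcongr
      _ = 2 * (R : ℝ) ^ 2 * L := by rw [hL]; ring
  have hpdge : (R : ℝ) ^ 2 * L ≤ p * d := by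
    calc (R : ℝ) ^ 2 * L = (p : ℝ) * (h * (m * R ^ 2)) := by rw [hL]; ring
      _ ≤ (p : ℝ) * d := by gcongr
  set K : ℕ := ⌈L * Q / d⌉₊ with hK
  have hKge : L * Q ≤ K * d := by
    have := Nat.le_ceil (L * Q / d)
    rwa [div_le_iff₀ hd0] at this
  have hKle : K * d ≤ L * Q + d := by
    have := (Nat.ceil_lt_add_one (show 0 ≤ L * Q / d by positivity)).le
    rw [← hK, ← sub_le_iff_le_add, le_div_iff₀ hd0] at this
    linarith
  set M : ℕ := ⌈12 * R * L / d⌉₊ with hM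
  have hMge : 12 * R * L ≤ M * d := by
    have := Nat.le_ceil (12 * R * L / d)
    rwa [div_le_iff₀ hd0] at this
  have hMle : M * d ≤ 12 * R * L + d := by
    have := (Nat.ceil_lt_add_one (show 0 ≤ 12 * R * L / d by positivity)).le
    rw [← hM, ← sub_le_iff_le_add, le_div_iff₀ hd0] at this
    linarith
  have hR3 : 2 * (R : ℝ) ≤ R ^ 3 := by
    have : 2 ≤ (R : ℝ) ^ 2 := by nlinarith only [hR1]
    nlinarith only [this, hR0]
  set T : ℕ := d / (2 * R) with hT
  have hTge : (d : ℝ) ≤ 4 * R * T := by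
    have h1 : d < 2 * R * (T + 1) := Nat.lt_mul_div_succ d (by positivity)
    have h2 : (d : ℝ) < 2 * R * (T + 1) := by exact_mod_cast h1
    linarith only [h2, hdR, hR3]
  set T' : ℕ := 2 * d / R with hT'
  have hT'le : (T' : ℝ) * R ≤ 2 * d := by
    have := Nat.div_mul_le_self (2 * d) R
    exact_mod_cast this
  have hpT' : (p : ℝ) * T' ≤ 4 * R * L := by
    have : R * ((p : ℝ) * T') ≤ R * (4 * R * L) := by
      calc R * ((p : ℝ) * T') = p * (T' * R) := by ring
        _ ≤ p * (2 * d) := by gcongr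
        _ ≤ R * (4 * R * L) := by linarith
    exact le_of_mul_le_mul_left this hR0
  set k : ℕ := T / m with hk
  have hkge : (d : ℝ) ≤ 8 * R * m * k := by
    have h1 : T < m * (k + 1) := Nat.lt_mul_div_succ T hmpos
    have h2 : (T : ℝ) < m * (k + 1) := by exact_mod_cast h1
    have h3 : 4 * (R : ℝ) * T ≤ 4 * R * (m * (k + 1)) := by gcongr
    have h4 : 8 * (R : ℝ) * m ≤ d := by
      have h5 : (m : ℝ) * 8 ≤ R * R := by nlinarith only [hmR, hR1]
      have h6 : R * ((m : ℝ) * 8) ≤ R * (R * R) := by gcongr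
      linarith only [h6, hdR, pow_pos hR0 3]
    linarith only [h3, h4, hTge]
  set S : ℕ := 2 * n / (Q * R) with hS
  have hSle : (S : ℝ) * R ≤ 2 * L := by
    have h1 := Nat.div_mul_le_self (2 * n) (Q * R)
    have h2 : (S : ℝ) * (Q * R) ≤ 2 * n := by exact_mod_cast h1
    have h3 : Q * (S * R) ≤ Q * (2 * L) := by linarith
    exact le_of_mul_le_mul_left h3 hQ0
  have hSp : (S : ℝ) * R ^ 3 ≤ 2 * (p * d) := by
    calc (S : ℝ) * R ^ 3 = R ^ 2 * (S * R) := by ring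
      _ ≤ R ^ 2 * (2 * L) := by gcongr
      _ ≤ 2 * (p * d) := by linarith
  refine ⟨h, p, K, M, by exact_mod_cast hh0, by exact_mod_cast hp0, ?_, ?_, ?_, ?_, ?_, ?_, ?_,
    ?_, ?_⟩
  · have hsub : ((m - 3 : ℕ) : ℝ) = m - 3 := by
      rw [Nat.cast_sub (by omega)]; norm_num
    push_cast
    rw [hsub]
    have h1 : Q * ((h : ℝ) * ((m - 3) * p)) * m = Q * L * (m - 3) := by rw [hL]; ring
    have h2 : (1 + κ) * n * m ≤ (1 + η) * n * (m - 3) := by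
      have : (1 + κ) * m ≤ (1 + η) * (m - 3) := by
        have : κ * m ≤ η / 2 * m := by gcongr
        linarith only [this, hm, hη1]
      calc (1 + κ) * n * m = (1 + κ) * m * n := by ring
        _ ≤ (1 + η) * (m - 3) * n := by gcongr
        _ = _ := by ring
    have h3 : (1 + η) * n * (m - 3) ≤ Q * L * (m - 3) := by
      gcongr
      linarith
    exact le_of_mul_le_mul_right (by linarith) hm0
  · have h1 : 2 * (n : ℝ) ≤ Q * R * (h * p) := by
      have h2 : Q * R * ((h : ℝ) * p) = 4000 * (Q * L) := by rw [hL, ← hmR]; ring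
      rw [h2]
      linarith
    exact_mod_cast h1
  · have h1 : 3 * L ≤ M * T := by
      have h2 : 4 * R * (3 * L) ≤ 4 * R * (M * T) := by
        have : (M : ℝ) * d ≤ M * (4 * R * T) := by gcongr
        linarith only [this, hMge]
      exact le_of_mul_le_mul_left h2 (by positivity)
    rw [hL] at h1
    exact_mod_cast h1
  · have h1 : 2 * L + (M * d + p * T') + 2 * p * T' ≤ 27 * R * L := by
      have : 3 * L ≤ R * L := by gcongr; linarith only [hR1]
      linarith only [this, hMle, hpT', hdL, hL0]
    rw [hL] at h1
    exact_mod_cast h1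
  · have h1 : (2 * (27 * R) + 1) * (4 * (S : ℝ) + 2 * p) < p * k := by
      have h2 : (2 * (27 * (R : ℝ)) + 1) ≤ 55 * R := by linarith only [hR1]
      have h3 : (4 * (S : ℝ) + 2 * p) * R ^ 3 ≤ 9 * (p * d) := by
        have : p * (2 * (R : ℝ) ^ 3) ≤ p * d := by gcongr
        linarith only [this, hSp]
      have h4 : 8 * R * m * ((2 * (27 * R) + 1) * (4 * (S : ℝ) + 2 * p)) < 8 * R * m * (p * k) := by
        have h5 : p * (d : ℝ) ≤ 8 * R * m * (p * k) := by
          calc p * (d : ℝ) ≤ p * (8 * R * m * k) := by gcongr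
            _ = _ := by ring
        refine lt_of_lt_of_le ?_ h5
        have h6 : R * (8 * R * m * ((2 * (27 * R) + 1) * (4 * (S : ℝ) + 2 * p))) ≤
            8 * 55 * m * (9 * (p * d)) := by
          calc R * (8 * R * m * ((2 * (27 * R) + 1) * (4 * (S : ℝ) + 2 * p)))
              ≤ R * (8 * R * m * (55 * R * (4 * (S : ℝ) + 2 * p))) := by gcongr
            _ = 8 * 55 * m * ((4 * (S : ℝ) + 2 * p) * R ^ 3) := by ring
            _ ≤ _ := by gcongr
        have h7 : 8 * 55 * (m : ℝ) * (9 * (p * d)) < R * (p * d) := by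
          have : (0 : ℝ) < m * (p * d) := by positivity
          rw [← hmR]
          linarith only [this]
        exact lt_of_mul_lt_mul_left (h6.trans_lt h7) hR0.le
      exact lt_of_mul_lt_mul_left h4 (by positivity)
    exact_mod_cast h1
  · rw [hL] at hKge
    exact_mod_cast hKge
  · rw [hL] at hKle
    exact_mod_cast hKle
  · push_cast
    rw [← hL]
    have : 2 * Q * κ * L ≤ 1 * L := by gcongr
    linarith only [this, hdL]
  · have h1 : ((1 + 2 * p + K + M : ℕ) : ℝ) * d ≤
        (3 + 2 * Q + (1 + η) ^ 2 * (n / d)) * d := by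
      have e1 : (3 + 2 * Q + (1 + η) ^ 2 * (n / d)) * d =
          3 * d + 2 * Q * d + (1 + η) ^ 2 * n := by field_simp
      rw [e1]
      push_cast
      have h2 : 12 * R * L ≤ 12 * R ^ 2 * L := by
        have : (R : ℝ) ≤ R ^ 2 := by nlinarith only [hR1]
        gcongr
      have h3 : 16 * R ^ 2 * L ≤ η * Q * L := by gcongr
      have h4 : Q * L ≤ (1 + η) * n + Q * d := by
        have : (h : ℝ) * m ≤ d := by
          refine le_trans ?_ hhle
          have : (1 : ℝ) ≤ R ^ 2 := by nlinarith only [hR1]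
          have := mul_le_mul_of_nonneg_left this (by positivity : (0 : ℝ) ≤ h * m)
          linarith only [this]
        have : Q * ((h : ℝ) * m) ≤ Q * d := by gcongr
        linarith only [this, hple]
      have h5 : (1 + η) * (Q * L) ≤ (1 + η) * ((1 + η) * n + Q * d) := by gcongr
      have h6 : η * (Q * d) ≤ 1 * (Q * d) := by gcongr; linarith only [hη1]
      linarith only [h2, h3, h5, h6, hpdle, hKle, hMle]
    exact le_of_mul_le_mul_right h1 hd0

/-- If all fibres of `c` on `s` have size within `δ` of `x`, then the preimage of `J` has size
within `#J * δ` of `#J * x`. -/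
lemma abs_card_filter_mem_sub_le {α ι : Type*} [DecidableEq ι] (s : Finset α) (c : α → ι)
    {x δ : ℝ} (h : ∀ j, |(#{u ∈ s | c u = j} : ℝ) - x| ≤ δ) (J : Finset ι) :
    |(#{u ∈ s | c u ∈ J} : ℝ) - #J * x| ≤ #J * δ := by
  have h1 : #{u ∈ s | c u ∈ J} = ∑ j ∈ J, #{u ∈ s | c u = j} := by
    rw [card_eq_sum_card_fiberwise (s := {u ∈ s | c u ∈ J}) (f := c) (t := J)
      fun u hu => (mem_filter.1 hu).2]
    refine sum_congr rfl fun j hj => ?_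
    rw [filter_filter]
    congr 1
    ext u
    simp only [mem_filter]
    constructor
    · rintro ⟨h1, -, h2⟩
      exact ⟨h1, h2⟩
    · rintro ⟨h1, rfl⟩
      exact ⟨h1, hj, rfl⟩
  have h2 : (#{u ∈ s | c u ∈ J} : ℝ) - #J * x = ∑ j ∈ J, ((#{u ∈ s | c u = j} : ℝ) - x) := by
    rw [h1, sum_sub_distrib, sum_const, nsmul_eq_mul]
    push_cast
    rfl
  rw [h2, ← nsmul_eq_mul, ← sum_const]
  exact (abs_sum_le_sum_abs _ _).trans (sum_le_sum fun j _ => h j)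

/-- In a `d`-regular graph, a set of which every vertex sees at most `B` elements has size at most
`n * B / d`. -/
lemma mul_card_le_of_card_neighborFinset_le {V : Type*} [Fintype V] (G : SimpleGraph V)
    [DecidableRel G.Adj] {d : ℕ} (hreg : G.IsRegularOfDegree d) (P : V → Prop) [DecidablePred P]
    {B : ℝ} (hB : ∀ v, (#{u ∈ G.neighborFinset v | P u} : ℝ) ≤ B) :
    (d : ℝ) * #{v | P v} ≤ Fintype.card V * B := by
  have h1 : ∑ v : V, #{u ∈ G.neighborFinset v | P u} = ∑ u ∈ ({u | P u} : Finset V), d := by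
    have := sum_card_bipartiteAbove_eq_sum_card_bipartiteBelow (s := (univ : Finset V))
      (t := ({u | P u} : Finset V)) G.Adj
    convert this using 2 with v _ u _
    · congr 1
      ext u
      simp [bipartiteAbove, and_comm]
    · rw [← hreg.degree_eq u, ← G.card_neighborFinset_eq_degree]
      congr 1
      ext w
      simp [bipartiteBelow, G.adj_comm]
  rw [sum_const, smul_eq_mul] at h1
  have h2 : ((#{u | P u} * d : ℕ) : ℝ) ≤ ∑ v : V, B := by
    rw [← h1]
    push_cast
    exact sum_le_sum fun v _ => hB v
  rw [sum_const, card_univ, nsmul_eq_mul] at h2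
  push_cast at h2
  linarith

lemma abs_mul_sub_mul_le {K N l L Q d κ : ℝ} (hQ : 0 < Q) (hκ : 0 ≤ κ) (hκ1 : κ ≤ 1)
    (hK : 0 ≤ K) (hL : 0 ≤ L) (hd : 0 ≤ d) (hl : 0 ≤ l) (hlQ : l ≤ Q)
    (hN : |N * Q - l * d| ≤ κ * (l * d)) (hKge : L * Q ≤ K * d) (hKle : K * d ≤ L * Q + d)
    (hκL : κ * Q * L + 2 * d ≤ L) : |K * N - l * L| ≤ L := by
  rw [abs_le] at hN ⊢
  have e1 : K * (N * Q) ≤ K * ((1 + κ) * (l * d)) :=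
    mul_le_mul_of_nonneg_left (by linarith only [hN.2]) hK
  have e2 : K * ((1 - κ) * (l * d)) ≤ K * (N * Q) :=
    mul_le_mul_of_nonneg_left (by linarith only [hN.1]) hK
  have e3 : (1 + κ) * l * (K * d) ≤ (1 + κ) * l * (L * Q + d) := by gcongr
  have e4 : (1 - κ) * l * (L * Q) ≤ (1 - κ) * l * (K * d) := by
    have : 0 ≤ 1 - κ := by linarith only [hκ1]
    gcongr
  have e5 : κ * (L * Q) * l ≤ κ * (L * Q) * Q := by gcongr
  have e6 : (1 + κ) * l * d ≤ 2 * Q * d := by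
    gcongr
    linarith only [hκ1]
  have e7 : Q * (κ * Q * L + 2 * d) ≤ Q * L := by gcongr
  have e8 : 0 ≤ Q * d := by positivity
  constructor
  · refine le_of_mul_le_mul_left ?_ hQ
    linarith only [e2, e4, e5, e7, e8]
  · refine le_of_mul_le_mul_left ?_ hQ
    linarith only [e1, e3, e5, e6, e7]

lemma card_filter_le_add_val {Q l : ℕ} (hl : l ≤ Q) : #{i : Fin Q | Q ≤ l + i} = l := by
  rw [← card_image_of_injective _ Fin.val_injective]
  have : ({i : Fin Q | Q ≤ l + i} : Finset (Fin Q)).image Fin.val = Ico (Q - l) Q := by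
    ext j
    simp only [mem_image, mem_filter, mem_univ, true_and, mem_Ico]
    constructor
    · rintro ⟨i, hi, rfl⟩
      exact ⟨by omega, i.2⟩
    · rintro ⟨h1, h2⟩
      exact ⟨⟨j, h2⟩, by simp only; omega, rfl⟩
  rw [this, Nat.card_Ico]
  omega

/-- The upper bound: a weighting of a regular graph with pairwise distinct weighted degrees and
weights not much larger than `n / d`. -/
lemma exists_irregular_weighting_le {V : Type} [Fintype V] (G : SimpleGraph V)
    [DecidableRel G.Adj] {η κ : ℝ} (hη : 0 < η) (hη1 : η ≤ 1 / 4) (hκ : 0 < κ) (hκη : κ ≤ η / 2)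
    {m R Q n d : ℕ} (hreg : G.IsRegularOfDegree d) (hV : n = Fintype.card V)
    (hm4 : 4 ≤ m) (hm : 12 ≤ η * m) (hR : R = 4000 * m)
    (hQ : 16 * (R : ℝ) ^ 2 ≤ η * Q) (hκQ : 2 * Q * κ ≤ 1) (hd : 2 * R ^ 3 ≤ d)
    (hn : 4 * Q * d ≤ n)
    (hexp : 2 * n * (Q * R) * Real.exp (-((κ / (Q * R)) ^ 2 * d / 4)) < 1) :
    ∃ k : ℕ, (k : ℝ) ≤ 3 + 2 * Q + (1 + η) ^ 2 * (n / d) ∧ ∃ ω : Sym2 V → ℕ,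
      (∀ e, 1 ≤ ω e ∧ ω e ≤ k) ∧ ∀ u v, u ≠ v → weightedDeg G ω u ≠ weightedDeg G ω v := by
  classical
  obtain ⟨h, p, K, M, hh, hp, hA, hDp, hM, hW, hconf, hKge, hKle, hκL, hk⟩ :=
    exists_parameters hη hη1 hκη hm4 hm hR hQ hκQ hd hn
  have hRpos : 1 < R := by omega
  have hR0 : (0 : ℝ) < R := by exact_mod_cast (by omega : 0 < R)
  have hQ0 : (0 : ℝ) < Q := by
    by_contra h0
    have h1 : η * (Q : ℝ) ≤ 0 := mul_nonpos_of_nonneg_of_nonpos hη.le (not_lt.1 h0)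
    have h2 := pow_pos hR0 2
    linarith
  have hQpos : 0 < Q := by exact_mod_cast hQ0
  have hd0 : (0 : ℝ) < d := by
    have : 0 < d := lt_of_lt_of_le (by positivity) hd
    exact_mod_cast this
  have hκ1 : κ ≤ 1 / 2 := by linarith
  have hQR1 : (1 : ℝ) ≤ Q * R := by
    have : 0 < Q * R := by positivity
    exact_mod_cast this
  let zero : Fin R := ⟨0, by omega⟩
  let one : Fin R := ⟨1, by omega⟩
  have h01 : zero ≠ one := by simp [zero, one]
  have : Nonempty (Fin Q × Fin R) := ⟨(⟨0, hQpos⟩, zero)⟩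
  obtain ⟨c, hc⟩ := exists_balanced_coloring (ι := Fin Q × Fin R) G hreg
    (γ := κ / (Q * R)) (by positivity)
    (by rw [div_le_one (by positivity)]; linarith)
    (by rw [← hV]; simpa using hexp)
  have hcard : ((Fintype.card (Fin Q × Fin R) : ℕ) : ℝ) = Q * R := by simp
  rw [hcard] at hc
  have hN : ∀ (v : V) (J : Finset (Fin Q × Fin R)),
      |(#{u ∈ G.neighborFinset v | c u ∈ J} : ℝ) * (Q * R) - #J * d| ≤ κ * (#J * d) := by
    intro v J
    have h1 := abs_card_filter_mem_sub_le (G.neighborFinset v) c (hc v) J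
    have h2 : (#{u ∈ G.neighborFinset v | c u ∈ J} : ℝ) * (Q * R) - #J * d =
        (#{u ∈ G.neighborFinset v | c u ∈ J} - #J * (d / (Q * R) : ℝ)) * (Q * R) := by
      field_simp
    rw [h2, abs_mul, abs_of_pos (show (0 : ℝ) < Q * R by positivity)]
    calc _ ≤ #J * (κ / (Q * R) * d) * (Q * R) := by gcongr
      _ = _ := by field_simp
  have hJ : ∀ J : Finset (Fin Q × Fin R),
      (#{v | c v ∈ J} : ℝ) * (Q * R) ≤ (1 + κ) * (#J * n) := by
    intro J
    have h1 := mul_card_le_of_card_neighborFinset_le G hreg (fun v => c v ∈ J)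
      (B := (1 + κ) * (#J * d) / (Q * R)) (by
        intro v
        rw [le_div_iff₀ (by positivity)]
        linarith [(abs_le.1 (hN v J)).2])
    rw [← hV, mul_div_assoc', le_div_iff₀ (by positivity)] at h1
    refine le_of_mul_le_mul_left ?_ hd0
    linarith
  have hslot : ∀ (s : Fin R) (v : V),
      d / (2 * R) ≤ #{u ∈ G.neighborFinset v | (c u).2 = s} ∧
        #{u ∈ G.neighborFinset v | (c u).2 = s} ≤ 2 * d / R := by
    intro s v
    have h1 := hN v (univ ×ˢ {s})
    simp only [mem_product, mem_univ, true_and, mem_singleton, card_product, card_univ,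
      Fintype.card_fin, card_singleton, mul_one] at h1
    set x := #{u ∈ G.neighborFinset v | (c u).2 = s}
    rw [abs_le] at h1
    have h2 : κ * (Q * d) ≤ 1 / 2 * (Q * d) := by gcongr
    constructor
    · refine Nat.div_le_of_le_mul ?_
      have h3 : Q * (d : ℝ) ≤ Q * (2 * R * x) := by linarith [h1.1]
      exact_mod_cast le_of_mul_le_mul_left h3 hQ0
    · rw [Nat.le_div_iff_mul_le (by omega)]
      have h3 : Q * ((x : ℝ) * R) ≤ Q * (2 * d) := by nlinarith [h1.2]
      exact_mod_cast le_of_mul_le_mul_left h3 hQ0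
  have hlevslot : ∀ (i : ℕ) (s : Fin R),
      #{v | (c v).2 = s ∧ ((c v).1 : ℕ) = i} * (Q * R) ≤ 2 * n := by
    intro i s
    by_cases hi : i < Q
    · have h1 := hJ {(⟨i, hi⟩, s)}
      have h2 : univ.filter (fun v => c v ∈ ({(⟨i, hi⟩, s)} : Finset (Fin Q × Fin R))) =
          univ.filter (fun v => (c v).2 = s ∧ ((c v).1 : ℕ) = i) := by
        ext v
        simp [Prod.ext_iff, Fin.ext_iff, and_comm]
      rw [h2, card_singleton, Nat.cast_one, one_mul] at h1
      have h3 : (1 + κ) * (n : ℝ) ≤ 2 * n := by gcongr; linarith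
      exact_mod_cast h1.trans h3
    · rw [filter_false_of_mem]
      · simp
      · rintro v - ⟨-, rfl⟩
        exact hi (c v).1.2
  have hL0 : (0 : ℝ) ≤ (h * (m * p) : ℕ) := Nat.cast_nonneg _
  refine ⟨1 + 2 * p + K + M, hk, ?_⟩
  refine exists_irregular_weighting G hreg {v | (c v).2 = zero} {v | (c v).2 = one} ?_
    (fun v => (c v).1) (Q := Q) (K := K) (M := M) (p := p) (m := m) (h := h)
    (T := d / (2 * R)) (T' := 2 * d / R) (S := 2 * n / (Q * R)) (W := 27 * R) hp hh (by omega)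
    ?_ ?_ ?_ ?_ ?_ hM ?_ ?_ ?_ hW hconf
  · rw [disjoint_filter]
    intro v _ h1 h2
    exact h01 (h1.symm.trans h2)
  · intro v
    have h1 := hN v (({i : Fin Q | Q ≤ (c v).1 + i} : Finset (Fin Q)) ×ˢ univ)
    simp only [mem_product, mem_univ, and_true, mem_filter, true_and, card_product, card_univ,
      Fintype.card_fin, card_filter_le_add_val (c v).1.2.le] at h1
    have h2 := abs_mul_sub_mul_le (K := K) (L := (h * (m * p) : ℕ)) (Q := Q) (d := d) (κ := κ)
      (N := #{u ∈ G.neighborFinset v | Q ≤ ((c v).1 : ℕ) + (c u).1}) (l := ((c v).1 : ℕ))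
      hQ0 hκ.le (by linarith) (Nat.cast_nonneg _) hL0 hd0.le (Nat.cast_nonneg _)
      (by exact_mod_cast (c v).1.2.le) ?_ (by exact_mod_cast hKge) (by exact_mod_cast hKle) hκL
    · exact_mod_cast h2
    · have e : ∀ a l : ℝ, a * (Q * R) - l * R * d = (a * Q - l * d) * R := fun a l => by ring
      push_cast at h1
      rw [e, abs_mul, abs_of_pos hR0] at h1
      exact le_of_mul_le_mul_right (by linarith) hR0
  · intro v
    simpa using (hslot zero v).1
  · intro v
    simpa using (hslot zero v).2
  · intro v
    simpa using (hslot one v).1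
  · intro v
    simpa using (hslot one v).2
  · intro i
    by_cases hi : i < Q
    · have h1 := hJ ({⟨i, hi⟩} ×ˢ univ)
      simp only [mem_product, mem_univ, and_true, mem_singleton, card_product, card_univ,
        Fintype.card_fin, card_singleton, one_mul] at h1
      refine (card_le_card (t := {v | (c v).1 = ⟨i, hi⟩}) fun v hv => ?_).trans ?_
      · simpa [Fin.ext_iff] using (mem_filter.1 hv).2
      have h3 : (Q * R : ℝ) * #{v | (c v).1 = ⟨i, hi⟩} ≤
          Q * R * (h * ((m - 3 : ℕ) * p) : ℕ) := by
        have : R * ((1 + κ) * n) ≤ R * (Q * ((h * ((m - 3 : ℕ) * p) : ℕ) : ℝ)) := by gcongr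
        linarith
      exact_mod_cast le_of_mul_le_mul_left h3 (by positivity)
    · rw [filter_false_of_mem]
      · simp
      · rintro v - rfl
        exact hi (c v).1.2
  · intro i
    have h1 := (hlevslot i one).trans hDp
    rw [filter_filter]
    refine le_of_mul_le_mul_left ?_ (show 0 < Q * R by positivity)
    linarith
  · intro i
    have h1 := hlevslot i zero
    rw [filter_filter]
    rwa [Nat.le_div_iff_mul_le (by positivity)]

/-- Pairwise distinct weighted degrees in a `d`-regular graph on `n` vertices need a weight at
least `n / d`. -/
lemma card_le_mul_of_irregular {V : Type} [Fintype V] (G : SimpleGraph V) [DecidableRel G.Adj]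
    {d k : ℕ} (hreg : G.IsRegularOfDegree d) (hd : 0 < d) {ω : Sym2 V → ℕ}
    (hω : ∀ e ∈ G.edgeSet, 1 ≤ ω e ∧ ω e ≤ k)
    (hdist : ∀ u v : V, u ≠ v → weightedDeg G ω u ≠ weightedDeg G ω v) :
    Fintype.card V ≤ k * d := by
  have hcard : ∀ v, #(G.neighborFinset v) = d := fun v => hreg.degree_eq v
  have hmem : ∀ v ∈ (univ : Finset V), weightedDeg G ω v ∈ Icc d (k * d) := by
    intro v _
    have hb : ∀ u ∈ G.neighborFinset v, 1 ≤ ω s(v, u) ∧ ω s(v, u) ≤ k := fun u hu =>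
      hω _ (by simpa using hu)
    rw [mem_Icc]
    constructor
    · have := card_nsmul_le_sum _ _ 1 fun u hu => (hb u hu).1
      simpa [hcard, weightedDeg] using this
    · have := sum_le_card_nsmul _ _ k fun u hu => (hb u hu).2
      simpa [hcard, weightedDeg, mul_comm] using this
  have h1 := card_le_card_of_injOn _ hmem fun u _ v _ huv => by
    by_contra hne
    exact hdist u v hne huv
  rw [card_univ, Nat.card_Icc] at h1
  omega

open Filter in
/-- In the given range of degrees, `d` exceeds any multiple of `log n` and `n` exceeds any multiple
of `d`, for large `n`. -/
lemma exists_forall_mul_log_le {ε : ℝ} (hε : 0 < ε) (A : ℝ) :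
    ∃ N : ℕ, ∀ n d : ℕ, N ≤ n → Real.log n ^ (1 + ε) ≤ (d : ℝ) →
      (d : ℝ) ≤ n / Real.log n ^ ε →
      A < n ∧ 1 ≤ Real.log n ∧ A * Real.log n ≤ d ∧ A * d ≤ n := by
  have hlog : Tendsto (fun n : ℕ => Real.log n) atTop atTop :=
    Real.tendsto_log_atTop.comp tendsto_natCast_atTop_atTop
  have hpow : Tendsto (fun n : ℕ => Real.log n ^ ε) atTop atTop :=
    (tendsto_rpow_atTop hε).comp hlog
  obtain ⟨N, hN⟩ := eventually_atTop.1 (((hpow.eventually_ge_atTop A).and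
    (hlog.eventually_ge_atTop 1)).and
      ((tendsto_natCast_atTop_atTop (R := ℝ)).eventually_gt_atTop A))
  refine ⟨N, fun n d hn h1 h2 => ?_⟩
  obtain ⟨⟨hA, hl⟩, hAn⟩ := hN n hn
  have hl0 : 0 < Real.log n := by linarith
  refine ⟨hAn, hl, ?_, ?_⟩
  · rw [Real.rpow_add hl0, Real.rpow_one] at h1
    have : Real.log n * A ≤ Real.log n * Real.log n ^ ε := by gcongr
    linarith
  · rw [le_div_iff₀ (Real.rpow_pos_of_pos hl0 ε)] at h2
    have : (d : ℝ) * A ≤ d * Real.log n ^ ε := by gcongr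
    linarith

theorem irregularity_strength_asymptotics (ε₀ : ℝ) (hε₀ : 0 < ε₀) (η : ℝ) (hη : 0 < η) :
    ∃ N : ℕ, ∀ (V : Type) [Fintype V] (G : SimpleGraph V) [DecidableRel G.Adj] (n d : ℕ),
      n = Fintype.card V → G.IsRegularOfDegree d → N ≤ n →
      Real.log n ^ (1 + ε₀) ≤ (d : ℝ) →
      (d : ℝ) ≤ (n : ℝ) / Real.log n ^ ε₀ →
      (n : ℝ) / (d : ℝ) ≤ (irregularityStrength G : ℝ) ∧
      (irregularityStrength G : ℝ) ≤ (1 + η) * ((n : ℝ) / (d : ℝ)) := by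
  obtain ⟨δ, hδ0, hδ1, hδη⟩ : ∃ δ : ℝ, 0 < δ ∧ δ ≤ 1 / 4 ∧ 4 * δ ≤ η :=
    ⟨min (η / 4) (1 / 4), by positivity, min_le_right _ _,
      by linarith [min_le_left (η / 4) (1 / 4)]⟩
  obtain ⟨m, hm4, hm⟩ : ∃ m : ℕ, 4 ≤ m ∧ 12 ≤ δ * m := by
    refine ⟨max 4 ⌈12 / δ⌉₊, le_max_left _ _, ?_⟩
    have h1 : (12 / δ : ℝ) ≤ (max 4 ⌈12 / δ⌉₊ : ℕ) :=
      (Nat.le_ceil _).trans (by exact_mod_cast le_max_right _ _)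
    rw [div_le_iff₀ hδ0] at h1
    linarith
  obtain ⟨R, hR⟩ : ∃ R : ℕ, R = 4000 * m := ⟨_, rfl⟩
  have hR0 : (0 : ℝ) < R := by exact_mod_cast (by omega : 0 < R)
  obtain ⟨Q, hQ⟩ : ∃ Q : ℕ, 16 * (R : ℝ) ^ 2 ≤ δ * Q := by
    refine ⟨⌈16 * (R : ℝ) ^ 2 / δ⌉₊, ?_⟩
    have h1 := Nat.le_ceil (16 * (R : ℝ) ^ 2 / δ)
    rw [div_le_iff₀ hδ0] at h1
    linarith
  have hQ0 : (0 : ℝ) < Q := by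
    refine pos_of_mul_pos_right (lt_of_lt_of_le ?_ hQ) hδ0.le
    positivity
  have hQ1 : (1 : ℝ) ≤ Q := by
    have : 0 < Q := by exact_mod_cast hQ0
    exact_mod_cast this
  obtain ⟨κ, hκ⟩ : ∃ κ : ℝ, κ = δ / (2 * Q) := ⟨_, rfl⟩
  have hκ0 : 0 < κ := by rw [hκ]; positivity
  have hκQ : 2 * Q * κ = δ := by rw [hκ]; field_simp
  have hκδ : κ ≤ δ / 2 := by nlinarith
  obtain ⟨γ, hγ⟩ : ∃ γ : ℝ, γ = κ / (Q * R) := ⟨_, rfl⟩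
  have hγ0 : 0 < γ := by rw [hγ]; positivity
  obtain ⟨N, hN⟩ := exists_forall_mul_log_le hε₀
    (2 * R ^ 3 + 4 * Q + (3 + 2 * Q) / δ + 8 / γ ^ 2 + 2 * (Q * R))
  refine ⟨N, fun V _ G _ n d hV hreg hn hdlow hdup => ?_⟩
  obtain ⟨hAn, hl, hAd, hdn⟩ := hN n d hn hdlow hdup
  have t1 : (0 : ℝ) ≤ 2 * R ^ 3 := by positivity
  have t2 : (0 : ℝ) ≤ 4 * Q := by positivity
  have t3 : 0 ≤ (3 + 2 * Q) / δ := by positivity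
  have t4 : 0 ≤ 8 / γ ^ 2 := by positivity
  have t5 : (0 : ℝ) < 2 * (Q * R) := by positivity
  set A := 2 * R ^ 3 + 4 * Q + (3 + 2 * Q) / δ + 8 / γ ^ 2 + 2 * (Q * R) with hA
  have hA0 : 0 < A := by linarith
  have hd1 : A ≤ d := (le_mul_of_one_le_right hA0.le hl).trans hAd
  have hd0 : (0 : ℝ) < d := by linarith
  have hn0 : (0 : ℝ) < n := by linarith
  have hdnat : 0 < d := by exact_mod_cast hd0
  have hmul : ∀ x ≤ A, x * d ≤ n := fun x hx =>
    (mul_le_mul_of_nonneg_right hx hd0.le).trans hdn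
  have hexp : 2 * n * (Q * R) * Real.exp (-((κ / (Q * R)) ^ 2 * d / 4)) < 1 := by
    have h1 : 2 * Real.log n ≤ γ ^ 2 * d / 4 := by
      have h2 : 8 / γ ^ 2 * Real.log n ≤ d := by
        refine le_trans ?_ hAd
        gcongr
        linarith
      rw [div_mul_eq_mul_div, div_le_iff₀ (by positivity)] at h2
      linarith
    have h3 : Real.exp (-(γ ^ 2 * d / 4)) ≤ ((n : ℝ) ^ 2)⁻¹ := by
      calc Real.exp (-(γ ^ 2 * d / 4)) ≤ Real.exp (-(2 * Real.log n)) := by gcongr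
        _ = ((n : ℝ) ^ 2)⁻¹ := by
          rw [Real.exp_neg, two_mul, Real.exp_add, Real.exp_log hn0, sq]
    rw [← hγ]
    calc 2 * n * (Q * R) * Real.exp (-(γ ^ 2 * d / 4))
        ≤ 2 * n * (Q * R) * ((n : ℝ) ^ 2)⁻¹ := by gcongr
      _ = 2 * (Q * R) / n := by field_simp
      _ < 1 := by
        rw [div_lt_one hn0]
        linarith
  obtain ⟨k, hk, ω, hω, hdist⟩ := exists_irregular_weighting_le G hδ0 hδ1 hκ0 hκδ hreg hV hm4 hm hR
    hQ (by linarith) (by exact_mod_cast (by linarith : 2 * (R : ℝ) ^ 3 ≤ d))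
    (by exact_mod_cast hmul (4 * Q) (by linarith)) hexp
  have hmem : k ∈ {k : ℕ | ∃ ω : Sym2 V → ℕ, (∀ e ∈ G.edgeSet, 1 ≤ ω e ∧ ω e ≤ k) ∧
      ∀ u v : V, u ≠ v → weightedDeg G ω u ≠ weightedDeg G ω v} :=
    ⟨ω, fun e _ => hω e, hdist⟩
  constructor
  · obtain ⟨ω', hω', hdist'⟩ := Nat.sInf_mem ⟨k, hmem⟩
    rw [div_le_iff₀ hd0, hV]
    exact_mod_cast card_le_mul_of_irregular G hreg hdnat hω' hdist'
  · have h1 : (irregularityStrength G : ℝ) ≤ k := by exact_mod_cast Nat.sInf_le hmem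
    have h2 : 3 + 2 * Q ≤ δ * ((n : ℝ) / d) := by
      have h3 := hmul ((3 + 2 * Q) / δ) (by linarith)
      rw [div_mul_eq_mul_div, div_le_iff₀ hδ0] at h3
      rw [mul_div_assoc', le_div_iff₀ hd0]
      linarith
    have h4 : (δ + (1 + δ) ^ 2) * ((n : ℝ) / d) ≤ (1 + η) * (n / d) :=
      mul_le_mul_of_nonneg_right (by nlinarith only [hδ0, hδ1, hδη]) (by positivity)
    linarith
end

section
/- For any positive reals b and ε there exists a constant N such that for every d-regular simple graph G with vertex set V, |V| = n ≥ N, and d ≥ ln^{1+6b+12ε} n, there exist a subset U ⊆ V and a partition U = U₁ ∪ U₂ ∪ … ∪ U₇ into seven pairwise disjoint sets such that for every v ∈ V and every i ∈ {1,…,7}: (1°) | |U_i| − (1/7)·n/ln^{b+ε} n | ≤ (1/7)·n/ln^{2b+4ε} n, and (2°) | d_{U_i}(v) − (1/7)·d/ln^{b+ε} n | ≤ (1/7)·d/ln^{2b+4ε} n, where d_S(v) denotes the number of neighbours of v lying in the set S. -/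
open Finset

/-- `degIn G v S` is the number of neighbours of `v` lying in the set `S`. -/
def degIn {V : Type} [Fintype V] [DecidableEq V] (G : SimpleGraph V) [DecidableRel G.Adj]
    (v : V) (S : Finset V) : ℕ :=
  (G.neighborFinset v ∩ S).card

section RandomColouring

variable {V C ι : Type*} [Fintype V] [DecidableEq V] [Fintype C] [DecidableEq C] [Fintype ι]

/-- A subgaussian bound for the moment generating function of a centred Bernoulli variable,
realised as the indicator of `c` under the probability vector `w`. -/
lemma sum_mul_exp_indicator_sub_le (w : C → ℝ) (hw : ∀ c, 0 ≤ w c) (hsum : ∑ c, w c = 1)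
    (c : C) {θ : ℝ} (hθ : |θ| ≤ 1) :
    ∑ a, w a * Real.exp (θ * ((if a = c then 1 else 0) - w c)) ≤ Real.exp (θ ^ 2) := by
  have hc : w c ≤ 1 := hsum ▸ single_le_sum (fun a _ => hw a) (mem_univ c)
  have hterm : ∀ a, w a * Real.exp (θ * ((if a = c then 1 else 0) - w c)) ≤
      w a * (1 + θ ^ 2) + θ * (w a * (if a = c then 1 else 0) - w a * w c) := by
    intro a
    have hy : |(if a = c then (1 : ℝ) else 0) - w c| ≤ 1 := by
      have := hw c
      rw [abs_le]
      split_ifs <;> constructor <;> linarith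
    generalize (if a = c then (1 : ℝ) else 0) = t at hy ⊢
    have hx : |θ * (t - w c)| ≤ 1 := by
      rw [abs_mul]
      exact mul_le_one₀ hθ (abs_nonneg _) hy
    have hexp := (abs_le.mp (Real.abs_exp_sub_one_sub_id_le hx)).2
    have hsq : (θ * (t - w c)) ^ 2 ≤ θ ^ 2 := by
      rw [mul_pow]
      exact mul_le_of_le_one_right (sq_nonneg θ) ((sq_le_one_iff_abs_le_one _).mpr hy)
    have := mul_le_mul_of_nonneg_left
      (show Real.exp (θ * (t - w c)) ≤ 1 + θ ^ 2 + θ * (t - w c) by linarith) (hw a)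
    linarith
  calc _ ≤ ∑ a, (w a * (1 + θ ^ 2) + θ * (w a * (if a = c then 1 else 0) - w a * w c)) :=
        sum_le_sum fun a _ => hterm a
    _ = θ ^ 2 + 1 := by
        rw [sum_add_distrib, ← sum_mul, ← mul_sum, sum_sub_distrib, ← sum_mul, hsum]
        simp
        ring
    _ ≤ _ := Real.add_one_le_exp _

/-- Exponential moment of the deviation of a colour class inside `S`, for a colouring whose values
are independent with distribution `w`. -/
lemma sum_prod_mul_exp_card_filter_sub_le (w : C → ℝ) (hw : ∀ c, 0 ≤ w c) (hsum : ∑ c, w c = 1)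
    (c : C) (S : Finset V) {θ : ℝ} (hθ : |θ| ≤ 1) :
    ∑ f : V → C, (∏ v, w (f v)) * Real.exp (θ * (#{v ∈ S | f v = c} - w c * #S)) ≤
      Real.exp (θ ^ 2 * #S) := by
  have hfactor : ∀ f : V → C,
      (∏ v, w (f v)) * Real.exp (θ * (#{v ∈ S | f v = c} - w c * #S)) =
        ∏ v, w (f v) *
          (if v ∈ S then Real.exp (θ * ((if f v = c then 1 else 0) - w c)) else 1) := by
    intro f
    rw [prod_mul_distrib, prod_ite_mem, univ_inter, ← Real.exp_sum, ← mul_sum, sum_sub_distrib,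
      sum_boole, sum_const, nsmul_eq_mul, mul_comm (w c)]
  simp_rw [hfactor]
  rw [← Fintype.prod_sum fun v a =>
    w a * (if v ∈ S then Real.exp (θ * ((if a = c then 1 else 0) - w c)) else 1)]
  calc _ ≤ ∏ v, if v ∈ S then Real.exp (θ ^ 2) else 1 := by
        refine prod_le_prod (fun v _ => sum_nonneg fun a _ => ?_) fun v _ => ?_
        · have := hw a
          positivity
        · split_ifs
          · exact sum_mul_exp_indicator_sub_le w hw hsum c hθ
          · simp [hsum]
    _ = _ := by
        rw [prod_ite_mem, univ_inter, prod_const, ← Real.exp_nat_mul, mul_comm]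

/-- If the sets `S j` are large compared with the logarithm of their number, some colouring hits
each of them in every colour with approximately the prescribed density. -/
lemma exists_colouring_card_filter_close (w : C → ℝ) (hw : ∀ c, 0 ≤ w c) (hsum : ∑ c, w c = 1)
    (S : ι → Finset V) {δ m : ℝ} (hδ : 0 < δ) (hδ' : δ ≤ 1) (hm : ∀ j, m ≤ #(S j))
    (hlt : 2 * (Fintype.card ι * Fintype.card C) * Real.exp (-(δ ^ 2 * m / 4)) < 1) :
    ∃ f : V → C, ∀ j c, |(#{v ∈ S j | f v = c} : ℝ) - w c * #(S j)| ≤ δ * #(S j) := by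
  by_contra! hbad
  let X (f : V → C) (j : ι) (c : C) : ℝ := #{v ∈ S j | f v = c} - w c * #(S j)
  let E (θ : ℝ) (f : V → C) (j : ι) (c : C) : ℝ :=
    Real.exp (θ * X f j c) * Real.exp (-(δ / 2 * (δ * #(S j))))
  have htotal : ∑ f : V → C, ∏ v, w (f v) = 1 := by
    rw [← Fintype.prod_sum fun _ : V => w]
    simp [hsum]
  have hone : ∀ f, 1 ≤ ∑ j, ∑ c, (E (δ / 2) f j c + E (-(δ / 2)) f j c) := by
    intro f
    obtain ⟨j, c, hjc⟩ := hbad f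
    have hE : ∀ θ j c, 0 ≤ E θ f j c := fun θ j c => by positivity
    have hnn : ∀ j c, 0 ≤ E (δ / 2) f j c + E (-(δ / 2)) f j c :=
      fun j c => add_nonneg (hE _ _ _) (hE _ _ _)
    refine le_trans ?_ (single_le_sum (fun j _ => sum_nonneg fun c _ => hnn j c) (mem_univ j))
    refine le_trans ?_ (single_le_sum (fun c _ => hnn j c) (mem_univ c))
    rcases lt_abs.mp hjc with h | h
    · refine le_add_of_le_of_nonneg ?_ (hE _ _ _)
      simp only [E]
      rw [← Real.exp_add, Real.one_le_exp_iff]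
      have := mul_le_mul_of_nonneg_left h.le (half_pos hδ).le
      change _ ≤ δ / 2 * X f j c at this
      linarith
    · refine le_add_of_nonneg_of_le (hE _ _ _) ?_
      simp only [E]
      rw [← Real.exp_add, Real.one_le_exp_iff]
      have := mul_le_mul_of_nonneg_left h.le (half_pos hδ).le
      change _ ≤ δ / 2 * -X f j c at this
      linarith
  have hmoment : ∀ θ : ℝ, θ ^ 2 = δ ^ 2 / 4 → ∀ j c,
      ∑ f : V → C, (∏ v, w (f v)) * E θ f j c ≤ Real.exp (-(δ ^ 2 * m / 4)) := by
    intro θ hθ j c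
    have habs : |θ| ≤ 1 := by
      rw [← sq_le_one_iff_abs_le_one, hθ]
      nlinarith
    simp only [E, X, ← mul_assoc]
    rw [← sum_mul]
    refine (mul_le_mul_of_nonneg_right
      (sum_prod_mul_exp_card_filter_sub_le w hw hsum c (S j) habs) (Real.exp_pos _).le).trans ?_
    rw [← Real.exp_add, Real.exp_le_exp, hθ]
    have := mul_le_mul_of_nonneg_left (hm j) (sq_nonneg δ)
    linarith
  refine hlt.not_ge ?_
  calc 1 = ∑ f : V → C, (∏ v, w (f v)) * 1 := by simp [htotal]
    _ ≤ ∑ f : V → C, (∏ v, w (f v)) * ∑ j, ∑ c, (E (δ / 2) f j c + E (-(δ / 2)) f j c) :=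
        sum_le_sum fun f _ =>
          mul_le_mul_of_nonneg_left (hone f) (prod_nonneg fun v _ => hw _)
    _ = ∑ j, ∑ c, (∑ f : V → C, (∏ v, w (f v)) * E (δ / 2) f j c +
          ∑ f : V → C, (∏ v, w (f v)) * E (-(δ / 2)) f j c) := by
        simp_rw [mul_sum, mul_add, ← sum_add_distrib]
        rw [sum_comm]
        exact sum_congr rfl fun j _ => sum_comm
    _ ≤ ∑ _j : ι, ∑ _c : C,
          (Real.exp (-(δ ^ 2 * m / 4)) + Real.exp (-(δ ^ 2 * m / 4))) := by
        gcongr with j _ c _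
        · exact hmoment _ (by ring) j c
        · exact hmoment _ (by ring) j c
    _ = _ := by
        simp only [sum_const, card_univ, nsmul_eq_mul]
        ring

end RandomColouring

theorem random_vertex_partition (b ε : ℝ) (hb : 0 < b) (hε : 0 < ε) :
    ∃ N : ℕ, ∀ (V : Type) [Fintype V] [DecidableEq V] (G : SimpleGraph V)
      [DecidableRel G.Adj] (n d : ℕ),
      n = Fintype.card V → G.IsRegularOfDegree d → N ≤ n →
      Real.log n ^ (1 + 6 * b + 12 * ε) ≤ (d : ℝ) →
      ∃ U : Fin 7 → Finset V,
        (∀ i j : Fin 7, i ≠ j → Disjoint (U i) (U j)) ∧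
        (∀ i : Fin 7,
          |((U i).card : ℝ) - (1 / 7) * ((n : ℝ) / Real.log n ^ (b + ε))| ≤
            (1 / 7) * ((n : ℝ) / Real.log n ^ (2 * b + 4 * ε))) ∧
        (∀ v : V, ∀ i : Fin 7,
          |(degIn G v (U i) : ℝ) - (1 / 7) * ((d : ℝ) / Real.log n ^ (b + ε))| ≤
            (1 / 7) * ((d : ℝ) / Real.log n ^ (2 * b + 4 * ε))) := by
  have hlog : Filter.Tendsto (fun n : ℕ => Real.log n) Filter.atTop Filter.atTop :=
    Real.tendsto_log_atTop.comp tendsto_natCast_atTop_atTop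
  have hpow := (tendsto_rpow_atTop (show 0 < 2 * b + 4 * ε by positivity)).comp hlog
  obtain ⟨N, hN⟩ := Filter.eventually_atTop.mp
    ((hlog.eventually_ge_atTop 1).and ((hpow.eventually_ge_atTop 392).and
      (Filter.eventually_ge_atTop 18)))
  refine ⟨N, fun V _ _ G _ n d hn hreg hNn hd => ?_⟩
  obtain ⟨hL, hbig, hn18⟩ := hN n hNn
  simp only [Function.comp_apply] at hbig
  set L := Real.log n with hLdef
  have hL0 : 0 < L := by linarith
  have hn0 : (0 : ℝ) < n := by positivity
  have hK : 1 ≤ L ^ (b + ε) := Real.one_le_rpow hL (by positivity)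
  have hM : 1 ≤ L ^ (2 * b + 4 * ε) := by linarith
  have hsplit : L ^ (1 + 6 * b + 12 * ε) = L * (L ^ (2 * b + 4 * ε)) ^ 3 := by
    rw [← Real.rpow_natCast, ← Real.rpow_mul hL0.le]
    nth_rw 2 [← Real.rpow_one L]
    rw [← Real.rpow_add hL0]
    congr 1
    push_cast
    ring
  rw [hsplit] at hd
  generalize L ^ (b + ε) = K at hK ⊢
  generalize L ^ (2 * b + 4 * ε) = M at hM hbig hd ⊢
  have hdn : d ≤ n := by
    have : Nonempty V := Fintype.card_pos_iff.mp (by omega)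
    obtain ⟨v⟩ := this
    rw [hn, ← hreg v]
    exact (G.degree_lt_card_verts v).le
  let w : Option (Fin 7) → ℝ := fun o => o.elim (1 - 1 / K) fun _ => 1 / 7 / K
  let S : Option V → Finset V := fun o => o.elim univ fun v => G.neighborFinset v
  have hw : ∀ c, 0 ≤ w c := by
    rintro (_ | c)
    · exact sub_nonneg.mpr ((div_le_one (by linarith)).mpr hK)
    · change 0 ≤ 1 / 7 / K
      positivity
  have hsum : ∑ c, w c = 1 := by
    simp [w, Fintype.sum_option]
    ring
  have hS : ∀ j, (d : ℝ) ≤ #(S j) := by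
    rintro (_ | v)
    · change (d : ℝ) ≤ #(univ : Finset V)
      rw [card_univ, ← hn]
      exact_mod_cast hdn
    · change (d : ℝ) ≤ #(G.neighborFinset v)
      rw [G.card_neighborFinset_eq_degree, hreg v]
  have hexponent : 2 * L ≤ (1 / 7 / M) ^ 2 * d / 4 := by
    have hM0 : 0 < M := by linarith
    calc 2 * L ≤ L * M / 196 := by nlinarith
      _ = (1 / 7 / M) ^ 2 * (L * M ^ 3) / 4 := by
          field_simp
          norm_num
      _ ≤ _ := by gcongr
  have hlt : 2 * ((Fintype.card (Option V) : ℝ) * Fintype.card (Option (Fin 7))) *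
      Real.exp (-((1 / 7 / M) ^ 2 * d / 4)) < 1 := by
    have hn18' : (18 : ℝ) ≤ n := by exact_mod_cast hn18
    have hexp : Real.exp (-((1 / 7 / M) ^ 2 * d / 4)) ≤ ((n : ℝ) ^ 2)⁻¹ := by
      rw [← Real.exp_log (show (0 : ℝ) < ((n : ℝ) ^ 2)⁻¹ by positivity), Real.exp_le_exp,
        Real.log_inv, Real.log_pow, ← hLdef]
      push_cast
      linarith
    rw [Fintype.card_option, Fintype.card_option, Fintype.card_fin, ← hn]
    push_cast
    refine (mul_le_mul_of_nonneg_left hexp (by positivity)).trans_lt ?_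
    rw [← div_eq_mul_inv, div_lt_one (by positivity)]
    nlinarith
  obtain ⟨f, hf⟩ := exists_colouring_card_filter_close w hw hsum S
    (δ := 1 / 7 / M) (by positivity) (by rw [div_div, div_le_one] <;> linarith) hS hlt
  have hcomm : ∀ x y : ℝ, 1 / 7 * (x / y) = 1 / 7 / y * x := fun x y => by ring
  simp only [hcomm]
  refine ⟨fun i => {v | f v = some i}, fun i j hij => ?_, fun i => ?_, fun v i => ?_⟩
  · refine disjoint_filter.mpr fun v _ hi hj => hij ?_
    exact Option.some_injective _ (hi.symm.trans hj)
  · have h := hf none (some i)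
    simpa only [S, w, Option.elim, card_univ, ← hn] using h
  · have h := hf (some v) (some i)
    simp only [S, w, Option.elim, G.card_neighborFinset_eq_degree, hreg v] at h
    rw [degIn, ← filter_mem_eq_inter]
    simpa only [mem_filter, mem_univ, true_and] using h
end
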